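/- r₂(H) = 3 if and only if n has one of the following forms, where p, p₁, p₂, p₃ denote distinct primes ≡ 1 (mod 4), q, q₁, q₂, q₃, q₄ distinct primes ≡ 3 (mod 4), all coprime to l, and δ ∈ {1, 2}: (1) n = 2p with either ((p/l) = −1 and (2/l)₄ = (−1)^((l−1)/8)), or ((p/l) = 1 and ((2/l)₄ ≠ (−1)^((l−1)/8) or (p/l)₄ ≠ (l/p)₄)); (2) n = p₁p₂ with either ((p_i/l) = 1 for i = 1, 2 and (p_i/l)₄ ≠ (l/p_i)₄ for at least one i), or ((p₁/l) = −(p₂/l) = −1 and (p₂/l)₄ = (l/p₂)₄); (3) n = 2p₁p₂ with (p₁/l) = (p₂/l) = −1 and (2/l)₄ ≠ (−1)^((l−1)/8); (4) n = p₁p₂p₃ with either (p_i/l) = −1 for all i ∈ {1,2,3}, or ((p₁/l) = (p₂/l) = −(p₃/l) = −1 and (p₃/l)₄ ≠ (l/p₃)₄); (5) n = δ·q₁q₂q₃ with (q_i/l) = −1 for all i ∈ {1,2,3}; (6) n = q₁q₂q₃q₄ with at most one of the symbols (q_i/l), i ∈ {1,2,3,4}, equal to 1; (7) n = 2q₁q₂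 with (q_i/l) = −1 for at least one i ∈ {1,2}; (8) n = δ·p₁p₂q with (p₁/l) = (p₂/l) = −1 and (q/l) = −1; (9) n = δ·pq with (p/l) ≠ (q/l); (10) n = p₁p₂q₁q₂ with (p₁/l) = (p₂/l) = −1 and at most one of (q₁/l), (q₂/l) equal to 1; (11) n = p·q₁q₂ with either ((p/l) = 1 and at most one of (q₁/l), (q₂/l) equal to 1), or ((p/l) = −1 and (q₁/l) = (q₂/l) = 1). -/

import Mathlib

/-- `ε` is the fundamental unit of the real quadratic field `ℚ(√l)` (viewed inside `ℝ`):
it lies in `ℚ(√l)`, it is a unit of the ring of integers (both `ε` and `ε⁻¹` are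
algebraic integers), `ε > 1`, and it is the smallest such unit. -/
def IsFundamentalUnit (l : ℕ) (ε : ℝ) : Prop :=
  1 < ε ∧ ε ∈ IntermediateField.adjoin ℚ ({Real.sqrt (l : ℝ)} : Set ℝ) ∧
    IsIntegral ℤ ε ∧ IsIntegral ℤ ε⁻¹ ∧
    ∀ x : ℝ, 1 < x → x ∈ IntermediateField.adjoin ℚ ({Real.sqrt (l : ℝ)} : Set ℝ) →
      IsIntegral ℤ x → IsIntegral ℤ x⁻¹ → ε ≤ x

/-- The Legendre symbol `(a/p)`, via Euler's criterion (so that no `Fact p.Prime`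
instance is needed): for an odd prime `p` it is `1` if `a` is a nonzero square mod `p`,
`0` if `p ∣ a`, and `-1` otherwise. -/
def legSym (p : ℕ) (a : ℤ) : ℤ :=
  if (a : ZMod p) ^ ((p - 1) / 2) = 1 then 1 else if (a : ZMod p) = 0 then 0 else -1

/-- The rational fourth power residue symbol `(a/p)₄ ∈ {±1}`, meaningful when
`(a/p) = 1`; it is determined by `(a/p)₄ ≡ a ^ ((p-1)/4) (mod p)`. -/
def quartSym (p : ℕ) (a : ℤ) : ℤ :=
  if (a : ZMod p) ^ ((p - 1) / 4) = 1 then 1 else -1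

/-- The cardinality of the 2-torsion subgroup of the class group of `K`.
For a number field `K` this equals `2 ^ r₂(H)`, where `r₂(H)` is the rank of the
2-class group `H` of `K` (i.e. `dim_{𝔽₂} Cl(K)/Cl(K)²`); in particular
`r₂(H) = r` iff this cardinality is `2 ^ r`. -/
noncomputable def twoTorsCard (K : IntermediateField ℚ ℝ) : ℕ :=
  Nat.card {x : ClassGroup (NumberField.RingOfIntegers K) // x ^ 2 = 1}

namespace GenusCount

open IsDedekindDomain nonZeroDivisors

section Val

variable {R : Type*} [CommRing R] [IsDedekindDomain R] {K : Type*} [Field K] [Algebra R K]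
  [IsFractionRing R K]

/-- The additive valuation of `x` at `v` (with the value `0` at `x = 0`). -/
noncomputable def vord (v : HeightOneSpectrum R) (x : K) : ℤ := -WithZero.log (v.valuation K x)

variable (v : HeightOneSpectrum R)

theorem vord_mul {x y : K} (hx : x ≠ 0) (hy : y ≠ 0) : vord v (x * y) = vord v x + vord v y := by
  unfold vord
  rw [map_mul, WithZero.log_mul (by simpa using hx) (by simpa using hy)]
  ring

@[simp] theorem vord_one : vord v (1 : K) = 0 := by simp [vord]

theorem vord_inv (x : K) : vord v x⁻¹ = -vord v x := by simp [vord, WithZero.log_inv]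

theorem vord_pow (x : K) (n : ℕ) : vord v (x ^ n) = n * vord v x := by
  simp [vord, WithZero.log_pow]

theorem vord_neg (x : K) : vord v (-x) = vord v x := by simp [vord]

theorem vord_eq_count {x : K} (hx : x ≠ 0) :
    vord v x = FractionalIdeal.count K v (FractionalIdeal.spanSingleton R⁰ x) := by
  classical
  obtain ⟨a, b, hb, rfl⟩ := IsFractionRing.div_surjective (A := R) x
  have key : ∀ a : R, a ≠ 0 → vord v (algebraMap R K a) =
      FractionalIdeal.count K v (FractionalIdeal.spanSingleton R⁰ (algebraMap R K a)) := by
    intro a ha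
    rw [← FractionalIdeal.coeIdeal_span_singleton, FractionalIdeal.count_coe K v (by simpa using ha),
      vord, HeightOneSpectrum.valuation_of_algebraMap, v.intValuation_if_neg ha, WithZero.log_exp,
      neg_neg]
  have hb0 : algebraMap R K b ≠ 0 := by
    simpa using nonZeroDivisors.ne_zero hb
  have ha0 : algebraMap R K a ≠ 0 := fun h => hx (by simp [h])
  have h1 : a ≠ 0 := fun h => ha0 (by simp [h])
  have h2 : b ≠ 0 := fun h => hb0 (by simp [h])
  rw [div_eq_mul_inv, vord_mul v ha0 (inv_ne_zero hb0), vord_inv, key a h1, key b h2,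
    ← FractionalIdeal.spanSingleton_mul_spanSingleton, FractionalIdeal.count_mul,
    ← FractionalIdeal.spanSingleton_inv, FractionalIdeal.count_inv]
  · simpa [FractionalIdeal.spanSingleton_eq_zero_iff] using ha0
  · simpa [FractionalIdeal.spanSingleton_eq_zero_iff] using hb0

theorem vord_nonneg_iff {x : K} (hx : x ≠ 0) : 0 ≤ vord v x ↔ v.valuation K x ≤ 1 := by
  rw [vord, neg_nonneg, WithZero.log_le_iff_le_exp (by simpa using hx), WithZero.exp_zero]

theorem vord_pos_iff {x : K} (hx : x ≠ 0) : 0 < vord v x ↔ v.valuation K x < 1 := by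
  rw [vord, neg_pos, WithZero.log_lt_iff_lt_exp (by simpa using hx), WithZero.exp_zero]

theorem vord_eq_zero_iff {x : K} (hx : x ≠ 0) : vord v x = 0 ↔ v.valuation K x = 1 := by
  have h1 := vord_nonneg_iff v hx
  have h2 := vord_pos_iff v hx
  constructor
  · intro h
    exact le_antisymm (h1.1 h.ge) (not_lt.1 fun h' => by have := h2.2 h'; omega)
  · intro h
    have := h1.2 h.le
    have : ¬ 0 < vord v x := fun h' => (h2.1 h').ne h
    omega

theorem vord_algebraMap_nonneg (a : R) : 0 ≤ vord v (algebraMap R K a) := by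
  by_cases h : a = 0
  · simp [h, vord]
  · exact (vord_nonneg_iff v (by simpa using h)).2 (v.valuation_le_one a)

theorem vord_algebraMap_pos {a : R} (ha : a ≠ 0) :
    0 < vord v (algebraMap R K a) ↔ a ∈ v.asIdeal := by
  rw [vord_pos_iff v (by simpa using ha), HeightOneSpectrum.valuation_lt_one_iff_mem]

theorem vord_algebraMap_eq_zero {a : R} (ha : a ∉ v.asIdeal) :
    vord v (algebraMap R K a) = 0 := by
  have h0 : a ≠ 0 := fun h => ha (h ▸ v.asIdeal.zero_mem)
  have := vord_algebraMap_nonneg (K := K) v a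
  have := (vord_algebraMap_pos (K := K) v h0).not.2 ha
  omega

theorem vord_unit (u : Rˣ) : vord v (algebraMap R K u) = 0 :=
  vord_algebraMap_eq_zero v fun h => v.isPrime.ne_top (Ideal.eq_top_of_isUnit_mem _ h u.isUnit)

variable (R K) in
/-- The subgroup of elements generating the square of a fractional ideal. -/
def selmer : Subgroup Kˣ where
  carrier := {x | ∀ v : HeightOneSpectrum R, Even (vord v (x : K))}
  one_mem' := fun v => by simp
  mul_mem' := fun {a b} ha hb v => by
    rw [Units.val_mul, vord_mul v a.ne_zero b.ne_zero]
    exact (ha v).add (hb v)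
  inv_mem' := fun {a} ha v => by
    rw [Units.val_inv_eq_inv_val, vord_inv]
    exact (ha v).neg

theorem mem_selmer {x : Kˣ} :
    x ∈ selmer R K ↔ ∀ v : HeightOneSpectrum R, Even (vord v (x : K)) := Iff.rfl

/-- The subgroup of squares. -/
abbrev squares (G : Type*) [CommGroup G] : Subgroup G := (powMonoidHom 2 : G →* G).range

theorem mem_squares {G : Type*} [CommGroup G] {x : G} : x ∈ squares G ↔ ∃ y, y ^ 2 = x := Iff.rfl

variable (R K) in
/-- The image of the units of `R` in `Kˣ`. -/
def unitGroup : Subgroup Kˣ := (Units.map (algebraMap R K : R →* K)).range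

theorem mem_unitGroup_iff {x : Kˣ} : x ∈ unitGroup R K ↔ ∀ v : HeightOneSpectrum R,
    vord v (x : K) = 0 := by
  constructor
  · rintro ⟨u, rfl⟩ v
    exact vord_unit v u
  · intro h
    have aux : ∀ y : Kˣ, (∀ v : HeightOneSpectrum R, vord v (y : K) = 0) →
        ∃ a : R, algebraMap R K a = y := fun y hy =>
      HeightOneSpectrum.mem_integers_of_valuation_le_one K (y : K) fun v =>
        ((vord_eq_zero_iff v y.ne_zero).1 (hy v)).le
    obtain ⟨a, ha⟩ := aux x h
    obtain ⟨b, hb⟩ := aux x⁻¹ fun v => by rw [Units.val_inv_eq_inv_val, vord_inv, h v, neg_zero]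
    have hab : a * b = 1 := by
      apply FaithfulSMul.algebraMap_injective R K
      rw [map_mul, ha, hb, map_one, Units.mul_inv]
    exact ⟨⟨a, b, hab, mul_comm a b ▸ hab⟩, Units.ext ha⟩

theorem unitGroup_le_selmer : unitGroup R K ≤ selmer R K := fun x hx v => by
  rw [mem_unitGroup_iff.1 hx v]; exact Even.zero

theorem squares_le_selmer : squares Kˣ ≤ selmer R K := by
  rintro _ ⟨y, rfl⟩ v
  simp [vord_pow]

open FractionalIdeal in
theorem fracIdeal_ext {I J : (FractionalIdeal R⁰ K)ˣ}
    (h : ∀ v : HeightOneSpectrum R, count K v (I : FractionalIdeal R⁰ K) = count K v J) :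
    I = J := by
  apply Units.ext
  rw [← finprod_heightOneSpectrum_factorization' K (I := (I : FractionalIdeal R⁰ K)) I.ne_zero,
    ← finprod_heightOneSpectrum_factorization' K (I := (J : FractionalIdeal R⁰ K)) J.ne_zero]
  simp_rw [h]

open FractionalIdeal in
theorem exists_sq_eq_of_even {I : (FractionalIdeal R⁰ K)ˣ}
    (h : ∀ v : HeightOneSpectrum R, Even (count K v (I : FractionalIdeal R⁰ K))) :
    ∃ J, J ^ 2 = I := by
  classical
  have hfin := finite_factors (K := K) (I : FractionalIdeal R⁰ K)
  have hfin' : ∀ᶠ v : HeightOneSpectrum R in Filter.cofinite,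
      count K v (I : FractionalIdeal R⁰ K) / 2 = 0 := by
    filter_upwards [hfin] with v hv
    rw [hv]; rfl
  set J : FractionalIdeal R⁰ K := ∏ᶠ v : HeightOneSpectrum R,
    (v.asIdeal : FractionalIdeal R⁰ K) ^ (count K v (I : FractionalIdeal R⁰ K) / 2) with hJ
  have hc : ∀ v, count K v J = count K v (I : FractionalIdeal R⁰ K) / 2 := fun v =>
    count_finprod K v _ hfin'
  have hJ0 : J ≠ 0 := by
    rw [hJ, finprod_def]
    split_ifs
    · rw [Finset.prod_ne_zero_iff]
      intro v _
      exact zpow_ne_zero _ (by simpa using v.ne_bot)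
    · exact one_ne_zero
  refine ⟨Units.mk0 J hJ0, fracIdeal_ext fun v => ?_⟩
  rw [Units.val_pow_eq_pow_val, Units.val_mk0, count_pow, hc]
  obtain ⟨m, hm⟩ := h v
  push_cast
  omega

theorem card_two_torsion_classGroup [Finite (ClassGroup R)] :
    Nat.card {c : ClassGroup R // c ^ 2 = 1} =
      (unitGroup R K ⊔ squares Kˣ).relIndex (selmer R K) := by
  classical
  set I := (FractionalIdeal R⁰ K)ˣ
  set π := toPrincipalIdeal R K
  set sq : I →* I := powMonoidHom 2
  have hcount : ∀ (x : Kˣ) (v : HeightOneSpectrum R),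
      FractionalIdeal.count K v ((π x : I) : FractionalIdeal R⁰ K) = vord v (x : K) := by
    intro x v
    rw [vord_eq_count v x.ne_zero, coe_toPrincipalIdeal]
  have hcsq : ∀ (J : I) (v : HeightOneSpectrum R),
      FractionalIdeal.count K v ((sq J : I) : FractionalIdeal R⁰ K) =
        2 * FractionalIdeal.count K v (J : FractionalIdeal R⁰ K) := by
    intro J v
    change FractionalIdeal.count K v ((J ^ 2 : I) : FractionalIdeal R⁰ K) = _
    rw [Units.val_pow_eq_pow_val, FractionalIdeal.count_pow]
    rfl
  have hsqinj : Function.Injective sq := by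
    intro a b hab
    apply fracIdeal_ext
    intro v
    have h := congrArg (fun c : I => FractionalIdeal.count K v (c : FractionalIdeal R⁰ K)) hab
    simp only [hcsq] at h
    omega
  have hπ : π.ker = unitGroup R K := by
    ext x
    rw [MonoidHom.mem_ker, mem_unitGroup_iff]
    constructor
    · intro h v
      rw [← hcount, h]; simp [FractionalIdeal.count_one]
    · intro h
      exact fracIdeal_ext fun v => by rw [hcount, h]; simp [FractionalIdeal.count_one]
  -- the class group side
  have h1 : Nat.card {c : ClassGroup R // c ^ 2 = 1} = π.range.relIndex (π.range.comap sq) := by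
    have e : {c : ClassGroup R // c ^ 2 = 1} ≃ {c : I ⧸ π.range // c ^ 2 = 1} :=
      (ClassGroup.equiv K).toEquiv.subtypeEquiv fun c => by
        change _ ↔ (ClassGroup.equiv K c) ^ 2 = 1
        rw [← map_pow, map_eq_one_iff _ (ClassGroup.equiv K).injective]
    rw [Nat.card_congr e]
    have := Subgroup.relIndex_ker (π.range.comap sq) (QuotientGroup.mk' π.range)
    rw [QuotientGroup.ker_mk'] at this
    rw [this]
    apply Nat.card_congr
    apply Equiv.subtypeEquivRight
    intro c
    constructor
    · intro hc
      obtain ⟨J, rfl⟩ := QuotientGroup.mk'_surjective _ c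
      refine ⟨J, ?_, rfl⟩
      rw [← map_pow] at hc
      exact (QuotientGroup.eq_one_iff (J ^ 2)).1 hc
    · rintro ⟨J, hJ, rfl⟩
      rw [← map_pow]
      exact (QuotientGroup.eq_one_iff (J ^ 2)).2 hJ
  have h2 : (π.range.map sq).relIndex ((π.range.comap sq).map sq) =
      π.range.relIndex (π.range.comap sq) := by
    rw [← Subgroup.relIndex_comap, Subgroup.comap_map_eq_self_of_injective hsqinj]
  have h3 : (π.range.comap sq).map sq = (selmer R K).map π := by
    ext J
    constructor
    · rintro ⟨J', ⟨x, hx⟩, rfl⟩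
      refine ⟨x, fun v => ?_, hx⟩
      rw [← hcount, hx, hcsq]
      exact even_two_mul _
    · rintro ⟨x, hx, rfl⟩
      obtain ⟨J, hJ⟩ := exists_sq_eq_of_even (I := π x) fun v => by rw [hcount]; exact hx v
      exact ⟨J, ⟨x, hJ.symm⟩, hJ⟩
  have h4 : (π.range.map sq).comap π = unitGroup R K ⊔ squares Kˣ := by
    ext x
    constructor
    · rintro ⟨_, ⟨y, rfl⟩, hy⟩
      have : x * (y ^ 2)⁻¹ ∈ unitGroup R K := by
        rw [← hπ, MonoidHom.mem_ker, map_mul, map_inv, map_pow, ← hy]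
        simp [sq]
      have hx : x = (x * (y ^ 2)⁻¹) * y ^ 2 := by simp
      rw [hx]
      exact Subgroup.mul_mem_sup this ⟨y, rfl⟩
    · intro hx
      obtain ⟨u, hu, _, ⟨y, rfl⟩, rfl⟩ := Subgroup.mem_sup.1 hx
      rw [← hπ, MonoidHom.mem_ker] at hu
      refine ⟨π y, ⟨y, rfl⟩, ?_⟩
      rw [map_mul, hu]
      simp [sq]
  rw [h1, ← h2, h3, ← h4, Subgroup.relIndex_comap]

end Val

end GenusCount

namespace GenusCount

open IsDedekindDomain nonZeroDivisors

section Units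

open NumberField

variable (K : Type*) [Field K] [NumberField K]

theorem card_torsion_two : Nat.card (powMonoidHom 2 : Units.torsion K →* _).ker = 2 := by
  have hneg : ((-1 : (𝓞 K)ˣ)) ∈ Units.torsion K := by
    rw [Units.torsion, CommGroup.mem_torsion, isOfFinOrder_iff_pow_eq_one]
    exact ⟨2, by norm_num, by simp⟩
  have hne : (1 : Units.torsion K) ≠ ⟨-1, hneg⟩ := by
    intro h
    have h := congrArg (fun x : Units.torsion K => (((x : (𝓞 K)ˣ) : 𝓞 K) : K)) h
    simp at h
    norm_num [eq_neg_iff_add_eq_zero] at h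
  rw [Nat.card_eq_two_iff]
  refine ⟨1, ⟨⟨-1, hneg⟩, ?_⟩, ?_, ?_⟩
  · rw [MonoidHom.mem_ker]
    apply Subtype.ext
    simp
  · intro h
    exact hne (congrArg Subtype.val h)
  · ext ⟨x, hx⟩
    simp only [Set.mem_insert_iff, Set.mem_singleton_iff, Set.mem_univ, iff_true]
    rw [MonoidHom.mem_ker] at hx
    have h1 : (((x : (𝓞 K)ˣ) : 𝓞 K)) ^ 2 = 1 := by
      have := congrArg (fun x : Units.torsion K => ((x : (𝓞 K)ˣ) : 𝓞 K)) hx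
      simpa using this
    rcases sq_eq_sq_iff_eq_or_eq_neg.1 (h1.trans (one_pow 2).symm) with h | h
    · left
      apply Subtype.ext
      apply Subtype.ext
      apply Units.ext
      simpa using h
    · right
      apply Subtype.ext
      apply Subtype.ext
      apply Units.ext
      simpa using h

theorem exists_hom_of_basis {Q : Type*} [CommGroup Q] {r : ℕ}
    (b : Module.Basis (Fin r) ℤ (Additive Q)) :
    ∃ f : Q →* Multiplicative (Fin r → ℤ), Function.Bijective f :=
  ⟨(AddEquiv.toMultiplicative b.equivFun.toAddEquiv).toMonoidHom,
    (AddEquiv.toMultiplicative b.equivFun.toAddEquiv).bijective⟩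

theorem index_squares_sup {G : Type*} [CommGroup G] (T : Subgroup G) {r : ℕ}
    (f : G ⧸ T →* Multiplicative (Fin r → ℤ)) (hf : Function.Bijective f) :
    (squares G ⊔ T).index = 2 ^ r := by
  let φ : Multiplicative (Fin r → ℤ) →* Multiplicative (Fin r → ZMod 2) :=
    AddMonoidHom.toMultiplicative ((Int.castAddHom (ZMod 2)).compLeft (Fin r))
  have hφ : Function.Surjective φ := by
    intro g
    choose h hh using fun i => ZMod.intCast_surjective (g.toAdd i)
    exact ⟨Multiplicative.ofAdd h, congrArg Multiplicative.ofAdd (funext hh)⟩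
  let ψ : G →* Multiplicative (Fin r → ZMod 2) := φ.comp (f.comp (QuotientGroup.mk' T))
  have hψ : Function.Surjective ψ :=
    hφ.comp (hf.surjective.comp (QuotientGroup.mk'_surjective T))
  have hker : ψ.ker = squares G ⊔ T := by
    apply le_antisymm
    · intro x hx
      have hx0 : ψ x = 1 := hx
      have h2 : ∀ i, ∃ m : ℤ, (f (QuotientGroup.mk' T x)).toAdd i = 2 * m := fun i =>
        (ZMod.intCast_zmod_eq_zero_iff_dvd _ 2).1 (congrFun (congrArg Multiplicative.toAdd hx0) i)
      choose m hm using h2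
      obtain ⟨y', hy'⟩ := hf.surjective (Multiplicative.ofAdd m)
      obtain ⟨y, rfl⟩ := QuotientGroup.mk'_surjective _ y'
      have hxy : QuotientGroup.mk' T x = QuotientGroup.mk' T (y ^ 2) := by
        apply hf.injective
        rw [map_pow, map_pow, hy']
        apply Multiplicative.toAdd.injective
        ext i
        rw [hm i]
        simp
      have hxy' := QuotientGroup.eq.1 hxy
      have : x = y ^ 2 * (x⁻¹ * y ^ 2)⁻¹ := by group
      rw [this]
      exact Subgroup.mul_mem_sup ⟨y, rfl⟩ (inv_mem hxy')
    · rw [sup_le_iff]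
      constructor
      · rintro _ ⟨y, rfl⟩
        rw [MonoidHom.mem_ker, powMonoidHom_apply, map_pow]
        apply Multiplicative.toAdd.injective
        ext i
        simp only [toAdd_pow, Pi.smul_apply, toAdd_one, Pi.zero_apply, nsmul_eq_mul]
        have : ((2 : ℕ) : ZMod 2) = 0 := by decide
        rw [this, zero_mul]
      · intro x hx
        have h1 : QuotientGroup.mk' T x = 1 := (QuotientGroup.eq_one_iff x).2 hx
        rw [MonoidHom.mem_ker]
        change φ (f (QuotientGroup.mk' T x)) = 1
        rw [h1, map_one, map_one]
  rw [← hker, Subgroup.index_ker, MonoidHom.range_eq_top.2 hψ, Subgroup.card_top]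
  simp

theorem index_squares_sup_torsion :
    (squares (𝓞 K)ˣ ⊔ Units.torsion K).index = 2 ^ Units.rank K := by
  obtain ⟨f, hf⟩ := exists_hom_of_basis (Units.basisModTorsion K)
  exact index_squares_sup _ f hf

theorem index_squares_units : (squares (𝓞 K)ˣ).index = 2 ^ (Units.rank K + 1) := by
  rw [← Subgroup.relIndex_mul_index (le_sup_left : squares (𝓞 K)ˣ ≤ _ ⊔ Units.torsion K),
    index_squares_sup_torsion, pow_succ, mul_comm, Subgroup.relIndex_sup_left]
  congr 1
  rw [Subgroup.relIndex]
  have : (squares (𝓞 K)ˣ).subgroupOf (Units.torsion K) =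
      (powMonoidHom 2 : Units.torsion K →* _).range := by
    ext ⟨x, hx⟩
    rw [Subgroup.mem_subgroupOf]
    constructor
    · rintro ⟨y, hy⟩
      have hy' : y ^ 2 = x := hy
      have : y ∈ Units.torsion K := by
        rw [Units.torsion, CommGroup.mem_torsion] at hx ⊢
        rw [← hy'] at hx
        exact (isOfFinOrder_pow.1 hx).resolve_right (by norm_num)
      exact ⟨⟨y, this⟩, Subtype.ext hy⟩
    · rintro ⟨y, hy⟩
      exact ⟨y, congrArg Subtype.val hy⟩
  rw [this, Subgroup.index_range, card_torsion_two]

theorem relIndex_squares_units :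
    (squares Kˣ).relIndex (unitGroup (𝓞 K) K) = 2 ^ (Units.rank K + 1) := by
  rw [← index_squares_units K, unitGroup, MonoidHom.range_eq_map, ← Subgroup.relIndex_comap,
    Subgroup.relIndex_top_right]
  congr 1
  ext u
  constructor
  · rintro ⟨y, hy⟩
    have hy2 : y ^ 2 = Units.map (algebraMap (𝓞 K) K : 𝓞 K →* K) u := hy
    have hyE : y ∈ unitGroup (𝓞 K) K := by
      rw [mem_unitGroup_iff]
      intro v
      have h1 := vord_unit (K := K) v u
      have h2 : ((y : K)) ^ 2 = algebraMap (𝓞 K) K u := congrArg Units.val hy2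
      rw [← h2, vord_pow] at h1
      push_cast at h1
      omega
    obtain ⟨w, rfl⟩ := hyE
    refine ⟨w, ?_⟩
    rw [← map_pow] at hy2
    exact Units.map_injective (FaithfulSMul.algebraMap_injective (𝓞 K) K) hy2
  · rintro ⟨y, rfl⟩
    exact ⟨Units.map (algebraMap (𝓞 K) K : 𝓞 K →* K) y, by simp⟩

end Units

end GenusCount

namespace GenusCount

open IsDedekindDomain nonZeroDivisors NumberField

section Val

variable {R : Type*} [CommRing R] [IsDedekindDomain R] {K : Type*} [Field K] [Algebra R K]
  [IsFractionRing R K]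

theorem le_vord_iff (v : HeightOneSpectrum R) {a : R} (ha : a ≠ 0) (n : ℕ) :
    (n : ℤ) ≤ vord v (algebraMap R K a) ↔ a ∈ v.asIdeal ^ n := by
  rw [← v.intValuation_le_pow_iff_mem, ← v.valuation_of_algebraMap (K := K), vord, le_neg,
    WithZero.log_le_iff_le_exp (by simpa using ha)]

theorem vord_comap {S : Type*} [CommRing S] [IsDedekindDomain S] {L : Type*} [Field L]
    [Algebra S L] [IsFractionRing S L] (e : R ≃+* S) (f : K ≃+* L)
    (hef : ∀ a, f (algebraMap R K a) = algebraMap S L (e a)) (w : HeightOneSpectrum S) (x : K) :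
    vord w (f x) = vord (w.comap (e : R →+* S) e.surjective) x := by
  have key : ∀ a : R, a ≠ 0 → vord w (f (algebraMap R K a)) =
      vord (w.comap (e : R →+* S) e.surjective) (algebraMap R K a) := by
    intro a ha
    have hea : e a ≠ 0 := by simpa using ha
    rw [hef]
    have h : ∀ n : ℕ, (n : ℤ) ≤ vord w (algebraMap S L (e a)) ↔
        (n : ℤ) ≤ vord (w.comap (e : R →+* S) e.surjective) (algebraMap R K a) := by
      intro n
      rw [le_vord_iff w hea, le_vord_iff _ ha]
      change _ ↔ a ∈ (w.asIdeal.comap e) ^ n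
      have h2 : ∀ I : Ideal S, I.comap (e : R →+* S) = I.map (e.symm : S →+* R) := fun I => by
        exact (Ideal.map_symm e (I := I)).symm
      have h3 : (w.asIdeal.comap (e : R →+* S)) ^ n = (w.asIdeal ^ n).comap (e : R →+* S) := by
        rw [h2, h2, Ideal.map_pow]
      change _ ↔ a ∈ (w.asIdeal.comap (e : R →+* S)) ^ n
      rw [h3]
      rfl
    have h1 := vord_algebraMap_nonneg (K := L) w (e a)
    have h2 := vord_algebraMap_nonneg (K := K) (w.comap (e : R →+* S) e.surjective) a
    apply le_antisymm
    · have := (h (vord w (algebraMap S L (e a))).toNat).1 (by omega)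
      omega
    · have := (h (vord (w.comap (e : R →+* S) e.surjective) (algebraMap R K a)).toNat).2 (by omega)
      omega
  obtain ⟨a, b, hb, rfl⟩ := IsFractionRing.div_surjective (A := R) x
  have h2 : b ≠ 0 := nonZeroDivisors.ne_zero hb
  by_cases h1 : a = 0
  · simp [h1, vord]
  have ha0 : algebraMap R K a ≠ 0 := by simpa using h1
  have hb0 : algebraMap R K b ≠ 0 := by simpa using h2
  rw [map_div₀, div_eq_mul_inv, div_eq_mul_inv, vord_mul _ (by simpa using ha0) (by simpa using hb0),
    vord_mul _ ha0 (inv_ne_zero hb0), vord_inv, vord_inv, key a h1, key b h2]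

end Val

section Ext

variable {k K : Type*} [Field k] [NumberField k] [Field K] [NumberField K] [Algebra k K]

/-- The ramification index of `w` over the base field. -/
noncomputable def ram (k : Type*) [Field k] [NumberField k] [Algebra k K]
    (w : HeightOneSpectrum (𝓞 K)) : ℕ :=
  (w.under (𝓞 k)).asIdeal.ramificationIdx' w.asIdeal

instance (w : HeightOneSpectrum (𝓞 K)) : w.asIdeal.LiesOver (w.under (𝓞 k)).asIdeal := ⟨rfl⟩

theorem vord_algebraMap (w : HeightOneSpectrum (𝓞 K)) (x : k) :
    vord w (algebraMap k K x) = ram k w * vord (w.under (𝓞 k)) x := by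
  rw [vord, ← HeightOneSpectrum.valuation_liesOver K (w.under (𝓞 k)) w x, WithZero.log_pow, vord,
    ram]
  simp

theorem exists_over (P : HeightOneSpectrum (𝓞 k)) :
    ∃ w : HeightOneSpectrum (𝓞 K), w.under (𝓞 k) = P := by
  obtain ⟨Q, hQ, hQP⟩ := Ideal.exists_ideal_over_prime_of_isIntegral_of_isDomain
    (S := 𝓞 K) P.asIdeal (by
      rw [(RingHom.injective_iff_ker_eq_bot _).1 (FaithfulSMul.algebraMap_injective (𝓞 k) (𝓞 K))]
      exact bot_le)
  refine ⟨⟨Q, hQ, ?_⟩, HeightOneSpectrum.ext hQP⟩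
  rintro rfl
  apply P.ne_bot
  rw [← hQP]
  exact (RingHom.injective_iff_ker_eq_bot _).1 (FaithfulSMul.algebraMap_injective (𝓞 k) (𝓞 K))

theorem sum_ram (P : HeightOneSpectrum (𝓞 k)) :
    ∑ Q ∈ IsDedekindDomain.primesOverFinset P.asIdeal (𝓞 K),
      P.asIdeal.ramificationIdx' Q * P.asIdeal.inertiaDeg' Q = Module.finrank k K :=
  have := P.isMaximal
  Ideal.sum_ramification_inertia (𝓞 K) k K P.ne_bot

theorem mem_primesOverFinset (w : HeightOneSpectrum (𝓞 K)) :
    w.asIdeal ∈ IsDedekindDomain.primesOverFinset (w.under (𝓞 k)).asIdeal (𝓞 K) := by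
  have := (w.under (𝓞 k)).isMaximal
  exact (IsDedekindDomain.mem_primesOverFinset_iff (w.under (𝓞 k)).ne_bot _).2 ⟨w.isPrime, ⟨rfl⟩⟩

theorem ram_pos (w : HeightOneSpectrum (𝓞 K)) : 0 < ram k w :=
  Nat.pos_of_ne_zero (Ideal.IsDedekindDomain.ramificationIdx'_ne_zero_of_liesOver _ (w.under (𝓞 k)).ne_bot)

/-- The inertia degree of `w` over the base field. -/
noncomputable def inert (k : Type*) [Field k] [NumberField k] [Algebra k K]
    (w : HeightOneSpectrum (𝓞 K)) : ℕ :=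
  (w.under (𝓞 k)).asIdeal.inertiaDeg' w.asIdeal

theorem inert_pos (w : HeightOneSpectrum (𝓞 K)) : 0 < inert k w := by
  have := (w.under (𝓞 k)).isMaximal
  have := w.isMaximal
  exact Nat.pos_of_ne_zero (Ideal.inertiaDeg'_ne_zero _ _)

theorem ram_mul_inert_le (w : HeightOneSpectrum (𝓞 K)) :
    ram k w * inert k w ≤ Module.finrank k K := by
  rw [← sum_ram (K := K) (w.under (𝓞 k))]
  exact Finset.single_le_sum (f := fun Q => (w.under (𝓞 k)).asIdeal.ramificationIdx' Q *
    (w.under (𝓞 k)).asIdeal.inertiaDeg' Q) (fun _ _ => Nat.zero_le _) (mem_primesOverFinset w)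

theorem ram_add_ram_le {w w' : HeightOneSpectrum (𝓞 K)} (hww : w ≠ w')
    (h : w.under (𝓞 k) = w'.under (𝓞 k)) :
    ram k w * inert k w + ram k w' * inert k w' ≤ Module.finrank k K := by
  classical
  rw [← sum_ram (K := K) (w.under (𝓞 k))]
  have h1 := mem_primesOverFinset (k := k) w
  have h2 := mem_primesOverFinset (k := k) w'
  have hne : w.asIdeal ≠ w'.asIdeal := fun h => hww (HeightOneSpectrum.ext h)
  rw [← h] at h2
  have := Finset.sum_le_sum_of_subset (f := fun Q => (w.under (𝓞 k)).asIdeal.ramificationIdx' Q *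
    (w.under (𝓞 k)).asIdeal.inertiaDeg' Q) (Finset.insert_subset h1 (Finset.singleton_subset_iff.2 h2))
  rw [Finset.sum_pair hne] at this
  rw [ram, ram, inert, inert, ← h]
  exact this

theorem eq_of_ram_eq (hd : Module.finrank k K = 2) {w w' : HeightOneSpectrum (𝓞 K)}
    (hw : ram k w = 2) (h : w.under (𝓞 k) = w'.under (𝓞 k)) : w = w' := by
  by_contra hww
  have h1 := ram_add_ram_le hww h
  have h2 := ram_pos (k := k) w'
  have h3 := inert_pos (k := k) w'
  have h4 := inert_pos (k := k) w
  rw [hw, hd] at h1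
  nlinarith

theorem inert_eq_one (hd : Module.finrank k K = 2) {w : HeightOneSpectrum (𝓞 K)}
    (hw : ram k w = 2) : inert k w = 1 := by
  have h1 := ram_mul_inert_le (k := k) w
  have h4 := inert_pos (k := k) w
  rw [hw, hd] at h1
  omega

theorem ram_le (hd : Module.finrank k K = 2) (w : HeightOneSpectrum (𝓞 K)) : ram k w ≤ 2 := by
  have h1 := ram_mul_inert_le (k := k) w
  have h4 := inert_pos (k := k) w
  rw [hd] at h1
  nlinarith

theorem exists_sub_mem_of_inert {w : HeightOneSpectrum (𝓞 K)} (hw : inert k w = 1) (x : 𝓞 K) :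
    ∃ a : 𝓞 k, x - algebraMap (𝓞 k) (𝓞 K) a ∈ w.asIdeal := by
  have := (w.under (𝓞 k)).isMaximal
  have := w.isMaximal
  rw [inert, Ideal.inertiaDeg'_algebraMap] at hw
  letI : Field (𝓞 k ⧸ (w.under (𝓞 k)).asIdeal) := Ideal.Quotient.field _
  letI : Field (𝓞 K ⧸ w.asIdeal) := Ideal.Quotient.field _
  obtain ⟨c, hc⟩ := (finrank_eq_one_iff_of_nonzero' (1 : 𝓞 K ⧸ w.asIdeal) one_ne_zero).1 hw
    (Ideal.Quotient.mk _ x)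
  obtain ⟨a, rfl⟩ := Ideal.Quotient.mk_surjective c
  refine ⟨a, Ideal.Quotient.eq.1 ?_⟩
  rw [← hc, Algebra.smul_def, mul_one]
  rfl

end Ext

end GenusCount

namespace GenusCount

open IsDedekindDomain nonZeroDivisors NumberField

/-- A quadratic extension `K = k(δ)`, `δ² = d`, together with its nontrivial automorphism. -/
structure QuadExt (k K : Type*) [Field k] [Field K] [Algebra k K] where
  /-- the radicand -/
  d : k
  /-- the square root of the radicand -/
  δ : K
  /-- the nontrivial automorphism -/
  σ : K ≃ₐ[k] K
  sq : δ ^ 2 = algebraMap k K d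
  not_sq : ¬IsSquare d
  gen : ∀ y : K, ∃ u v : k, y = algebraMap k K u + algebraMap k K v * δ
  map_δ : σ δ = -δ

namespace QuadExt

section Field

variable {k K : Type*} [Field k] [Field K] [Algebra k K] (Q : QuadExt k K)

theorem d_ne_zero : Q.d ≠ 0 := fun h => Q.not_sq (h ▸ ⟨0, by simp⟩)

theorem δ_ne_zero : Q.δ ≠ 0 := fun h => by
  have := Q.sq
  rw [h, zero_pow two_ne_zero, eq_comm, map_eq_zero] at this
  exact Q.d_ne_zero this

theorem δ_notMem (x : k) : algebraMap k K x ≠ Q.δ := fun h => Q.not_sq ⟨x, by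
  apply (algebraMap k K).injective
  rw [← Q.sq, ← h, map_mul, pow_two]⟩

theorem σ_apply (u v : k) : Q.σ (algebraMap k K u + algebraMap k K v * Q.δ) =
    algebraMap k K u - algebraMap k K v * Q.δ := by
  rw [map_add, map_mul, AlgEquiv.commutes, AlgEquiv.commutes, Q.map_δ]
  ring

theorem σ_σ (x : K) : Q.σ (Q.σ x) = x := by
  obtain ⟨u, v, rfl⟩ := Q.gen x
  rw [σ_apply, sub_eq_add_neg, ← neg_mul, ← map_neg, σ_apply, map_neg, neg_mul, sub_neg_eq_add]

theorem eq_zero_of {u v : k} (h : algebraMap k K u + algebraMap k K v * Q.δ = 0) :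
    u = 0 ∧ v = 0 := by
  have hv : v = 0 := by
    by_contra hv
    apply Q.δ_notMem (-u / v)
    have : algebraMap k K v ≠ 0 := by simpa using hv
    rw [map_div₀, map_neg]
    field_simp
    linear_combination -h
  subst hv
  simpa using h

theorem exists_nm (y : K) : ∃ c : k, algebraMap k K c = y * Q.σ y := by
  obtain ⟨u, v, rfl⟩ := Q.gen y
  refine ⟨u ^ 2 - Q.d * v ^ 2, ?_⟩
  rw [σ_apply, map_sub, map_mul, ← Q.sq, map_pow, map_pow]
  ring

/-- The relative norm. -/
noncomputable def nm : K →* k where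
  toFun y := (Q.exists_nm y).choose
  map_one' := by
    apply (algebraMap k K).injective
    rw [(Q.exists_nm 1).choose_spec]
    simp
  map_mul' x y := by
    apply (algebraMap k K).injective
    refine (Q.exists_nm (x * y)).choose_spec.trans ?_
    rw [map_mul (algebraMap k K), (Q.exists_nm x).choose_spec, (Q.exists_nm y).choose_spec,
      map_mul Q.σ]
    ring

theorem algebraMap_nm (y : K) : algebraMap k K (Q.nm y) = y * Q.σ y :=
  (Q.exists_nm y).choose_spec

theorem nm_apply (u v : k) :
    Q.nm (algebraMap k K u + algebraMap k K v * Q.δ) = u ^ 2 - Q.d * v ^ 2 := by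
  apply (algebraMap k K).injective
  rw [algebraMap_nm, σ_apply, map_sub, map_mul, ← Q.sq, map_pow, map_pow]
  ring

theorem nm_algebraMap (u : k) : Q.nm (algebraMap k K u) = u ^ 2 := by
  have := Q.nm_apply u 0
  simpa using this

/-- The relative norm on units. -/
noncomputable def nmU : Kˣ →* kˣ := Units.map Q.nm

theorem val_nmU (x : Kˣ) : (Q.nmU x : k) = Q.nm (x : K) := rfl

/-- A form of Hilbert's theorem 90 for elements of norm a square. -/
theorem exists_of_nm_eq_sq {γ : K} (hγ : γ ≠ 0) {c : k} (h : Q.nm γ = c ^ 2) (h2 : (2 : k) ≠ 0) :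
    ∃ a : k, a ≠ 0 ∧ ∃ β : K, β ≠ 0 ∧ γ = algebraMap k K a * β ^ 2 := by
  have hN := Q.algebraMap_nm γ
  have hσ : Q.σ γ ≠ 0 := by simpa using hγ
  have hc : c ≠ 0 := by
    rintro rfl
    rw [h] at hN
    simp at hN
    tauto
  have hcK : algebraMap k K c ≠ 0 := by simpa using hc
  by_cases hs : γ + algebraMap k K c = 0
  · refine ⟨-c, neg_ne_zero.2 hc, 1, one_ne_zero, ?_⟩
    rw [map_neg]; linear_combination hs
  · refine ⟨c / Q.nm (γ + algebraMap k K c), ?_, γ + algebraMap k K c, hs, ?_⟩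
    · apply div_ne_zero hc
      intro h0
      have := Q.algebraMap_nm (γ + algebraMap k K c)
      rw [h0, map_zero, eq_comm, mul_eq_zero] at this
      rcases this with h1 | h1
      · exact hs h1
      · exact hs ((map_eq_zero Q.σ).1 h1)
    · have hs' : Q.σ (γ + algebraMap k K c) ≠ 0 := fun h1 => hs ((map_eq_zero Q.σ).1 h1)
      rw [h, map_pow] at hN
      rw [map_add, AlgEquiv.commutes] at hs'
      rw [map_div₀, algebraMap_nm, map_add, AlgEquiv.commutes]
      field_simp
      linear_combination -hN

include Q in
theorem finrank_eq : Module.finrank k K = 2 := by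
  have h1 : LinearIndependent k ![(1 : K), Q.δ] := by
    rw [LinearIndependent.pair_iff]
    intro s t h
    apply Q.eq_zero_of
    simpa [Algebra.smul_def] using h
  have h2 : ⊤ ≤ Submodule.span k (Set.range ![(1 : K), Q.δ]) := by
    intro y _
    obtain ⟨u, v, rfl⟩ := Q.gen y
    rw [Matrix.range_cons, Matrix.range_cons, Matrix.range_empty, Set.union_empty,
      Set.singleton_union, Submodule.mem_span_pair]
    exact ⟨u, v, by simp [Algebra.smul_def]⟩
  rw [Module.finrank_eq_card_basis (Module.Basis.mk h1 h2)]
  simp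

end Field

section NF

variable {k K : Type*} [Field k] [NumberField k] [Field K] [NumberField K] [Algebra k K]
  (Q : QuadExt k K)

/-- The action of `σ` on integers. -/
noncomputable def σR : 𝓞 K ≃+* 𝓞 K := RingOfIntegers.mapRingEquiv Q.σ.toRingEquiv

theorem σR_apply (x : 𝓞 K) : ((Q.σR x : 𝓞 K) : K) = Q.σ x := rfl

theorem σR_σR (x : 𝓞 K) : Q.σR (Q.σR x) = x := by
  apply RingOfIntegers.ext
  rw [σR_apply, σR_apply, σ_σ]

theorem σR_algebraMap (a : 𝓞 k) : Q.σR (algebraMap (𝓞 k) (𝓞 K) a) = algebraMap _ _ a := by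
  apply RingOfIntegers.ext
  exact Q.σ.commutes a

/-- The action of `σ` on primes. -/
noncomputable def sw (w : HeightOneSpectrum (𝓞 K)) : HeightOneSpectrum (𝓞 K) :=
  w.comap (Q.σR : 𝓞 K →+* 𝓞 K) Q.σR.surjective

theorem mem_sw {w : HeightOneSpectrum (𝓞 K)} {x : 𝓞 K} :
    x ∈ (Q.sw w).asIdeal ↔ Q.σR x ∈ w.asIdeal := Iff.rfl

theorem vord_σ (w : HeightOneSpectrum (𝓞 K)) (x : K) : vord w (Q.σ x) = vord (Q.sw w) x :=
  vord_comap Q.σR Q.σ.toRingEquiv (fun _ => rfl) w x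

theorem under_sw (w : HeightOneSpectrum (𝓞 K)) : (Q.sw w).under (𝓞 k) = w.under (𝓞 k) := by
  ext x
  change algebraMap (𝓞 k) (𝓞 K) x ∈ (Q.sw w).asIdeal ↔ algebraMap (𝓞 k) (𝓞 K) x ∈ w.asIdeal
  rw [mem_sw, σR_algebraMap]

omit [NumberField k] [NumberField K] in
theorem exists_integer_of_algebraMap {c : k} {x : 𝓞 K} (h : algebraMap k K c = x) :
    ∃ a : 𝓞 k, (a : k) = c ∧ algebraMap (𝓞 k) (𝓞 K) a = x := by
  have hc : IsIntegral ℤ c := by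
    rw [← isIntegral_algebraMap_iff (algebraMap k K).injective, h]
    exact x.isIntegral_coe
  exact ⟨⟨c, hc⟩, rfl, RingOfIntegers.ext h⟩

theorem eq_or_eq_sw {w w' : HeightOneSpectrum (𝓞 K)} (h : w.under (𝓞 k) = w'.under (𝓞 k)) :
    w' = w ∨ w' = Q.sw w := by
  have key : (w'.asIdeal : Set (𝓞 K)) ⊆ w.asIdeal ∪ (Q.sw w).asIdeal := by
    intro x hx
    have h1 : algebraMap k K (Q.nm x) = ((x * Q.σR x : 𝓞 K) : K) := Q.algebraMap_nm x
    obtain ⟨a, -, ha⟩ := exists_integer_of_algebraMap h1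
    have h2 : a ∈ (w'.under (𝓞 k)).asIdeal := by
      change algebraMap (𝓞 k) (𝓞 K) a ∈ w'.asIdeal
      rw [ha]
      exact Ideal.mul_mem_right _ _ hx
    rw [← h] at h2
    have h3 : algebraMap (𝓞 k) (𝓞 K) a ∈ w.asIdeal := h2
    rw [ha] at h3
    exact w.isPrime.mem_or_mem h3
  rcases (Ideal.subset_union).1 key with h1 | h1
  · left
    exact HeightOneSpectrum.ext (w'.isMaximal.eq_of_le w.isPrime.ne_top h1)
  · right
    exact HeightOneSpectrum.ext (w'.isMaximal.eq_of_le (Q.sw w).isPrime.ne_top h1)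

theorem sw_eq_of_even {w : HeightOneSpectrum (𝓞 K)} (hw : Even (ram k w)) : Q.sw w = w := by
  have h1 := ram_le Q.finrank_eq w
  have h2 := ram_pos (k := k) w
  obtain ⟨m, hm⟩ := hw
  exact (eq_of_ram_eq Q.finrank_eq (by omega) (Q.under_sw w).symm).symm

include Q in
theorem ram_eq_of_even {w : HeightOneSpectrum (𝓞 K)} (hw : Even (ram k w)) : ram k w = 2 := by
  have h1 := ram_le Q.finrank_eq w
  have h2 := ram_pos (k := k) w
  obtain ⟨m, hm⟩ := hw
  omega

end NF

end QuadExt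

/-- The primes of `k` all of whose ramification indices in `K` are even. -/
def ramSet (k K : Type*) [Field k] [NumberField k] [Field K] [NumberField K] [Algebra k K] :
    Set (HeightOneSpectrum (𝓞 k)) :=
  {P | ∀ w : HeightOneSpectrum (𝓞 K), w.under (𝓞 k) = P → Even (ram k w)}

end GenusCount

namespace GenusCount

open IsDedekindDomain nonZeroDivisors NumberField

section Odd

variable {R : Type*} [CommRing R] [IsDedekindDomain R] {K : Type*} [Field K] [Algebra R K]
  [IsFractionRing R K]

theorem vord_finite (x : K) (hx : x ≠ 0) :
    {v : HeightOneSpectrum R | vord v x ≠ 0}.Finite := by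
  have := FractionalIdeal.finite_factors (K := K) (FractionalIdeal.spanSingleton R⁰ x)
  rw [Filter.eventually_cofinite] at this
  refine this.subset fun v hv => ?_
  rw [Set.mem_ofPred_eq, vord_eq_count v hx] at hv
  exact hv

theorem odd_card_of_card_two_torsion {G : Type*} [CommGroup G] [Finite G]
    (h : Nat.card {c : G // c ^ 2 = 1} = 1) : Odd (Nat.card G) := by
  rw [← Nat.not_even_iff_odd, even_iff_two_dvd]
  intro h2
  obtain ⟨x, hx⟩ := exists_prime_orderOf_dvd_card' 2 h2
  have hs := (Nat.card_eq_one_iff_unique.1 h).1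
  have : (⟨x, hx ▸ pow_orderOf_eq_one x⟩ : {c : G // c ^ 2 = 1}) = ⟨1, one_pow 2⟩ :=
    Subsingleton.elim _ _
  have hx1 : x = 1 := congrArg Subtype.val this
  rw [hx1, orderOf_one] at hx
  omega

theorem card_two_torsion_of_odd_card {G : Type*} [CommGroup G] [Finite G]
    (h : Odd (Nat.card G)) : Nat.card {c : G // c ^ 2 = 1} = 1 := by
  rw [Nat.card_eq_one_iff_unique]
  refine ⟨⟨fun a b => Subtype.ext ?_⟩, ⟨1, one_pow 2⟩⟩
  have key : ∀ c : {c : G // c ^ 2 = 1}, (c : G) = 1 := fun c => by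
    obtain ⟨m, hm⟩ := h
    have h1 := pow_card_eq_one' (x := (c : G))
    rwa [hm, pow_succ, pow_mul, c.2, one_pow, one_mul] at h1
  rw [key a, key b]

theorem selmer_eq_of_odd [Finite (ClassGroup R)] (h : Odd (Nat.card (ClassGroup R))) :
    selmer R K = unitGroup R K ⊔ squares Kˣ := by
  apply le_antisymm
  · rw [← Subgroup.relIndex_eq_one, ← card_two_torsion_classGroup]
    exact card_two_torsion_of_odd_card h
  · exact sup_le unitGroup_le_selmer squares_le_selmer

theorem exists_generator_pow_card [Finite (ClassGroup R)] (P : HeightOneSpectrum R) :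
    ∃ a : R, a ≠ 0 ∧ P.asIdeal ^ Nat.card (ClassGroup R) = Ideal.span {a} := by
  have h1 : ClassGroup.mk0 ⟨P.asIdeal, mem_nonZeroDivisors_of_ne_zero P.ne_bot⟩ ^
      Nat.card (ClassGroup R) = 1 := pow_card_eq_one'
  rw [← map_pow, ClassGroup.mk0_eq_one_iff] at h1
  obtain ⟨a, ha⟩ := h1.principal
  refine ⟨a, ?_, ha⟩
  rintro rfl
  have h2 : P.asIdeal ^ Nat.card (ClassGroup R) = ⊥ := by
    simpa using ha
  exact pow_ne_zero _ P.ne_bot h2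

theorem vord_of_span_eq {P : HeightOneSpectrum R} {a : R} (ha : a ≠ 0) {h : ℕ}
    (hP : P.asIdeal ^ h = Ideal.span {a}) (v : HeightOneSpectrum R) [Decidable (v = P)] :
    vord v (algebraMap R K a) = if v = P then (h : ℤ) else 0 := by
  classical
  rw [vord_eq_count v (by simpa using ha), ← FractionalIdeal.coeIdeal_span_singleton, ← hP,
    FractionalIdeal.coeIdeal_pow, FractionalIdeal.count_pow, FractionalIdeal.count_maximal]
  by_cases hv : v = P
  · rw [if_pos hv, if_pos hv.symm, mul_one]
  · rw [if_neg hv, if_neg (Ne.symm hv), mul_zero]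

variable (K) in
theorem exists_odd_iff [Finite (ClassGroup R)] (h : Odd (Nat.card (ClassGroup R)))
    (S : Finset (HeightOneSpectrum R)) :
    ∃ a : Kˣ, ∀ P : HeightOneSpectrum R, Odd (vord P (a : K)) ↔ P ∈ S := by
  classical
  induction S using Finset.induction_on with
  | empty => exact ⟨1, fun P => by simp⟩
  | insert Q S hQ ih =>
    obtain ⟨a, ha⟩ := ih
    obtain ⟨b, hb0, hb⟩ := exists_generator_pow_card Q
    have hb0' : algebraMap R K b ≠ 0 := by simpa using hb0
    refine ⟨a * Units.mk0 _ hb0', fun P => ?_⟩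
    rw [Units.val_mul, Units.val_mk0, vord_mul P a.ne_zero hb0', vord_of_span_eq hb0 hb,
      Int.odd_add, ha, Finset.mem_insert]
    by_cases hP : P = Q
    · subst hP
      rw [if_pos rfl]
      simp only [hQ, true_or, Int.even_coe_nat, iff_true, false_iff, Nat.not_even_iff_odd]
      exact h
    · simp [hP]

end Odd

end GenusCount

namespace GenusCount

open IsDedekindDomain nonZeroDivisors NumberField

section Selmer

variable (k K : Type*) [Field k] [NumberField k] [Field K] [NumberField K] [Algebra k K]

/-- The map `kˣ → Kˣ`. -/
abbrev unitsMap : kˣ →* Kˣ := Units.map (algebraMap k K : k →* K)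

variable {k K} in
theorem mem_comap_selmer {x : kˣ} : x ∈ (selmer (𝓞 K) K).comap (unitsMap k K) ↔
    ∀ P ∉ ramSet k K, Even (vord P (x : k)) := by
  rw [Subgroup.mem_comap, mem_selmer]
  constructor
  · intro h P hP
    simp only [ramSet, Set.mem_ofPred_eq, not_forall] at hP
    obtain ⟨w, rfl, hw⟩ := hP
    have := h w
    rw [Units.coe_map, MonoidHom.coe_coe, vord_algebraMap, Int.even_mul, Int.even_coe_nat] at this
    exact this.resolve_left hw
  · intro h w
    rw [Units.coe_map, MonoidHom.coe_coe, vord_algebraMap, Int.even_mul, Int.even_coe_nat]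
    by_cases hP : w.under (𝓞 k) ∈ ramSet k K
    · exact Or.inl (hP w rfl)
    · exact Or.inr (h _ hP)

/-- The parities of the valuations at a set of primes. -/
noncomputable def parity (S : Set (HeightOneSpectrum (𝓞 k))) :
    kˣ →* Multiplicative (S → ZMod 2) where
  toFun x := Multiplicative.ofAdd fun P => ((vord P.1 (x : k) : ℤ) : ZMod 2)
  map_one' := by
    rw [← ofAdd_zero]
    congr 1
    funext P
    simp
  map_mul' x y := by
    rw [← ofAdd_add]
    congr 1
    funext P
    simp [vord_mul P.1 x.ne_zero y.ne_zero]

variable {k} in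
theorem mem_ker_parity {S : Set (HeightOneSpectrum (𝓞 k))} {x : kˣ} :
    x ∈ (parity k S).ker ↔ ∀ P ∈ S, Even (vord P (x : k)) := by
  rw [MonoidHom.mem_ker, parity, MonoidHom.coe_mk, OneHom.coe_mk, ← ofAdd_zero,
    Equiv.apply_eq_iff_eq, funext_iff]
  simp only [Pi.zero_apply, ZMod.intCast_eq_zero_iff_even, Subtype.forall]

theorem relIndex_selmer (hodd : Odd (Nat.card (ClassGroup (𝓞 k))))
    (hfin : (ramSet k K).Finite) :
    (selmer (𝓞 k) k).relIndex ((selmer (𝓞 K) K).comap (unitsMap k K)) =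
      2 ^ (ramSet k K).ncard := by
  classical
  have h1 : selmer (𝓞 k) k ⊓ (selmer (𝓞 K) K).comap (unitsMap k K) =
      (parity k (ramSet k K)).ker ⊓ (selmer (𝓞 K) K).comap (unitsMap k K) := by
    ext x
    rw [Subgroup.mem_inf, Subgroup.mem_inf, mem_comap_selmer, mem_ker_parity, mem_selmer]
    constructor
    · exact fun h => ⟨fun P _ => h.1 P, h.2⟩
    · refine fun h => ⟨fun P => ?_, h.2⟩
      by_cases hP : P ∈ ramSet k K
      · exact h.1 P hP
      · exact h.2 P hP
  have h2 : ((selmer (𝓞 K) K).comap (unitsMap k K)).map (parity k (ramSet k K)) = ⊤ := by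
    rw [eq_top_iff]
    intro f _
    have := hfin.fintype
    obtain ⟨a, ha⟩ := exists_odd_iff k hodd (((Finset.univ : Finset (ramSet k K)).filter
      (fun P => Multiplicative.toAdd f P = 1)).map (Function.Embedding.subtype _))
    refine ⟨a, ?_, ?_⟩
    · rw [SetLike.mem_coe, mem_comap_selmer]
      intro P hP
      rw [← Int.not_odd_iff_even, ha]
      simp [hP]
    · rw [← ofAdd_toAdd f, parity, MonoidHom.coe_mk, OneHom.coe_mk]
      congr 1
      funext P
      have h := ha P.1
      have hmem := Finset.mem_map' (Function.Embedding.subtype (· ∈ ramSet k K)) (a := P)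
        (s := Finset.univ.filter fun P => Multiplicative.toAdd f P = 1)
      rw [Finset.mem_filter, and_iff_right (Finset.mem_univ P)] at hmem
      replace h := h.trans hmem
      by_cases hf : Multiplicative.toAdd f P = 1
      · rw [hf, ZMod.intCast_eq_one_iff_odd, h]
        exact hf
      · have hf0 : Multiplicative.toAdd f P = 0 := by
          generalize Multiplicative.toAdd f P = z at hf
          revert hf
          revert z
          decide
        rw [hf0, ZMod.intCast_eq_zero_iff_even, ← Int.not_odd_iff_even, h]
        exact hf
  rw [← Subgroup.inf_relIndex_right, h1, Subgroup.inf_relIndex_right, Subgroup.relIndex_ker, h2,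
    Subgroup.card_top]
  have := hfin.fintype
  rw [Nat.card_congr Multiplicative.toAdd, Nat.card_eq_fintype_card, Fintype.card_fun,
    ZMod.card, ← Nat.card_eq_fintype_card, Nat.card_coe_set_eq]

theorem relIndex_squares_selmer_of_odd (hodd : Odd (Nat.card (ClassGroup (𝓞 k)))) :
    (squares kˣ).relIndex (selmer (𝓞 k) k) = 2 ^ (Units.rank k + 1) := by
  rw [selmer_eq_of_odd hodd, Subgroup.relIndex_sup_right, relIndex_squares_units]

theorem relIndex_squares_selmer : (squares kˣ).relIndex (selmer (𝓞 k) k) =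
    2 ^ (Units.rank k + 1) * Nat.card {c : ClassGroup (𝓞 k) // c ^ 2 = 1} := by
  rw [card_two_torsion_classGroup (K := k), ← relIndex_squares_units,
    ← Subgroup.relIndex_sup_right (unitGroup (𝓞 k) k) (squares kˣ),
    Subgroup.relIndex_mul_relIndex _ _ _ le_sup_right
      (sup_le unitGroup_le_selmer squares_le_selmer)]

end Selmer

namespace QuadExt

variable {k K : Type*} [Field k] [NumberField k] [Field K] [NumberField K] [Algebra k K]
  (Q : QuadExt k K)

theorem nmU_unitsMap (x : kˣ) : Q.nmU (unitsMap k K x) = x ^ 2 :=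
  Units.ext (Q.nm_algebraMap x)

include Q in
theorem relIndex_comap_squares :
    (squares kˣ).relIndex ((squares Kˣ).comap (unitsMap k K)) = 2 := by
  have hd : ∀ x : kˣ, x ∈ (squares Kˣ).comap (unitsMap k K) ↔
      x ∈ squares kˣ ∨ x * Units.mk0 Q.d Q.d_ne_zero ∈ squares kˣ := by
    intro x
    constructor
    · rintro ⟨y, hy⟩
      have hy' : (y : K) ^ 2 = algebraMap k K x := congrArg Units.val hy
      obtain ⟨u, v, huv⟩ := Q.gen y
      have h0 : algebraMap k K (u ^ 2 + v ^ 2 * Q.d - x) +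
          algebraMap k K (2 * u * v) * Q.δ = 0 := by
        simp only [map_sub, map_add, map_mul, map_pow, ← Q.sq, ← hy', huv, map_ofNat]
        ring
      obtain ⟨h1, h2⟩ := Q.eq_zero_of h0
      have hx := x.ne_zero
      rcases mul_eq_zero.1 h2 with h3 | h3
      · have hu : u = 0 := by simpa using h3
        right
        have hv : v ≠ 0 := by
          rintro rfl
          apply hx
          rw [hu] at h1
          linear_combination -h1
        refine ⟨Units.mk0 (v * Q.d) (mul_ne_zero hv Q.d_ne_zero), Units.ext ?_⟩
        simp only [powMonoidHom_apply, Units.val_pow_eq_pow_val, Units.val_mk0, Units.val_mul]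
        rw [hu] at h1
        linear_combination Q.d * h1
      · left
        have hu : u ≠ 0 := by
          rintro rfl
          apply hx
          rw [h3] at h1
          linear_combination -h1
        refine ⟨Units.mk0 u hu, Units.ext ?_⟩
        simp only [powMonoidHom_apply, Units.val_pow_eq_pow_val, Units.val_mk0]
        rw [h3] at h1
        linear_combination h1
    · rintro (⟨y, rfl⟩ | ⟨y, hy⟩)
      · exact ⟨unitsMap k K y, by simp⟩
      · refine ⟨unitsMap k K y * (Units.mk0 Q.δ Q.δ_ne_zero)⁻¹, Units.ext ?_⟩
        have hy' : (y : k) ^ 2 = x * Q.d := congrArg Units.val hy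
        have h1 := congrArg (algebraMap k K) hy'
        rw [map_pow, map_mul, ← Q.sq] at h1
        have hδ := Q.δ_ne_zero
        simp only [powMonoidHom_apply, Units.val_pow_eq_pow_val, Units.val_mul, Units.coe_map,
          MonoidHom.coe_coe, Units.val_inv_eq_inv_val, Units.val_mk0]
        field_simp
        linear_combination h1
  have hns : Units.mk0 Q.d Q.d_ne_zero ∉ squares kˣ := by
    rintro ⟨y, hy⟩
    apply Q.not_sq
    have hy' : (y : k) ^ 2 = Q.d := congrArg Units.val hy
    exact ⟨y, by rw [← hy', pow_two]⟩
  rw [Subgroup.relIndex, Subgroup.index_eq_two_iff]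
  refine ⟨⟨Units.mk0 Q.d Q.d_ne_zero, (hd _).2 (Or.inr ⟨Units.mk0 Q.d Q.d_ne_zero, pow_two _⟩)⟩,
    fun ⟨b, hb⟩ => ?_⟩
  rw [Subgroup.mem_subgroupOf, Subgroup.mem_subgroupOf]
  rcases (hd b).1 hb with h | h
  · refine Or.inr ⟨h, fun h' => hns ?_⟩
    have h2 := mul_mem (inv_mem h) h'
    simpa using h2
  · refine Or.inl ⟨h, fun h' => hns ?_⟩
    have h2 := mul_mem (inv_mem h') h
    simpa using h2

theorem selmer_inf_comap_nmU : selmer (𝓞 K) K ⊓ (squares kˣ).comap Q.nmU =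
    ((selmer (𝓞 K) K).comap (unitsMap k K)).map (unitsMap k K) ⊔ squares Kˣ := by
  apply le_antisymm
  · rintro γ ⟨h1, c, hc⟩
    have hc' : Q.nm (γ : K) = (c : k) ^ 2 := (congrArg Units.val hc).symm
    obtain ⟨a, ha, β, hβ, h⟩ := Q.exists_of_nm_eq_sq γ.ne_zero hc' two_ne_zero
    have h2 : γ = unitsMap k K (Units.mk0 a ha) * Units.mk0 β hβ ^ 2 := Units.ext h
    have h3 : Units.mk0 β hβ ^ 2 ∈ squares Kˣ := ⟨_, rfl⟩
    rw [h2]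
    refine Subgroup.mul_mem_sup (Subgroup.mem_map_of_mem _ ?_) h3
    rw [Subgroup.mem_comap, ← mul_inv_eq_iff_eq_mul.2 h2]
    exact mul_mem h1 (inv_mem (squares_le_selmer h3))
  · apply sup_le
    · rintro _ ⟨a, ha, rfl⟩
      exact ⟨ha, a, (Q.nmU_unitsMap a).symm⟩
    · rintro _ ⟨y, rfl⟩
      exact ⟨squares_le_selmer ⟨y, rfl⟩, Q.nmU y, by simp⟩

theorem vord_nm (w : HeightOneSpectrum (𝓞 K)) {x : K} (hx : x ≠ 0) :
    ram k w * vord (w.under (𝓞 k)) (Q.nm x) = vord w x + vord (Q.sw w) x := by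
  rw [← vord_algebraMap, algebraMap_nm, vord_mul w hx (by simpa using hx), vord_σ]

theorem map_nmU_selmer_sup (hodd : Odd (Nat.card (ClassGroup (𝓞 k)))) :
    (selmer (𝓞 K) K).map Q.nmU ⊔ squares kˣ =
      (unitGroup (𝓞 k) k ⊓ Q.nmU.range) ⊔ squares kˣ := by
  classical
  apply le_antisymm
  · refine sup_le ?_ le_sup_right
    rintro _ ⟨γ, hγ, rfl⟩
    have hsel : Q.nmU γ ∈ selmer (𝓞 k) k := by
      intro P
      obtain ⟨w, rfl⟩ := exists_over (K := K) P
      have h1 := Q.vord_nm w γ.ne_zero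
      have h2 : Even (vord w (γ : K)) := hγ w
      have h3 : Even (vord (Q.sw w) (γ : K)) := hγ _
      rw [val_nmU]
      by_cases hw : Even (ram k w)
      · rw [Q.ram_eq_of_even hw, Q.sw_eq_of_even hw] at h1
        have : vord (w.under (𝓞 k)) (Q.nm γ) = vord w (γ : K) := by
          push_cast at h1
          omega
        rwa [this]
      · have h4 := h2.add h3
        rw [← h1, Int.even_mul, Int.even_coe_nat] at h4
        exact h4.resolve_left hw
    rw [selmer_eq_of_odd hodd, Subgroup.mem_sup] at hsel
    obtain ⟨u, hu, _, ⟨s, rfl⟩, hus⟩ := hsel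
    rw [← hus]
    refine Subgroup.mul_mem_sup ⟨hu, γ * (unitsMap k K s)⁻¹, ?_⟩ ⟨s, rfl⟩
    rw [map_mul, map_inv, nmU_unitsMap, ← hus]
    simp
  · refine sup_le ?_ le_sup_right
    rintro _ ⟨hu, γ, rfl⟩
    have hzero : ∀ w : HeightOneSpectrum (𝓞 K), vord w (γ : K) + vord (Q.sw w) (γ : K) = 0 := by
      intro w
      rw [← Q.vord_nm w γ.ne_zero, ← val_nmU, mem_unitGroup_iff.1 hu, mul_zero]
    have hfin : {w : HeightOneSpectrum (𝓞 K) | Odd (vord w (γ : K))}.Finite :=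
      (vord_finite (γ : K) γ.ne_zero).subset fun w hw h0 => by
        rw [Set.mem_ofPred_eq, h0] at hw
        exact absurd hw (by decide)
    obtain ⟨a, ha⟩ := exists_odd_iff k hodd (hfin.toFinset.image fun w => w.under (𝓞 k))
    have hsel : γ * unitsMap k K a ∈ selmer (𝓞 K) K := by
      intro w
      rw [Units.val_mul, vord_mul w γ.ne_zero (Units.ne_zero _), Units.coe_map, MonoidHom.coe_coe,
        vord_algebraMap]
      have h0 := hzero w
      by_cases hw : Even (ram k w)
      · rw [Q.sw_eq_of_even hw] at h0
        have h1 : vord w (γ : K) = 0 := by omega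
        rw [h1, zero_add, Int.even_mul, Int.even_coe_nat]
        exact Or.inl hw
      · rw [Int.even_add, Int.even_mul, Int.even_coe_nat, or_iff_right hw, ← not_iff_not,
          Int.not_even_iff_odd, Int.not_even_iff_odd, ha]
        simp only [Finset.mem_image, Set.Finite.mem_toFinset, Set.mem_ofPred_eq]
        constructor
        · exact fun h => ⟨w, h, rfl⟩
        · rintro ⟨w', h1, h2⟩
          rcases Q.eq_or_eq_sw h2.symm with rfl | rfl
          · exact h1
          · have : vord w (γ : K) = -vord (Q.sw w) (γ : K) := by omega
            rw [this]
            exact h1.neg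
    have h2 : Q.nmU γ = Q.nmU (γ * unitsMap k K a) * (a⁻¹) ^ 2 := by
      rw [map_mul, nmU_unitsMap]
      simp
    rw [h2]
    exact Subgroup.mul_mem_sup (Subgroup.mem_map_of_mem _ hsel) ⟨_, rfl⟩

/-- The ambiguous class number formula for the 2-torsion, over a base of odd class number. -/
theorem card_two_torsion (hodd : Odd (Nat.card (ClassGroup (𝓞 k))))
    (hfin : (ramSet k K).Finite) :
    Nat.card {c : ClassGroup (𝓞 K) // c ^ 2 = 1} * 2 ^ (Units.rank K + 1) =
      (squares kˣ).relIndex (unitGroup (𝓞 k) k ⊓ Q.nmU.range) *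
        2 ^ ((ramSet k K).ncard + Units.rank k) := by
  set T := (selmer (𝓞 K) K).comap (unitsMap k K) with hT
  have hkT : selmer (𝓞 k) k ≤ T := fun x hx => mem_comap_selmer.2 fun P _ => hx P
  have h1 : (squares kˣ).relIndex T = 2 ^ (Units.rank k + 1) * 2 ^ (ramSet k K).ncard := by
    rw [← Subgroup.relIndex_mul_relIndex _ _ _ squares_le_selmer hkT,
      relIndex_squares_selmer_of_odd k hodd, relIndex_selmer k K hodd hfin]
  have hQT : (squares Kˣ).comap (unitsMap k K) ≤ T := Subgroup.comap_mono squares_le_selmer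
  have hkQ : squares kˣ ≤ (squares Kˣ).comap (unitsMap k K) := by
    rintro _ ⟨y, rfl⟩
    exact ⟨unitsMap k K y, by simp⟩
  have h2 := Subgroup.relIndex_mul_relIndex _ _ _ hkQ hQT
  rw [Q.relIndex_comap_squares, h1, Subgroup.relIndex_comap] at h2
  have h3 : (squares Kˣ).relIndex (T.map (unitsMap k K) ⊔ squares Kˣ) =
      (squares Kˣ).relIndex (T.map (unitsMap k K)) := Subgroup.relIndex_sup_right _ _
  have hM : T.map (unitsMap k K) ⊔ squares Kˣ ≤ selmer (𝓞 K) K := by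
    rw [← Q.selmer_inf_comap_nmU]
    exact inf_le_left
  have h4 := Subgroup.relIndex_mul_relIndex _ _ _ le_sup_right hM
  rw [h3, ← Q.selmer_inf_comap_nmU, Subgroup.inf_relIndex_left, Subgroup.relIndex_comap,
    relIndex_squares_selmer, ← Subgroup.relIndex_sup_right (Subgroup.map Q.nmU _) (squares kˣ), Q.map_nmU_selmer_sup hodd,
    Subgroup.relIndex_sup_right] at h4
  rw [mul_comm, ← h4]
  apply Nat.eq_of_mul_eq_mul_left two_pos
  rw [← mul_assoc, h2]
  ring

end QuadExt

end GenusCount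

namespace GenusCount

open IsDedekindDomain nonZeroDivisors NumberField

namespace QuadExt

variable {k K : Type*} [Field k] [NumberField k] [Field K] [NumberField K] [Algebra k K]
  (Q : QuadExt k K)

theorem valuation_σ (w : HeightOneSpectrum (𝓞 K)) (x : K) :
    w.valuation K (Q.σ x) < 1 ↔ (Q.sw w).valuation K x < 1 := by
  by_cases hx : x = 0
  · simp [hx]
  · rw [← vord_pos_iff w (by simpa using hx), vord_σ, vord_pos_iff _ hx]

theorem exists_approx {w : HeightOneSpectrum (𝓞 K)} (hw : Even (ram k w)) {θ : K}
    (hθ : w.valuation K θ ≤ 1) :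
    ∃ a : 𝓞 k, w.valuation K (θ - algebraMap k K a) < 1 ∧
      w.valuation K (Q.σ θ - algebraMap k K a) < 1 := by
  obtain ⟨b, hb⟩ := w.exists_valuation_sub_lt_of_integer hθ 1
  obtain ⟨a, ha⟩ := exists_sub_mem_of_inert (inert_eq_one Q.finrank_eq (Q.ram_eq_of_even hw)) b
  have e : ((b - algebraMap (𝓞 k) (𝓞 K) a : 𝓞 K) : K) = (b : K) - algebraMap k K a :=
    map_sub (algebraMap (𝓞 K) K) _ _
  have h2 : w.valuation K ((b : K) - algebraMap k K a) < 1 := by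
    rw [← e]
    exact (w.valuation_lt_one_iff_mem (K := K) _).2 ha
  have h1 : w.valuation K (θ - algebraMap k K a) < 1 := by
    have h3 : w.valuation K (algebraMap (𝓞 K) K b - θ) < 1 := by simpa using hb
    have h4 := (w.valuation K).map_sub_lt h2 h3
    rwa [sub_sub_sub_cancel_left] at h4
  refine ⟨a, h1, ?_⟩
  have h5 : Q.σ θ - algebraMap k K a = Q.σ (θ - algebraMap k K a) := by
    rw [map_sub, AlgEquiv.commutes]
  rw [h5, valuation_σ, Q.sw_eq_of_even hw]
  exact h1

theorem valuation_sub_σ {w : HeightOneSpectrum (𝓞 K)} (hw : Even (ram k w)) {θ : K}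
    (hθ : w.valuation K θ ≤ 1) : w.valuation K (θ - Q.σ θ) < 1 := by
  obtain ⟨a, h1, h2⟩ := Q.exists_approx hw hθ
  have := (w.valuation K).map_sub_lt h1 h2
  rwa [sub_sub_sub_cancel_right] at this

theorem valuation_algebraMap_lt_one (w : HeightOneSpectrum (𝓞 K)) (x : k) :
    w.valuation K (algebraMap k K x) < 1 ↔ (w.under (𝓞 k)).valuation k x < 1 := by
  by_cases hx : x = 0
  · simp [hx]
  · rw [← vord_pos_iff w (by simpa using hx), vord_algebraMap, ← vord_pos_iff _ hx]
    have := ram_pos (k := k) w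
    constructor
    · intro h
      exact pos_of_mul_pos_right h (by positivity)
    · intro h
      positivity

theorem valuation_algebraMap_le_one (w : HeightOneSpectrum (𝓞 K)) (x : k) :
    w.valuation K (algebraMap k K x) ≤ 1 ↔ (w.under (𝓞 k)).valuation k x ≤ 1 := by
  by_cases hx : x = 0
  · simp [hx]
  · rw [← vord_nonneg_iff w (by simpa using hx), vord_algebraMap, ← vord_nonneg_iff _ hx]
    have := ram_pos (k := k) w
    constructor
    · intro h
      exact nonneg_of_mul_nonneg_right h (by positivity)
    · intro h
      positivity

/-- A ramified prime where `d ≡ 1 (mod 4)` divides `d`. -/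
theorem valuation_d_lt_one {P : HeightOneSpectrum (𝓞 k)} (hP : P ∈ ramSet k K)
    (h : P.valuation k (Q.d - 1) ≤ P.valuation k 4) : P.valuation k Q.d < 1 := by
  obtain ⟨w, rfl⟩ := exists_over (K := K) P
  have h40 : (w.under (𝓞 k)).valuation k (4 : k) ≠ 0 := by simp
  have hc : w.valuation K (algebraMap k K ((Q.d - 1) / 4)) ≤ 1 := by
    rw [valuation_algebraMap_le_one, map_div₀]
    exact div_le_one_of_le₀ h zero_le
  set θ : K := (1 + Q.δ) / 2 with hθd
  have hθ : θ * (θ - 1) = algebraMap k K ((Q.d - 1) / 4) := by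
    rw [map_div₀, map_sub, ← Q.sq, map_one, map_ofNat, hθd]
    ring
  have hθ1 : w.valuation K θ ≤ 1 := by
    by_contra! hlt
    have h1 : w.valuation K (θ - 1) = w.valuation K θ := by
      apply Valuation.map_sub_eq_of_lt_left
      rwa [map_one]
    rw [← hθ, map_mul, h1] at hc
    have := mul_lt_mul'' hlt hlt zero_le zero_le
    rw [one_mul] at this
    exact absurd hc (not_le.2 this)
  have h2 := Q.valuation_sub_σ (hP w rfl) hθ1
  have h3 : θ - Q.σ θ = Q.δ := by
    rw [hθd, map_div₀, map_add, map_one, Q.map_δ, map_ofNat]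
    ring
  rw [h3] at h2
  rw [← valuation_algebraMap_lt_one, ← Q.sq, map_pow]
  exact pow_lt_one₀ zero_le h2 two_ne_zero

theorem mem_ramSet_of_odd {P : HeightOneSpectrum (𝓞 k)} (hP : Odd (vord P Q.d)) :
    P ∈ ramSet k K := by
  rintro w rfl
  have h := vord_algebraMap (K := K) w Q.d
  rw [← Q.sq, vord_pow] at h
  have h2 : Even ((ram k w : ℤ) * vord (w.under (𝓞 k)) Q.d) := by
    rw [← h]; simp
  rw [Int.even_mul, Int.even_coe_nat] at h2
  exact h2.resolve_right (Int.not_even_iff_odd.2 hP)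

theorem mem_ramSet_of_eisenstein {P : HeightOneSpectrum (𝓞 k)} (θ : 𝓞 K) {b : 𝓞 k}
    (hb : b ∈ P.asIdeal) (htr : (θ : K) + Q.σ θ = algebraMap k K b)
    (hn : vord P (Q.nm θ) = 1) : P ∈ ramSet k K := by
  rintro w rfl
  by_contra hw
  have hr : ram k w = 1 := by
    have h1 := ram_le Q.finrank_eq w
    have h2 := ram_pos (k := k) w
    rw [Nat.not_even_iff_odd] at hw
    obtain ⟨m, hm⟩ := hw
    omega
  have hθ0 : θ ≠ 0 := by
    rintro rfl
    have h0 : Q.nm ((0 : 𝓞 K) : K) = 0 := by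
      apply (algebraMap k K).injective
      rw [algebraMap_nm]
      simp
    rw [h0] at hn
    simp [vord] at hn
  have hσ0 : Q.σR θ ≠ 0 := by simpa using hθ0
  have hv := Q.vord_nm w (x := (θ : K)) (by simpa using hθ0)
  rw [hn, hr, ← vord_σ, ← σR_apply] at hv
  have h1 := vord_algebraMap_nonneg (K := K) w θ
  have h2 := vord_algebraMap_nonneg (K := K) w (Q.σR θ)
  have h3 := vord_algebraMap_pos (K := K) w hθ0
  have h4 := vord_algebraMap_pos (K := K) w hσ0
  have hsum : θ + Q.σR θ ∈ w.asIdeal := by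
    have : θ + Q.σR θ = algebraMap (𝓞 k) (𝓞 K) b := RingOfIntegers.ext htr
    rw [this]
    exact hb
  have h5 : θ ∈ w.asIdeal ↔ Q.σR θ ∈ w.asIdeal :=
    ⟨fun h => (w.asIdeal.add_mem_iff_right h).1 hsum, fun h => (w.asIdeal.add_mem_iff_left h).1 hsum⟩
  rw [← h3, ← h4] at h5
  change ((1 : ℕ) : ℤ) * 1 = vord w (algebraMap (𝓞 K) K θ) + vord w (algebraMap (𝓞 K) K (Q.σR θ)) at hv
  omega

/-- A unit that is a relative norm is a square modulo ramified primes. -/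
theorem exists_sub_sq_mem {P : HeightOneSpectrum (𝓞 k)} (hP : P ∈ ramSet k K) {u : 𝓞 k}
    (hu : u ∉ P.asIdeal) {γ : K} (h : Q.nm γ = u) : ∃ a : 𝓞 k, u - a ^ 2 ∈ P.asIdeal := by
  obtain ⟨w, rfl⟩ := exists_over (K := K) P
  have hw := hP w rfl
  have hγ0 : γ ≠ 0 := by
    rintro rfl
    have h0 := Q.algebraMap_nm 0
    rw [h] at h0
    apply hu
    have : u = 0 := by simpa using h0
    rw [this]
    exact Ideal.zero_mem _
  have hv := Q.vord_nm w hγ0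
  rw [h, Q.sw_eq_of_even hw, vord_algebraMap_eq_zero _ hu, mul_zero] at hv
  have hγ1 : w.valuation K γ ≤ 1 := (vord_nonneg_iff w hγ0).1 (by omega)
  obtain ⟨a, h1, h2⟩ := Q.exists_approx hw hγ1
  refine ⟨a, ?_⟩
  rw [← HeightOneSpectrum.valuation_lt_one_iff_mem (K := k), ← valuation_algebraMap_lt_one]
  have h3 : algebraMap k K (algebraMap (𝓞 k) k (u - a ^ 2)) =
      (γ - algebraMap k K a) * Q.σ γ + algebraMap k K a * (Q.σ γ - algebraMap k K a) := by
    have := Q.algebraMap_nm γ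
    rw [h] at this
    rw [map_sub, map_pow, map_sub, map_pow, this]
    ring
  have hσ1 : w.valuation K (Q.σ γ) ≤ 1 := by
    rw [← vord_nonneg_iff w (by simpa using hγ0), vord_σ, Q.sw_eq_of_even hw]
    omega
  have ha1 : w.valuation K (algebraMap k K a) ≤ 1 := by
    rw [valuation_algebraMap_le_one]
    exact (w.under (𝓞 k)).valuation_le_one a
  rw [h3]
  apply Valuation.map_add_lt
  · rw [map_mul]
    exact (mul_le_mul' le_rfl hσ1).trans_lt (by rwa [mul_one])
  · rw [map_mul]
    exact (mul_le_mul' ha1 le_rfl).trans_lt (by rwa [one_mul])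

include Q in
theorem finite_ramSet : (ramSet k K).Finite := by
  have h4 : (4 : k) ≠ 0 := by norm_num
  refine ((vord_finite Q.d Q.d_ne_zero).union (vord_finite (4 : k) h4)).subset ?_
  intro P hP
  by_contra hcon
  rw [Set.mem_union, not_or, Set.mem_ofPred_eq, Set.mem_ofPred_eq, not_not, not_not,
    vord_eq_zero_iff P Q.d_ne_zero, vord_eq_zero_iff P h4] at hcon
  have := Q.valuation_d_lt_one hP (by
    rw [hcon.2]
    refine (P.valuation k).map_sub_le hcon.1.le (by simp))
  exact absurd hcon.1 this.ne

end QuadExt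

end GenusCount

namespace GenusCount

open IsDedekindDomain nonZeroDivisors NumberField

namespace QuadExt

section Lift

variable {k K : Type*} [Field k] [Field K] [Algebra k K] (Q : QuadExt k K)

/-- The rational part of an element of a quadratic extension. -/
noncomputable def re (y : K) : k := (Q.gen y).choose

/-- The irrational part of an element of a quadratic extension. -/
noncomputable def im (y : K) : k := (Q.gen y).choose_spec.choose

theorem eq_re_add_im (y : K) : y = algebraMap k K (Q.re y) + algebraMap k K (Q.im y) * Q.δ :=
  (Q.gen y).choose_spec.choose_spec

theorem re_im_eq {y : K} {u v : k} (h : y = algebraMap k K u + algebraMap k K v * Q.δ) :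
    Q.re y = u ∧ Q.im y = v := by
  have h1 := Q.eq_re_add_im y
  have h2 : algebraMap k K (Q.re y - u) + algebraMap k K (Q.im y - v) * Q.δ = 0 := by
    rw [map_sub, map_sub]
    linear_combination h - h1
  obtain ⟨h3, h4⟩ := Q.eq_zero_of h2
  exact ⟨sub_eq_zero.1 h3, sub_eq_zero.1 h4⟩

/-- Extension of a ring homomorphism to a quadratic extension. -/
noncomputable def lift {F : Type*} [CommRing F] (ρ : k →+* F) (r : F) (hr : r ^ 2 = ρ Q.d) :
    K →+* F where
  toFun y := ρ (Q.re y) + ρ (Q.im y) * r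
  map_one' := by
    obtain ⟨h1, h2⟩ := Q.re_im_eq (y := 1) (u := 1) (v := 0) (by simp)
    simp [h1, h2]
  map_zero' := by
    obtain ⟨h1, h2⟩ := Q.re_im_eq (y := 0) (u := 0) (v := 0) (by simp)
    simp [h1, h2]
  map_add' x y := by
    obtain ⟨h1, h2⟩ := Q.re_im_eq (y := x + y) (u := Q.re x + Q.re y) (v := Q.im x + Q.im y) (by
      rw [map_add, map_add]
      linear_combination Q.eq_re_add_im x + Q.eq_re_add_im y)
    rw [h1, h2, map_add, map_add]
    ring
  map_mul' x y := by
    obtain ⟨h1, h2⟩ := Q.re_im_eq (y := x * y) (u := Q.re x * Q.re y + Q.im x * Q.im y * Q.d)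
      (v := Q.re x * Q.im y + Q.im x * Q.re y) (by
        conv_lhs => rw [Q.eq_re_add_im x, Q.eq_re_add_im y]
        simp only [map_add, map_mul, ← Q.sq]
        ring)
    rw [h1, h2]
    simp only [map_add, map_mul, ← hr]
    ring

variable {F : Type*} [CommRing F] (ρ : k →+* F) (r : F) (hr : r ^ 2 = ρ Q.d)

theorem lift_apply (u v : k) :
    Q.lift ρ r hr (algebraMap k K u + algebraMap k K v * Q.δ) = ρ u + ρ v * r := by
  obtain ⟨h1, h2⟩ := Q.re_im_eq (y := algebraMap k K u + algebraMap k K v * Q.δ) rfl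
  change ρ (Q.re _) + ρ (Q.im _) * r = _
  rw [h1, h2]

theorem lift_algebraMap (u : k) : Q.lift ρ r hr (algebraMap k K u) = ρ u := by
  have := Q.lift_apply ρ r hr u 0
  simpa using this

theorem lift_δ : Q.lift ρ r hr Q.δ = r := by
  have := Q.lift_apply ρ r hr 0 1
  simpa using this

end Lift

theorem exists_of_not_isSquare {k : Type} [Field k] [NumberField k] {d : k} (hd : ¬IsSquare d) :
    ∃ (K : Type) (_ : Field K) (_ : NumberField K) (_ : Algebra k K) (Q : QuadExt k K),
      Q.d = d := by
  have hab : Fact (∀ r : k, r ^ 2 ≠ d + 0 * r) :=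
    ⟨fun r hr => hd ⟨r, by rw [← pow_two, hr]; ring⟩⟩
  have hnf : NumberField (QuadraticAlgebra k d 0) :=
    { to_charZero := charZero_of_injective_algebraMap (algebraMap k _).injective
      to_finiteDimensional := Module.Finite.trans k _ }
  have hω : (QuadraticAlgebra.omega : QuadraticAlgebra k d 0) ^ 2 = algebraMap k _ d := by
    rw [pow_two, QuadraticAlgebra.omega_mul_omega_eq_mk]; rfl
  refine ⟨QuadraticAlgebra k d 0, inferInstance, hnf, inferInstance,
    { d := d
      δ := QuadraticAlgebra.omega
      σ := AlgEquiv.ofAlgHom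
        (QuadraticAlgebra.lift ⟨-QuadraticAlgebra.omega, by
          rw [neg_mul_neg, ← pow_two, hω, Algebra.algebraMap_eq_smul_one, zero_smul, add_zero]⟩)
        (QuadraticAlgebra.lift ⟨-QuadraticAlgebra.omega, by
          rw [neg_mul_neg, ← pow_two, hω, Algebra.algebraMap_eq_smul_one, zero_smul, add_zero]⟩)
        (by ext <;> simp [QuadraticAlgebra.lift])
        (by ext <;> simp [QuadraticAlgebra.lift])
      sq := hω
      not_sq := hd
      gen := fun y => ⟨y.re, y.im, by ext <;> simp [QuadraticAlgebra.algebraMap_eq]⟩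
      map_δ := by simp [QuadraticAlgebra.lift] }, rfl⟩

end QuadExt

section Rank

variable (K : Type*) [Field K] [NumberField K]

theorem two_mul_rank : 2 * (Units.rank K + 1) =
    Module.finrank ℚ K + InfinitePlace.nrRealPlaces K := by
  have h1 := InfinitePlace.card_add_two_mul_card_eq_rank K
  have h2 := InfinitePlace.card_eq_nrRealPlaces_add_nrComplexPlaces K
  have h3 : 0 < Fintype.card (InfinitePlace K) := Fintype.card_pos
  rw [Units.rank]
  omega

variable {K} in
theorem le_nrRealPlaces {ι : Type*} [Fintype ι] (f : ι → (K →+* ℝ)) (hf : Function.Injective f) :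
    Fintype.card ι ≤ InfinitePlace.nrRealPlaces K := by
  classical
  have hr (i : ι) : ComplexEmbedding.IsReal (Complex.ofRealHom.comp (f i)) := by
    rw [ComplexEmbedding.isReal_iff]
    ext x
    simp [ComplexEmbedding.conjugate]
  let g (i : ι) : {w : InfinitePlace K // InfinitePlace.IsReal w} :=
    ⟨InfinitePlace.mk (Complex.ofRealHom.comp (f i)), ⟨_, hr i, rfl⟩⟩
  refine Fintype.card_le_of_injective g fun i j hij => hf ?_
  have h := congrArg Subtype.val hij
  rw [InfinitePlace.mk_eq_iff] at h
  have hij : Complex.ofRealHom.comp (f i) = Complex.ofRealHom.comp (f j) := by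
    rcases h with h | h
    · exact h
    · rw [← h, (ComplexEmbedding.isReal_iff.1 (hr i))]
  ext x
  have := congrArg (fun φ => φ x) hij
  simpa using this

theorem nrRealPlaces_le : InfinitePlace.nrRealPlaces K ≤ Module.finrank ℚ K := by
  have := InfinitePlace.card_add_two_mul_card_eq_rank K
  omega

end Rank

end GenusCount

namespace GenusCount

open IsDedekindDomain nonZeroDivisors NumberField

section Rational

theorem exists_int_eq (x : 𝓞 ℚ) : ∃ z : ℤ, x = z :=
  ⟨Rat.ringOfIntegersEquiv x, Rat.ringOfIntegersEquiv.injective (by simp)⟩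

theorem prime_natCast_rat {p : ℕ} (hp : p.Prime) : Prime (p : 𝓞 ℚ) := by
  rw [← MulEquiv.prime_iff Rat.ringOfIntegersEquiv.toMulEquiv]
  simpa using Nat.prime_iff_prime_int.1 hp

theorem asIdeal_eq_span {p : ℕ} (hp : p.Prime) {v : HeightOneSpectrum (𝓞 ℚ)}
    (h : (p : 𝓞 ℚ) ∈ v.asIdeal) : v.asIdeal = Ideal.span {(p : 𝓞 ℚ)} := by
  have h1 : (Ideal.span {(p : 𝓞 ℚ)}).IsPrime :=
    (Ideal.span_singleton_prime (prime_natCast_rat hp).ne_zero).2 (prime_natCast_rat hp)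
  have h2 : (Ideal.span {(p : 𝓞 ℚ)}).IsMaximal := h1.isMaximal (by
    simpa using (prime_natCast_rat hp).ne_zero)
  exact (h2.eq_of_le v.isPrime.ne_top (by simpa [Ideal.span_le] using h)).symm

theorem eq_of_natCast_mem {p : ℕ} (hp : p.Prime) {v v' : HeightOneSpectrum (𝓞 ℚ)}
    (h : (p : 𝓞 ℚ) ∈ v.asIdeal) (h' : (p : 𝓞 ℚ) ∈ v'.asIdeal) : v = v' := by
  ext1
  rw [asIdeal_eq_span hp h, asIdeal_eq_span hp h']

theorem vord_natCast_eq_one {p : ℕ} (hp : p.Prime) {v : HeightOneSpectrum (𝓞 ℚ)}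
    (h : (p : 𝓞 ℚ) ∈ v.asIdeal) : vord v (p : ℚ) = 1 := by
  classical
  have h1 := vord_of_span_eq (K := ℚ) (h := 1) (prime_natCast_rat hp).ne_zero
    (P := v) (by rw [pow_one, asIdeal_eq_span hp h]) v
  simpa using h1

theorem exists_natCast_mem_rat {p : ℕ} (hp : p.Prime) :
    ∃ v : HeightOneSpectrum (𝓞 ℚ), (p : 𝓞 ℚ) ∈ v.asIdeal := by
  have h1 : (Ideal.span {(p : 𝓞 ℚ)}).IsPrime :=
    (Ideal.span_singleton_prime (prime_natCast_rat hp).ne_zero).2 (prime_natCast_rat hp)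
  exact ⟨⟨_, h1, by simpa using (prime_natCast_rat hp).ne_zero⟩, Ideal.mem_span_singleton_self _⟩

end Rational

section General

variable {k : Type*} [Field k] [NumberField k]

theorem exists_natCast_mem {p : ℕ} (hp : p.Prime) :
    ∃ P : HeightOneSpectrum (𝓞 k), (p : 𝓞 k) ∈ P.asIdeal := by
  obtain ⟨v, hv⟩ := exists_natCast_mem_rat hp
  obtain ⟨P, rfl⟩ := exists_over (K := k) v
  refine ⟨P, ?_⟩
  have : algebraMap (𝓞 ℚ) (𝓞 k) p ∈ P.asIdeal := hv
  simpa using this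

theorem natCast_mem_under {p : ℕ} {P : HeightOneSpectrum (𝓞 k)} :
    (p : 𝓞 ℚ) ∈ (P.under (𝓞 ℚ)).asIdeal ↔ (p : 𝓞 k) ∈ P.asIdeal := by
  change algebraMap (𝓞 ℚ) (𝓞 k) p ∈ P.asIdeal ↔ _
  simp

theorem exists_prime_mem (P : HeightOneSpectrum (𝓞 k)) :
    ∃ p : ℕ, p.Prime ∧ (p : 𝓞 k) ∈ P.asIdeal := by
  have h0 : Ideal.absNorm P.asIdeal ≠ 0 := by
    rw [Ne, Ideal.absNorm_eq_zero_iff]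
    exact P.ne_bot
  have h1 : ∏ p ∈ (Ideal.absNorm P.asIdeal).primeFactors,
      (p : 𝓞 k) ^ (Ideal.absNorm P.asIdeal).factorization p ∈ P.asIdeal := by
    have := Ideal.absNorm_mem P.asIdeal
    rw [← Nat.prod_factorization_pow_eq_self h0, Finsupp.prod, Nat.support_factorization] at this
    simpa only [Nat.cast_prod, Nat.cast_pow] using this
  obtain ⟨p, hp, h⟩ := (P.isPrime.prod_mem_iff).1 h1
  exact ⟨p, Nat.prime_of_mem_primeFactors hp, P.isPrime.mem_of_pow_mem _ h⟩

theorem intCast_mem {p : ℕ} (hp : p.Prime) {P : HeightOneSpectrum (𝓞 k)}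
    (h : (p : 𝓞 k) ∈ P.asIdeal) (z : ℤ) : (z : 𝓞 k) ∈ P.asIdeal ↔ (p : ℤ) ∣ z := by
  constructor
  · intro hz
    by_contra hpz
    obtain ⟨u, v, huv⟩ := ((Nat.prime_iff_prime_int.1 hp).coprime_iff_not_dvd).2 hpz
    apply P.isPrime.ne_top
    rw [Ideal.eq_top_iff_one]
    have h1 : (1 : 𝓞 k) = u * (p : 𝓞 k) + v * z := by exact_mod_cast huv.symm
    rw [h1]
    exact add_mem (Ideal.mul_mem_left _ _ h) (Ideal.mul_mem_left _ _ hz)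
  · rintro ⟨c, rfl⟩
    push_cast
    exact Ideal.mul_mem_right _ _ h

theorem prime_mem_unique {p q : ℕ} (hp : p.Prime) (hq : q.Prime) {P : HeightOneSpectrum (𝓞 k)}
    (h : (p : 𝓞 k) ∈ P.asIdeal) (h' : (q : 𝓞 k) ∈ P.asIdeal) : p = q := by
  have h1 := (intCast_mem hp h q).1 (by simpa using h')
  rw [Int.natCast_dvd_natCast] at h1
  exact (Nat.prime_dvd_prime_iff_eq hp hq).1 h1

theorem vord_natCast_prime {p : ℕ} (hp : p.Prime) {P : HeightOneSpectrum (𝓞 k)}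
    (h : (p : 𝓞 k) ∈ P.asIdeal) : vord P (p : k) = ram ℚ P := by
  have h1 := vord_algebraMap (k := ℚ) (K := k) P (p : ℚ)
  rw [vord_natCast_eq_one hp (natCast_mem_under.2 h), mul_one] at h1
  simpa using h1

theorem vord_intCast_eq_zero {p : ℕ} (hp : p.Prime) {P : HeightOneSpectrum (𝓞 k)}
    (h : (p : 𝓞 k) ∈ P.asIdeal) {z : ℤ} (hz : ¬(p : ℤ) ∣ z) : vord P (z : k) = 0 := by
  have := vord_algebraMap_eq_zero (K := k) P (a := (z : 𝓞 k)) (by rwa [intCast_mem hp h])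
  simpa using this

theorem under_eq_of_mem {p : ℕ} (hp : p.Prime) {P P' : HeightOneSpectrum (𝓞 k)}
    (h : (p : 𝓞 k) ∈ P.asIdeal) (h' : (p : 𝓞 k) ∈ P'.asIdeal) :
    P.under (𝓞 ℚ) = P'.under (𝓞 ℚ) :=
  eq_of_natCast_mem hp (natCast_mem_under.2 h) (natCast_mem_under.2 h')

end General

theorem card_classGroup_rat : Nat.card (ClassGroup (𝓞 ℚ)) = 1 := by
  have := Rat.classNumber_eq
  rwa [NumberField.classNumber, ← Nat.card_eq_fintype_card] at this

theorem rank_rat : Units.rank ℚ = 0 := by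
  have h1 := two_mul_rank ℚ
  have h2 := nrRealPlaces_le ℚ
  rw [Module.finrank_self] at h1 h2
  omega

end GenusCount

namespace GenusCount

open IsDedekindDomain nonZeroDivisors NumberField

section Split

variable {k : Type*} [Field k] [NumberField k] (Q : QuadExt ℚ k)

theorem QuadExt.eq_or_eq_sw_of_mem {p : ℕ} (hp : p.Prime) {P P' : HeightOneSpectrum (𝓞 k)}
    (h : (p : 𝓞 k) ∈ P.asIdeal) (h' : (p : 𝓞 k) ∈ P'.asIdeal) : P' = P ∨ P' = Q.sw P :=
  Q.eq_or_eq_sw (under_eq_of_mem hp h h')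

theorem QuadExt.natCast_mem_sw {p : ℕ} {P : HeightOneSpectrum (𝓞 k)} :
    (p : 𝓞 k) ∈ (Q.sw P).asIdeal ↔ (p : 𝓞 k) ∈ P.asIdeal := by
  rw [Q.mem_sw, map_natCast]

theorem QuadExt.ram_eq_one_of_sw_ne {P : HeightOneSpectrum (𝓞 k)} (h : Q.sw P ≠ P) :
    ram ℚ P = 1 := by
  have h1 := ram_le Q.finrank_eq P
  have h2 := ram_pos (k := ℚ) P
  have h3 : ram ℚ P ≠ 2 := fun h3 => h (Q.sw_eq_of_even (h3 ▸ even_two))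
  omega

theorem QuadExt.exists_int_sub_mem_of_sw_ne {P : HeightOneSpectrum (𝓞 k)} (h : Q.sw P ≠ P)
    (x : 𝓞 k) : ∃ z : ℤ, x - z ∈ P.asIdeal := by
  have h1 : inert ℚ P = 1 := by
    have h1 := ram_add_ram_le h.symm (Q.under_sw P).symm
    rw [Q.finrank_eq] at h1
    have h2 := Nat.mul_pos (ram_pos (k := ℚ) (Q.sw P)) (inert_pos (k := ℚ) (Q.sw P))
    have h3 := inert_pos (k := ℚ) P
    have h4 := ram_pos (k := ℚ) P
    nlinarith
  obtain ⟨a, ha⟩ := exists_sub_mem_of_inert h1 x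
  obtain ⟨z, rfl⟩ := exists_int_eq a
  exact ⟨z, by simpa using ha⟩

include Q in
theorem QuadExt.exists_int_sub_mem_of_ram {P : HeightOneSpectrum (𝓞 k)} (h : ram ℚ P = 2)
    (x : 𝓞 k) : ∃ z : ℤ, x - z ∈ P.asIdeal := by
  obtain ⟨a, ha⟩ := exists_sub_mem_of_inert (inert_eq_one Q.finrank_eq h) x
  obtain ⟨z, rfl⟩ := exists_int_eq a
  exact ⟨z, by simpa using ha⟩

theorem QuadExt.exists_int_mul_σR (x : 𝓞 k) : ∃ z : ℤ, x * Q.σR x = z ∧ Q.nm x = z := by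
  have h1 : algebraMap ℚ k (Q.nm x) = ((x * Q.σR x : 𝓞 k) : k) := Q.algebraMap_nm x
  obtain ⟨a, ha, hax⟩ := QuadExt.exists_integer_of_algebraMap h1
  obtain ⟨z, rfl⟩ := exists_int_eq a
  exact ⟨z, by simpa using hax.symm, by simpa using ha.symm⟩

end Split

/-- A real quadratic field of prime discriminant `l ≡ 1 (mod 8)` with a unit of norm `-1`. -/
structure Base (k : Type) [Field k] [NumberField k] where
  Q : QuadExt ℚ k
  l : ℕ
  prime : l.Prime
  mod_eight : l % 8 = 1
  d_eq : Q.d = l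
  a : ℤ
  b : ℤ
  pell : a ^ 2 + 1 = l * b ^ 2
  four_dvd : 4 ∣ a
  b_mod : b % 4 = 1
  b_pos : 0 < b

namespace Base

variable {k : Type} [Field k] [NumberField k] (B : Base k)

theorem δ_sq : B.Q.δ ^ 2 = (B.l : k) := by
  rw [B.Q.sq, B.d_eq]; simp

/-- The square root of `l`. -/
noncomputable def s : 𝓞 k :=
  ⟨B.Q.δ, by
    have h : IsIntegral ℤ (B.Q.δ ^ 2) := by
      rw [B.δ_sq]
      exact map_natCast (algebraMap ℤ k) B.l ▸ isIntegral_algebraMap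
    exact h.of_pow two_pos⟩

theorem coe_s : (B.s : k) = B.Q.δ := rfl

theorem s_sq : B.s ^ 2 = (B.l : 𝓞 k) := by
  apply FaithfulSMul.algebraMap_injective (𝓞 k) k
  rw [map_pow, map_natCast]
  exact B.δ_sq

theorem σR_s : B.Q.σR B.s = -B.s := by
  apply RingOfIntegers.ext
  rw [QuadExt.σR_apply, coe_s, B.Q.map_δ]
  simp [coe_s]

theorem exists_quarter : ∃ c : ℤ, (B.l : ℤ) = 1 + 4 * (2 * c) :=
  ⟨(B.l : ℤ) / 8, by have := B.mod_eight; omega⟩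

theorem exists_θ : ∃ θ : 𝓞 k, 2 * θ = 1 + B.s := by
  obtain ⟨c, hc⟩ := B.exists_quarter
  have h2 : (2 : k) ≠ 0 := two_ne_zero
  have h_int : IsIntegral ℤ ((1 + B.Q.δ) / 2) := by
    refine ⟨Polynomial.X ^ 2 - Polynomial.X - Polynomial.C (2 * c), by monicity!, ?_⟩
    have hc' : (B.l : k) = 1 + 4 * (2 * c) := by exact_mod_cast hc
    simp only [Polynomial.eval₂_sub, Polynomial.eval₂_pow, Polynomial.eval₂_X, Polynomial.eval₂_C]
    have := B.δ_sq
    rw [hc'] at this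
    simp only [eq_intCast, Int.cast_mul, Int.cast_ofNat]
    linear_combination (1 / 4) * this
  obtain ⟨θ, hθ⟩ : ∃ θ : 𝓞 k, algebraMap (𝓞 k) k θ = (1 + B.Q.δ) / 2 := ⟨⟨_, h_int⟩, rfl⟩
  refine ⟨θ, FaithfulSMul.algebraMap_injective (𝓞 k) k ?_⟩
  rw [map_mul, map_add, map_one, map_ofNat, hθ]
  change _ = 1 + B.Q.δ
  field_simp

/-- The unit of norm `-1`. -/
noncomputable def ε : (𝓞 k)ˣ where
  val := B.a + B.b * B.s
  inv := B.b * B.s - B.a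
  val_inv := by
    have h : (B.a : 𝓞 k) ^ 2 + 1 = B.l * B.b ^ 2 := by exact_mod_cast B.pell
    linear_combination -h + (B.b : 𝓞 k) ^ 2 * B.s_sq
  inv_val := by
    have h : (B.a : 𝓞 k) ^ 2 + 1 = B.l * B.b ^ 2 := by exact_mod_cast B.pell
    linear_combination -h + (B.b : 𝓞 k) ^ 2 * B.s_sq

theorem val_ε : ((B.ε : (𝓞 k)ˣ) : 𝓞 k) = B.a + B.b * B.s := rfl

/-- The unit of norm `-1`, as an element of the field. -/
noncomputable def e : kˣ := Units.map (algebraMap (𝓞 k) k) B.ε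

theorem val_e : (B.e : k) = B.a + B.b * B.Q.δ := by
  change algebraMap (𝓞 k) k (B.a + B.b * B.s) = _
  rw [map_add, map_mul, map_intCast, map_intCast]
  rfl

theorem coe_ε : ((B.ε : 𝓞 k) : k) = B.e := rfl

theorem e_mem : B.e ∈ unitGroup (𝓞 k) k := ⟨B.ε, rfl⟩

theorem ε_mul_σR : (B.ε : 𝓞 k) * B.Q.σR B.ε = -1 := by
  have h : (B.a : 𝓞 k) ^ 2 + 1 = B.l * B.b ^ 2 := by exact_mod_cast B.pell
  rw [val_ε, map_add, map_mul, B.σR_s, map_intCast, map_intCast]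
  linear_combination h - (B.b : 𝓞 k) ^ 2 * B.s_sq

theorem pell_real : ((B.a : ℝ)) ^ 2 + 1 = (Real.sqrt B.l) ^ 2 * B.b ^ 2 := by
  rw [Real.sq_sqrt (Nat.cast_nonneg _)]
  exact_mod_cast B.pell

/-- The real embedding with `√l > 0`. -/
noncomputable def pos : k →+* ℝ :=
  B.Q.lift (Rat.castHom ℝ) (Real.sqrt B.l) (by
    rw [Real.sq_sqrt (Nat.cast_nonneg _), B.d_eq]; simp)

/-- The real embedding with `√l < 0`. -/
noncomputable def neg : k →+* ℝ :=
  B.Q.lift (Rat.castHom ℝ) (-Real.sqrt B.l) (by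
    rw [neg_sq, Real.sq_sqrt (Nat.cast_nonneg _), B.d_eq]; simp)

theorem pos_s : B.pos B.Q.δ = Real.sqrt B.l := B.Q.lift_δ ..

theorem neg_s : B.neg B.Q.δ = -Real.sqrt B.l := B.Q.lift_δ ..

theorem sqrt_pos : 0 < Real.sqrt B.l := Real.sqrt_pos.2 (by exact_mod_cast B.prime.pos)

theorem abs_a_lt : |(B.a : ℝ)| < B.b * Real.sqrt B.l := by
  have h1 := B.pell_real
  have h2 : (0 : ℝ) < B.b := by exact_mod_cast B.b_pos
  apply abs_lt_of_sq_lt_sq _ (mul_pos h2 B.sqrt_pos).le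
  rw [mul_pow]; linarith

theorem pos_e : 0 < B.pos B.e := by
  have := abs_lt.1 B.abs_a_lt
  rw [val_e, map_add, map_mul, pos_s, map_intCast, map_intCast]
  linarith

theorem neg_e : B.neg B.e < 0 := by
  have := abs_lt.1 B.abs_a_lt
  rw [val_e, map_add, map_mul, neg_s, map_intCast, map_intCast]
  linarith

theorem pos_ne_neg : B.pos ≠ B.neg := fun h => by
  have h1 := B.pos_e
  have h2 := B.neg_e
  rw [h] at h1
  linarith

include B in
theorem finrank_eq : Module.finrank ℚ k = 2 := B.Q.finrank_eq

include B in
theorem rank_eq : Units.rank k = 1 := by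
  have h1 := two_mul_rank k
  have h2 := nrRealPlaces_le k
  have h3 := le_nrRealPlaces (K := k) ![B.pos, B.neg] (by
    intro i j
    fin_cases i <;> fin_cases j <;> simp [B.pos_ne_neg, B.pos_ne_neg.symm])
  rw [B.finrank_eq] at h1 h2
  simp only [Fintype.card_fin] at h3
  omega

end Base

end GenusCount

namespace GenusCount

open IsDedekindDomain nonZeroDivisors NumberField

/-- The index of the squares in the group of units which are norms. -/
noncomputable def QuadExt.nu {k K : Type*} [Field k] [NumberField k] [Field K] [NumberField K]
    [Algebra k K] (Q : QuadExt k K) : ℕ :=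
  (squares kˣ).relIndex (unitGroup (𝓞 k) k ⊓ Q.nmU.range)

namespace Base

variable {k : Type} [Field k] [NumberField k] (B : Base k)

theorem natCast_mem_of_ramSet {P : HeightOneSpectrum (𝓞 ℚ)} (hP : P ∈ ramSet ℚ k) :
    (B.l : 𝓞 ℚ) ∈ P.asIdeal := by
  have h := B.Q.valuation_d_lt_one hP (by
    obtain ⟨c, hc⟩ := B.exists_quarter
    have hc' : B.Q.d - 1 = 4 * algebraMap (𝓞 ℚ) ℚ (2 * c) := by
      have : (B.l : ℚ) = 1 + 4 * (2 * c) := by exact_mod_cast hc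
      rw [B.d_eq, this, map_mul, map_ofNat, map_intCast]
      ring
    rw [hc', map_mul]
    exact mul_le_of_le_one_right' (P.valuation_le_one _))
  rw [B.d_eq] at h
  have h1 : P.valuation ℚ (algebraMap (𝓞 ℚ) ℚ B.l) < 1 := by simpa using h
  exact (P.valuation_lt_one_iff_mem _).1 h1

include B in
theorem odd_card : Odd (Nat.card (ClassGroup (𝓞 k))) := by
  apply odd_card_of_card_two_torsion
  have h1 := B.Q.card_two_torsion (by rw [card_classGroup_rat]; exact odd_one) B.Q.finite_ramSet
  have h2 : (ramSet ℚ k).ncard ≤ 1 := by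
    rw [Set.ncard_le_one_iff B.Q.finite_ramSet]
    intro P P' hP hP'
    exact eq_of_natCast_mem B.prime (B.natCast_mem_of_ramSet hP) (B.natCast_mem_of_ramSet hP')
  have h3 : (squares ℚˣ).relIndex (unitGroup (𝓞 ℚ) ℚ ⊓ B.Q.nmU.range) ≤ 2 := by
    have h4 := relIndex_squares_units ℚ
    rw [rank_rat] at h4
    have h5 := Subgroup.relIndex_le_of_le_right (H := squares ℚˣ)
      (inf_le_left : unitGroup (𝓞 ℚ) ℚ ⊓ B.Q.nmU.range ≤ _) (by rw [h4]; norm_num)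
    rw [h4] at h5
    simpa using h5
  rw [B.rank_eq, rank_rat] at h1
  have h6 : 2 ^ ((ramSet ℚ k).ncard + 0) ≤ 2 ^ 1 := Nat.pow_le_pow_right two_pos (by omega)
  have h7 : Nat.card {c : ClassGroup (𝓞 k) // c ^ 2 = 1} ≠ 0 := by
    have : Nonempty {c : ClassGroup (𝓞 k) // c ^ 2 = 1} := ⟨⟨1, one_pow 2⟩⟩
    exact Nat.card_pos.ne'
  have h8 := Nat.mul_le_mul h3 h6
  omega

/-- The signs at the two real places. -/
noncomputable def signs : kˣ →* SignTypeˣ × SignTypeˣ :=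
  (Units.map ((signHom : ℝ →*₀ SignType).toMonoidHom.comp (B.pos : k →* ℝ))).prod
    (Units.map ((signHom : ℝ →*₀ SignType).toMonoidHom.comp (B.neg : k →* ℝ)))

theorem signs_eq_one {u : kˣ} (h : 0 < B.pos u) (h' : 0 < B.neg u) : B.signs u = 1 := by
  ext
  · exact sign_pos h
  · exact sign_pos h'

theorem isSquare_of_pos {u : kˣ} (hu : u ∈ unitGroup (𝓞 k) k) (h : 0 < B.pos u)
    (h' : 0 < B.neg u) : u ∈ squares kˣ := by
  set T := B.signs.ker
  have h1 : squares kˣ ≤ T := by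
    intro x hx
    obtain ⟨y, rfl⟩ := mem_squares.1 hx
    have h2 : B.pos y ≠ 0 := by simp
    have h3 : B.neg y ≠ 0 := by simp
    refine B.signs_eq_one ?_ ?_ <;> rw [Units.val_pow_eq_pow_val, map_pow] <;> positivity
  have h2 : T.relIndex (unitGroup (𝓞 k) k) = 4 := by
    have he : (unitGroup (𝓞 k) k).map B.signs = ⊤ := by
      rw [eq_top_iff]
      have hpos : SignType.sign (B.pos B.e) = 1 := sign_pos B.pos_e
      have hneg : SignType.sign (B.neg B.e) = -1 := sign_neg B.neg_e
      have h1 : (1 : kˣ) ∈ unitGroup (𝓞 k) k := one_mem _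
      have hm1 : (-1 : kˣ) ∈ unitGroup (𝓞 k) k := ⟨-1, by ext; simp⟩
      have hme := mul_mem hm1 B.e_mem
      have key : ∀ x : SignTypeˣ × SignTypeˣ, (x.1.1 = 1 ∨ x.1.1 = -1) ∧
        (x.2.1 = 1 ∨ x.2.1 = -1) := by decide
      intro x _
      obtain ⟨hx1 | hx1, hx2 | hx2⟩ := key x
      · refine ⟨1, h1, ?_⟩
        ext
        · rw [hx1]; simp
        · rw [hx2]; simp
      · refine ⟨_, B.e_mem, ?_⟩
        ext
        · rw [hx1]; exact hpos
        · rw [hx2]; exact hneg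
      · refine ⟨_, hme, ?_⟩
        ext
        · rw [hx1]
          change SignType.sign (B.pos ((-1) * B.e)) = -1
          rw [map_mul, sign_mul, hpos]; simp [sign_neg]
        · rw [hx2]
          change SignType.sign (B.neg ((-1) * B.e)) = 1
          rw [map_mul, sign_mul, hneg]; simp [sign_neg]
      · refine ⟨_, hm1, ?_⟩
        ext
        · rw [hx1]
          change SignType.sign (B.pos (-1)) = -1
          simp [sign_neg]
        · rw [hx2]
          change SignType.sign (B.neg (-1)) = -1
          simp [sign_neg]
    rw [Subgroup.relIndex_ker, he, Nat.card_congr Subgroup.topEquiv.toEquiv,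
      Nat.card_eq_fintype_card]
    decide
  have h3 := relIndex_squares_units k
  rw [B.rank_eq] at h3
  have h4 := Subgroup.relIndex_mul_relIndex (squares kˣ ⊓ unitGroup (𝓞 k) k)
    (T ⊓ unitGroup (𝓞 k) k) (unitGroup (𝓞 k) k) (inf_le_inf_right _ h1) inf_le_right
  rw [Subgroup.inf_relIndex_right, Subgroup.inf_relIndex_right, h2, h3] at h4
  have h5 : (squares kˣ ⊓ unitGroup (𝓞 k) k).relIndex (T ⊓ unitGroup (𝓞 k) k) = 1 := by
    omega
  rw [Subgroup.relIndex_eq_one] at h5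
  exact (h5 ⟨B.signs_eq_one h h', hu⟩).1

theorem unit_cases {u : kˣ} (hu : u ∈ unitGroup (𝓞 k) k) :
    u ∈ squares kˣ ∨ -u ∈ squares kˣ ∨ u * B.e ∈ squares kˣ ∨ -(u * B.e) ∈ squares kˣ := by
  have hn {v : kˣ} (hv : v ∈ unitGroup (𝓞 k) k) : -v ∈ unitGroup (𝓞 k) k := by
    have hm1 : (-1 : kˣ) ∈ unitGroup (𝓞 k) k := ⟨-1, by ext; simp⟩
    simpa using mul_mem hm1 hv
  have h1 : B.pos u ≠ 0 := by simp
  have h2 : B.neg u ≠ 0 := by simp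
  have hp := B.pos_e
  have hm := B.neg_e
  rcases lt_or_gt_of_ne h1 with h1 | h1 <;> rcases lt_or_gt_of_ne h2 with h2 | h2
  · refine Or.inr (Or.inl (B.isSquare_of_pos (hn hu) ?_ ?_)) <;> simpa
  · refine Or.inr (Or.inr (Or.inr (B.isSquare_of_pos (hn (mul_mem hu B.e_mem)) ?_ ?_)))
    · simpa using mul_neg_of_neg_of_pos h1 hp
    · simpa using mul_neg_of_pos_of_neg h2 hm
  · refine Or.inr (Or.inr (Or.inl (B.isSquare_of_pos (mul_mem hu B.e_mem) ?_ ?_)))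
    · simpa using mul_pos h1 hp
    · simpa using mul_pos_of_neg_of_neg h2 hm
  · exact Or.inl (B.isSquare_of_pos hu h1 h2)

theorem pos_of_mem_squares {x : kˣ} (hx : x ∈ squares kˣ) : 0 < B.pos x ∧ 0 < B.neg x := by
  obtain ⟨y, rfl⟩ := mem_squares.1 hx
  have h2 : B.pos y ≠ 0 := by simp
  have h3 : B.neg y ≠ 0 := by simp
  constructor <;> rw [Units.val_pow_eq_pow_val, map_pow] <;> positivity

variable {K : Type*} [Field K] [NumberField K] [Algebra k K] (Q : QuadExt k K)

theorem squares_le_norms : squares kˣ ≤ Q.nmU.range := by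
  intro x hx
  obtain ⟨y, rfl⟩ := mem_squares.1 hx
  refine ⟨Units.map (algebraMap k K) y, ?_⟩
  ext
  rw [QuadExt.val_nmU]
  simpa using Q.nm_algebraMap (y : k)

theorem neg_mem_unitGroup {v : kˣ} (hv : v ∈ unitGroup (𝓞 k) k) : -v ∈ unitGroup (𝓞 k) k := by
  have hm1 : (-1 : kˣ) ∈ unitGroup (𝓞 k) k := ⟨-1, by ext; simp⟩
  simpa using mul_mem hm1 hv

theorem nu_eq_one (h1 : -1 ∉ Q.nmU.range) (h2 : B.e ∉ Q.nmU.range) (h3 : -B.e ∉ Q.nmU.range) :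
    Q.nu = 1 := by
  rw [QuadExt.nu, Subgroup.relIndex_eq_one]
  rintro u ⟨hu, hun⟩
  rcases B.unit_cases hu with h | h | h | h
  · exact h
  · exact (h1 (by simpa using mul_mem (squares_le_norms Q h) (inv_mem hun))).elim
  · exact (h2 (by simpa using mul_mem (squares_le_norms Q h) (inv_mem hun))).elim
  · exact (h3 (by simpa using mul_mem (squares_le_norms Q h) (inv_mem hun))).elim

theorem nu_eq_four (h1 : -1 ∈ Q.nmU.range) (h2 : B.e ∈ Q.nmU.range) : Q.nu = 4 := by
  have h : unitGroup (𝓞 k) k ≤ Q.nmU.range := by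
    intro u hu
    rcases B.unit_cases hu with h | h | h | h
    · exact squares_le_norms Q h
    · simpa using mul_mem h1 (squares_le_norms Q h)
    · simpa using mul_mem (squares_le_norms Q h) (inv_mem h2)
    · simpa using mul_mem h1 (mul_mem (squares_le_norms Q h) (inv_mem h2))
  rw [QuadExt.nu, inf_of_le_left h, relIndex_squares_units, B.rank_eq]
  norm_num

theorem nu_eq_two {c : kˣ} (hc : c ∈ unitGroup (𝓞 k) k) (hcn : c ∈ Q.nmU.range)
    (hcs : c ∉ squares kˣ)
    (h : ∀ u ∈ unitGroup (𝓞 k) k, u ∈ Q.nmU.range → u ∈ squares kˣ ∨ u * c ∈ squares kˣ) :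
    Q.nu = 2 := by
  rw [QuadExt.nu, Subgroup.relIndex, Subgroup.index_eq_two_iff]
  refine ⟨⟨c, hc, hcn⟩, fun u => ?_⟩
  rw [Subgroup.mem_subgroupOf, Subgroup.mem_subgroupOf]
  change Xor ((u : kˣ) * c ∈ squares kˣ) _
  rcases h _ u.2.1 u.2.2 with h' | h'
  · exact Or.inr ⟨h', fun h'' => hcs (by simpa using mul_mem (inv_mem h') h'')⟩
  · refine Or.inl ⟨h', fun h'' => hcs (by simpa using mul_mem (inv_mem h'') h')⟩

theorem nu_eq_two_of_neg_one (h1 : -1 ∈ Q.nmU.range) (h2 : B.e ∉ Q.nmU.range) : Q.nu = 2 := by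
  refine nu_eq_two Q (c := -1) (neg_mem_unitGroup (one_mem _)) h1 (fun h => ?_) fun u hu hun => ?_
  · have := (B.pos_of_mem_squares h).1
    norm_num at this
  · rcases B.unit_cases hu with h | h | h | h
    · exact Or.inl h
    · exact Or.inr (by simpa using h)
    · exact (h2 (by simpa using mul_mem (squares_le_norms Q h) (inv_mem hun))).elim
    · exact (h2 (by simpa using mul_mem h1 (mul_mem (squares_le_norms Q h) (inv_mem hun)))).elim

theorem nu_eq_two_of_neg_e (h1 : -B.e ∈ Q.nmU.range) (h2 : -1 ∉ Q.nmU.range) : Q.nu = 2 := by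
  have h3 : B.e ∉ Q.nmU.range := fun h3 => h2 (by simpa using mul_mem h1 (inv_mem h3))
  refine nu_eq_two Q (neg_mem_unitGroup B.e_mem) h1 (fun h => ?_) fun u hu hun => ?_
  · have := (B.pos_of_mem_squares h).1
    have h4 := B.pos_e
    simp at this
    linarith
  · rcases B.unit_cases hu with h | h | h | h
    · exact Or.inl h
    · exact (h2 (by simpa using mul_mem (squares_le_norms Q h) (inv_mem hun))).elim
    · exact (h3 (by simpa using mul_mem (squares_le_norms Q h) (inv_mem hun))).elim
    · exact Or.inr (by simpa using h)

end Base

end GenusCount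

namespace GenusCount

open IsDedekindDomain nonZeroDivisors NumberField

theorem QuadExt.notMem_ramSet {k K : Type*} [Field k] [NumberField k] [Field K] [NumberField K]
    [Algebra k K] (Q : QuadExt k K) {D : 𝓞 k} (hD : Q.d = D) {P : HeightOneSpectrum (𝓞 k)}
    (hP : D ∉ P.asIdeal) (h : (2 : 𝓞 k) ∉ P.asIdeal ∨ ∃ c, D - 1 = 4 * c) : P ∉ ramSet k K := by
  intro hr
  apply hP
  rw [← P.valuation_lt_one_iff_mem (K := k)]
  change P.valuation k (D : k) < 1
  rw [← hD]
  refine Q.valuation_d_lt_one hr ?_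
  rw [hD]
  change P.valuation k (algebraMap (𝓞 k) k D - 1) ≤ _
  rw [← map_one (algebraMap (𝓞 k) k), ← map_sub, ← map_ofNat (algebraMap (𝓞 k) k) 4]
  rcases h with h | ⟨c, hc⟩
  · have h4 : P.valuation k (algebraMap (𝓞 k) k 4) = 1 := by
      have h40 : algebraMap (𝓞 k) k 4 ≠ 0 := by simp
      refine (vord_eq_zero_iff P h40).1 (vord_algebraMap_eq_zero P fun h4 => ?_)
      have : (4 : 𝓞 k) = 2 ^ 2 := by norm_num
      rw [this] at h4
      exact h (P.isPrime.mem_of_pow_mem _ h4)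
    rw [h4]
    exact P.valuation_le_one _
  · rw [hc, map_mul, map_mul]
    exact mul_le_of_le_one_right' (P.valuation_le_one _)

namespace Base

variable {k : Type} [Field k] [NumberField k] (B : Base k) {P : HeightOneSpectrum (𝓞 k)} {p : ℕ}

theorem σR_int (z : ℤ) : B.Q.σR (z : 𝓞 k) = z := map_intCast _ _

theorem s_sub_or_s_add {z : ℤ} (hP : (p : 𝓞 k) ∈ P.asIdeal) (hp : p.Prime)
    (hz : (p : ℤ) ∣ z ^ 2 - B.l) : B.s - z ∈ P.asIdeal ∨ B.s + z ∈ P.asIdeal := by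
  apply P.isPrime.mem_or_mem
  have h1 := (intCast_mem hp hP _).2 (dvd_neg.2 hz)
  have h2 : (B.s - z) * (B.s + z) = ((-(z ^ 2 - (B.l : ℤ)) : ℤ) : 𝓞 k) := by
    push_cast
    linear_combination B.s_sq
  rwa [h2]

theorem dvd_of_s_sub_mem {z : ℤ} (hP : (p : 𝓞 k) ∈ P.asIdeal) (hp : p.Prime)
    (hz : B.s - z ∈ P.asIdeal) : (p : ℤ) ∣ z ^ 2 - B.l := by
  rw [← intCast_mem hp hP]
  have h2 : ((z ^ 2 - (B.l : ℤ) : ℤ) : 𝓞 k) = -(B.s + z) * (B.s - z) := by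
    push_cast
    linear_combination B.s_sq
  rw [h2]
  exact Ideal.mul_mem_left _ _ hz

theorem not_dvd_of_dvd_sq_sub {z : ℤ} (hp : p.Prime) (hpl : p ≠ B.l)
    (hz : (p : ℤ) ∣ z ^ 2 - B.l) : ¬(p : ℤ) ∣ z := by
  intro h
  have h1 : (p : ℤ) ∣ B.l := by
    have := dvd_sub (dvd_pow h two_ne_zero) hz
    simpa using this
  exact hpl ((Nat.prime_dvd_prime_iff_eq hp B.prime).1 (Int.natCast_dvd_natCast.1 h1))

theorem not_dvd_two_mul {z : ℤ} (hp : p.Prime) (hp2 : p ≠ 2) (h : ¬(p : ℤ) ∣ z) :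
    ¬(p : ℤ) ∣ 2 * z := by
  intro h1
  rcases (Nat.prime_iff_prime_int.1 hp).dvd_or_dvd h1 with h1 | h1
  · exact hp2 ((Nat.prime_dvd_prime_iff_eq hp Nat.prime_two).1 (by exact_mod_cast h1))
  · exact h h1

theorem sw_ne_of_split {z : ℤ} (hP : (p : 𝓞 k) ∈ P.asIdeal) (hp : p.Prime) (hp2 : p ≠ 2)
    (hpl : p ≠ B.l) (hz : (p : ℤ) ∣ z ^ 2 - B.l) : B.Q.sw P ≠ P := by
  intro h
  have key : ∀ y : ℤ, (p : ℤ) ∣ y ^ 2 - B.l → B.s - y ∉ P.asIdeal := by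
    intro y hy h1
    have h2 : B.s - y ∈ (B.Q.sw P).asIdeal := by rwa [h]
    rw [B.Q.mem_sw, map_sub, B.σR_s, B.σR_int] at h2
    have h3 := add_mem h1 h2
    have h4 : B.s - y + (-B.s - y) = ((2 * -y : ℤ) : 𝓞 k) := by push_cast; ring
    rw [h4, intCast_mem hp hP] at h3
    refine not_dvd_two_mul hp hp2 ?_ h3
    rw [dvd_neg]
    exact B.not_dvd_of_dvd_sq_sub hp hpl hy
  rcases B.s_sub_or_s_add hP hp hz with h1 | h1
  · exact key z hz h1
  · exact key (-z) (by simpa using hz) (by simpa using h1)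

theorem sw_eq_of_inert (hP : (p : 𝓞 k) ∈ P.asIdeal) (hp : p.Prime)
    (hz : ∀ z : ℤ, ¬(p : ℤ) ∣ z ^ 2 - B.l) : B.Q.sw P = P := by
  by_contra h
  obtain ⟨z, h1⟩ := B.Q.exists_int_sub_mem_of_sw_ne h B.s
  exact hz z (B.dvd_of_s_sub_mem hP hp h1)

theorem ram_eq_one_of_inert (hP : (p : 𝓞 k) ∈ P.asIdeal) (hp : p.Prime)
    (hz : ∀ z : ℤ, ¬(p : ℤ) ∣ z ^ 2 - B.l) : ram ℚ P = 1 := by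
  have h1 := ram_le B.Q.finrank_eq P
  have h2 := ram_pos (k := ℚ) P
  have h3 : ram ℚ P ≠ 2 := by
    intro h3
    obtain ⟨z, h1⟩ := B.Q.exists_int_sub_mem_of_ram h3 B.s
    exact hz z (B.dvd_of_s_sub_mem hP hp h1)
  omega

theorem sw_ne_of_two (hP : ((2 : ℕ) : 𝓞 k) ∈ P.asIdeal) : B.Q.sw P ≠ P := by
  intro h
  obtain ⟨θ, hθ⟩ := B.exists_θ
  have h20 : (2 : 𝓞 k) ≠ 0 := two_ne_zero
  have hσ : B.Q.σR θ = 1 - θ := by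
    have := congrArg B.Q.σR hθ
    rw [map_mul, map_add, map_one, B.σR_s, map_ofNat] at this
    apply mul_left_cancel₀ h20
    linear_combination this + hθ
  obtain ⟨c, hc⟩ := B.exists_quarter
  have hm : θ * (1 - θ) ∈ P.asIdeal := by
    have h1 : θ * (1 - θ) = (-c) * ((2 : ℕ) : 𝓞 k) := by
      have hc' : (B.l : 𝓞 k) = 1 + 4 * (2 * c) := by exact_mod_cast hc
      apply mul_left_cancel₀ (mul_ne_zero h20 h20)
      push_cast
      linear_combination (-2 * θ + 1 - B.s) * hθ - B.s_sq - hc'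
    rw [h1]
    exact Ideal.mul_mem_left _ _ hP
  have h1 : θ ∈ P.asIdeal ∧ 1 - θ ∈ P.asIdeal := by
    rcases P.isPrime.mem_or_mem hm with h1 | h1
    · refine ⟨h1, ?_⟩
      rw [← h, B.Q.mem_sw, hσ] at h1
      exact h1
    · refine ⟨?_, h1⟩
      rw [← hσ] at h1
      rw [← h]
      exact h1
  apply P.isPrime.ne_top
  rw [Ideal.eq_top_iff_one]
  simpa using add_mem h1.1 h1.2

theorem s_mem (hP : (B.l : 𝓞 k) ∈ P.asIdeal) : B.s ∈ P.asIdeal := by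
  rw [← B.s_sq] at hP
  exact P.isPrime.mem_of_pow_mem _ hP

theorem two_mul_vord_δ (hP : (B.l : 𝓞 k) ∈ P.asIdeal) : 2 * vord P B.Q.δ = ram ℚ P := by
  rw [← vord_natCast_prime B.prime hP, ← B.δ_sq, vord_pow]
  norm_num

theorem vord_δ_eq_one (hP : (B.l : 𝓞 k) ∈ P.asIdeal) : vord P B.Q.δ = 1 := by
  have h1 := B.two_mul_vord_δ hP
  have h2 := ram_le B.Q.finrank_eq P
  have h3 := ram_pos (k := ℚ) P
  omega

theorem sw_eq_of_l (hP : (B.l : 𝓞 k) ∈ P.asIdeal) : B.Q.sw P = P := by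
  apply B.Q.sw_eq_of_even
  have h1 := B.two_mul_vord_δ hP
  rw [B.vord_δ_eq_one hP] at h1
  have h2 : ram ℚ P = 2 := by omega
  rw [h2]
  exact even_two

theorem vord_δ_eq_zero (hP : (B.l : 𝓞 k) ∉ P.asIdeal) : vord P B.Q.δ = 0 := by
  refine vord_algebraMap_eq_zero P (a := B.s) fun h => hP ?_
  rw [← B.s_sq, pow_two]
  exact Ideal.mul_mem_left _ _ h

theorem ram_eq_one (hP : (p : 𝓞 k) ∈ P.asIdeal) (hp : p.Prime) (hpl : p ≠ B.l) :
    ram ℚ P = 1 := by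
  by_cases hz : ∃ z : ℤ, (p : ℤ) ∣ z ^ 2 - B.l
  · obtain ⟨z, hz⟩ := hz
    apply B.Q.ram_eq_one_of_sw_ne
    by_cases hp2 : p = 2
    · subst hp2
      exact B.sw_ne_of_two hP
    · exact B.sw_ne_of_split hP hp hp2 hpl hz
  · push Not at hz
    exact B.ram_eq_one_of_inert hP hp hz

/-- The primes over `p`. -/
def primesAbove (k : Type*) [Field k] [NumberField k] (p : ℕ) : Set (HeightOneSpectrum (𝓞 k)) :=
  {P | (p : 𝓞 k) ∈ P.asIdeal}

theorem primesAbove_eq_pair (hP : (p : 𝓞 k) ∈ P.asIdeal) (hp : p.Prime) :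
    primesAbove k p = {P, B.Q.sw P} := by
  ext P'
  constructor
  · exact fun h => B.Q.eq_or_eq_sw_of_mem hp hP h
  · rintro (rfl | rfl)
    · exact hP
    · exact B.Q.natCast_mem_sw.2 hP

include B in
theorem primesAbove_finite (hp : p.Prime) : (primesAbove k p).Finite := by
  obtain ⟨P, hP⟩ := exists_natCast_mem (k := k) hp
  rw [B.primesAbove_eq_pair hP hp]
  simp

theorem ncard_primesAbove_of_sw_ne (hp : p.Prime) (h : ∀ P ∈ primesAbove k p, B.Q.sw P ≠ P) :
    (primesAbove k p).ncard = 2 := by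
  obtain ⟨P, hP⟩ := exists_natCast_mem (k := k) hp
  rw [B.primesAbove_eq_pair hP hp, Set.ncard_pair (h P hP).symm]

theorem ncard_primesAbove_of_sw_eq (hp : p.Prime) (h : ∀ P ∈ primesAbove k p, B.Q.sw P = P) :
    (primesAbove k p).ncard = 1 := by
  obtain ⟨P, hP⟩ := exists_natCast_mem (k := k) hp
  rw [B.primesAbove_eq_pair hP hp, h P hP]
  simp

theorem ncard_primesAbove_split {z : ℤ} (hp : p.Prime) (hp2 : p ≠ 2) (hpl : p ≠ B.l)
    (hz : (p : ℤ) ∣ z ^ 2 - B.l) : (primesAbove k p).ncard = 2 :=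
  B.ncard_primesAbove_of_sw_ne hp fun _ hP => B.sw_ne_of_split hP hp hp2 hpl hz

theorem ncard_primesAbove_inert (hp : p.Prime) (hz : ∀ z : ℤ, ¬(p : ℤ) ∣ z ^ 2 - B.l) :
    (primesAbove k p).ncard = 1 :=
  B.ncard_primesAbove_of_sw_eq hp fun _ hP => B.sw_eq_of_inert hP hp hz

include B in
theorem ncard_primesAbove_two : (primesAbove k 2).ncard = 2 :=
  B.ncard_primesAbove_of_sw_ne Nat.prime_two fun _ hP => B.sw_ne_of_two hP

theorem ncard_primesAbove_l : (primesAbove k B.l).ncard = 1 :=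
  B.ncard_primesAbove_of_sw_eq B.prime fun _ hP => B.sw_eq_of_l hP

/-- The totally positive generator `ε√l` of the ramified prime. -/
noncomputable def α : k := B.e * B.Q.δ

theorem α_eq : B.α = B.l * B.b + B.a * B.Q.δ := by
  rw [α, val_e]
  linear_combination (B.b : k) * B.δ_sq

theorem α_ne_zero : B.α ≠ 0 := mul_ne_zero B.e.ne_zero B.Q.δ_ne_zero

theorem vord_α (P : HeightOneSpectrum (𝓞 k)) : vord P B.α = vord P B.Q.δ := by
  rw [α, vord_mul P B.e.ne_zero B.Q.δ_ne_zero, mem_unitGroup_iff.1 B.e_mem P, zero_add]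

theorem pos_α : 0 < B.pos B.α := by
  rw [α, map_mul, B.pos_s]
  exact mul_pos B.pos_e B.sqrt_pos

theorem neg_α : 0 < B.neg B.α := by
  rw [α, map_mul, B.neg_s]
  exact mul_pos_of_neg_of_neg B.neg_e (neg_lt_zero.2 B.sqrt_pos)

end Base

end GenusCount

namespace GenusCount

open IsDedekindDomain nonZeroDivisors NumberField

section TwoAdic

instance fact_prime_two' : Fact (Nat.Prime 2) := ⟨Nat.prime_two⟩

theorem exists_two_adic_int {x : ℚ_[2]} (hx : ‖x‖ ≤ 1) : ∃ Z : ℤ_[2], (Z : ℚ_[2]) = x :=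
  ⟨⟨x, hx⟩, rfl⟩

theorem two_adic_coe_four : ((4 : ℤ_[2]) : ℚ_[2]) = 4 := map_ofNat PadicInt.Coe.ringHom 4

/-- Reduction of `2`-adic integers modulo `8`. -/
noncomputable def red₈ : ℤ_[2] →+* ZMod 8 := PadicInt.toZModPow 3

theorem two_adic_integral {D u : ℤ_[2]} {x y : ℚ_[2]} (h : x ^ 2 - D * y ^ 2 = u)
    (hD : red₈ D ∈ ({2, 3, 6, 7} : Finset (ZMod 8))) :
    ∃ X Y : ZMod 8, X ^ 2 - red₈ D * Y ^ 2 = red₈ u := by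
  have hy : ‖y‖ ≤ 1 := by
    by_contra hy
    push Not at hy
    have hy0 : y ≠ 0 := by
      rintro rfl
      norm_num at hy
    have ht1 : ‖y⁻¹‖ < 1 := by
      rw [norm_inv]
      exact inv_lt_one_of_one_lt₀ hy
    obtain ⟨T, hT⟩ := exists_two_adic_int ht1.le
    have hT1 : ‖T‖ < 1 := by rw [PadicInt.norm_def, hT]; exact ht1
    obtain ⟨t', ht'⟩ := PadicInt.norm_lt_one_iff_dvd T |>.1 hT1
    have hyt : y⁻¹ = 2 * (t' : ℚ_[2]) := by
      rw [← hT, ht', PadicInt.coe_mul]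
      congr 1
    have hz : (x * y⁻¹) ^ 2 = ((D + 4 * (u * t' ^ 2) : ℤ_[2]) : ℚ_[2]) := by
      rw [PadicInt.coe_add, PadicInt.coe_mul, two_adic_coe_four, PadicInt.coe_mul,
        PadicInt.coe_pow]
      have h1 : y * (2 * (t' : ℚ_[2])) = 1 := by rw [← hyt]; exact mul_inv_cancel₀ hy0
      rw [hyt]
      linear_combination (4 * (t' : ℚ_[2]) ^ 2) * h + D * (y * (2 * t') + 1) * h1
    have hz1 : ‖x * y⁻¹‖ ≤ 1 := by
      have h1 : ‖x * y⁻¹‖ ^ 2 ≤ 1 := by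
        rw [← norm_pow, hz]
        exact PadicInt.norm_le_one _
      exact (sq_le_one_iff₀ (norm_nonneg _)).1 h1
    obtain ⟨Z, hZ⟩ := exists_two_adic_int hz1
    have hz2 : Z ^ 2 = D + 4 * (u * t' ^ 2) := by
      apply PadicInt.ext
      rw [← hz, ← hZ, PadicInt.coe_pow]
    have hz3 := congrArg (red₈) hz2
    rw [map_pow, map_add, map_mul, map_ofNat] at hz3
    have key : ∀ Z D w : ZMod 8, Z ^ 2 = D + 4 * w → D ∉ ({2, 3, 6, 7} : Finset (ZMod 8)) := by
      decide
    exact key _ _ _ hz3 hD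
  obtain ⟨Y, rfl⟩ := exists_two_adic_int hy
  have hx : ‖x‖ ≤ 1 := by
    have h1 : x ^ 2 = ((u + D * Y ^ 2 : ℤ_[2]) : ℚ_[2]) := by
      push_cast
      linear_combination h
    have h2 : ‖x‖ ^ 2 ≤ 1 := by
      rw [← norm_pow, h1]
      exact PadicInt.norm_le_one _
    exact (sq_le_one_iff₀ (norm_nonneg _)).1 h2
  obtain ⟨X, rfl⟩ := exists_two_adic_int hx
  have h1 : X ^ 2 - D * Y ^ 2 = u := by
    apply PadicInt.ext
    rw [← h]
    push_cast
    ring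
  have h2 := congrArg (red₈) h1
  exact ⟨_, _, by rw [← h2, map_sub, map_mul, map_pow, map_pow]⟩

theorem exists_sqrt_two_adic {l : ℕ} (hl : l % 8 = 1) : ∃ r : ℤ_[2], r ^ 2 = (l : ℤ_[2]) := by
  have h1 : ‖(1 : ℤ_[2]) - (l : ℤ_[2])‖ ≤ 1 / 8 := by
    have := (PadicInt.norm_le_pow_iff_mem_span_pow ((1 : ℤ_[2]) - (l : ℤ_[2])) 3).2 (by
      rw [Ideal.mem_span_singleton]
      obtain ⟨c, hc⟩ : ∃ c : ℤ, (1 : ℤ) - l = 8 * c := ⟨(1 - l) / 8, by omega⟩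
      refine ⟨c, ?_⟩
      have : ((1 - (l : ℤ) : ℤ) : ℤ_[2]) = ((8 * c : ℤ) : ℤ_[2]) := by rw [hc]
      push_cast at this
      rw [this]
      norm_num)
    refine this.trans ?_
    norm_num
  have h2 : ‖(2 : ℤ_[2])‖ = 2⁻¹ := by
    have := PadicInt.norm_p (p := 2)
    exact_mod_cast this
  have h := hensels_lemma (p := 2) (F := (Polynomial.X ^ 2 - Polynomial.C (l : ℤ_[2])))
    (a := (1 : ℤ_[2])) (by
      have e1 : Polynomial.aeval (1 : ℤ_[2]) (Polynomial.X ^ 2 - Polynomial.C (l : ℤ_[2]))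
        = 1 - l := by simp
      have e2 : Polynomial.aeval (1 : ℤ_[2])
          (Polynomial.derivative (Polynomial.X ^ 2 - Polynomial.C (l : ℤ_[2]))) = 2 := by
        simp [one_add_one_eq_two]
      rw [e1, e2, h2]
      refine lt_of_le_of_lt h1 ?_
      norm_num)
  obtain ⟨r, hr, -⟩ := h
  refine ⟨r, ?_⟩
  have e1 : Polynomial.aeval r (Polynomial.X ^ 2 - Polynomial.C (l : ℤ_[2])) = r ^ 2 - (l : ℤ_[2]) := by
    simp
  rw [e1] at hr
  exact sub_eq_zero.1 hr

end TwoAdic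

namespace Base

variable {k : Type} [Field k] [NumberField k] (B : Base k)
variable {K : Type} [Field K] [NumberField K] [Algebra k K]

theorem exists_two_adic_aux {n : ℕ} (Q : QuadExt k K) (hd : Q.d = n * B.α)
    (hn : (n * (B.a + B.b)) % 8 ∈ ({2, 3, 6, 7} : Finset ℤ)) {u v : ℤ} {y : K}
    (h : Q.nm y = u + v * (B.b * B.Q.δ)) (r : ℤ_[2]) (hr : r ^ 2 = (B.l : ℤ_[2])) :
    ∃ X Y : ZMod 8, X ^ 2 - ((n * (B.a + B.b) : ℤ) : ZMod 8) * Y ^ 2 =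
      u + v * red₈ ((B.b : ℤ_[2]) * r) := by
  set φ := B.Q.lift (algebraMap ℚ ℚ_[2]) (r : ℚ_[2]) (by
    rw [B.d_eq, map_natCast, ← PadicInt.coe_pow, hr, PadicInt.coe_natCast]) with hφ
  have hφδ : φ B.Q.δ = r := B.Q.lift_δ ..
  have hα : φ Q.d = (((n : ℤ_[2]) * ((B.l : ℤ_[2]) * (B.b : ℤ_[2]) + (B.a : ℤ_[2]) * r) : ℤ_[2]) : ℚ_[2]) := by
    rw [hd, α_eq]
    push_cast
    simp [hφδ]
  have hD : red₈ ((n : ℤ_[2]) * ((B.l : ℤ_[2]) * (B.b : ℤ_[2]) + (B.a : ℤ_[2]) * r)) =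
      ((n * (B.a + B.b) : ℤ) : ZMod 8) := by
    have h1 : (red₈ r) ^ 2 = 1 := by
      rw [← map_pow, hr, map_natCast]
      have := (ZMod.natCast_eq_natCast_iff' B.l 1 8).2 (by rw [B.mod_eight])
      simpa using this
    have h2 : ((B.l : ℕ) : ZMod 8) = 1 := by
      have := (ZMod.natCast_eq_natCast_iff' B.l 1 8).2 (by rw [B.mod_eight])
      simpa using this
    obtain ⟨c, hc⟩ := B.four_dvd
    have key : ∀ R c : ZMod 8, R ^ 2 = 1 → 4 * c * R = 4 * c := by decide
    simp only [map_mul, map_add, map_natCast, map_intCast]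
    push_cast
    rw [hc]
    push_cast
    have h3 := key _ (c : ZMod 8) h1
    erw [h2, h3]
    ring
  have hyre := Q.nm_apply (Q.re y) (Q.im y)
  rw [← Q.eq_re_add_im, h] at hyre
  have h4 := congrArg φ hyre
  have h5 : (φ (Q.re y)) ^ 2 - (((n : ℤ_[2]) * ((B.l : ℤ_[2]) * (B.b : ℤ_[2]) + (B.a : ℤ_[2]) * r) : ℤ_[2]) : ℚ_[2]) * φ (Q.im y) ^ 2 =
      (((u : ℤ_[2]) + (v : ℤ_[2]) * ((B.b : ℤ_[2]) * r) : ℤ_[2]) : ℚ_[2]) := by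
    rw [← hα, ← map_pow, ← map_pow, ← map_mul, ← map_sub, ← h4]
    push_cast
    simp [hφδ]
  obtain ⟨X, Y, hXY⟩ := two_adic_integral h5 (by
    rw [hD]
    have key : ∀ z : ℤ, z % 8 ∈ ({2, 3, 6, 7} : Finset ℤ) →
        ((z : ℤ) : ZMod 8) ∈ ({2, 3, 6, 7} : Finset (ZMod 8)) := by
      intro z hz
      rw [← ZMod.intCast_mod z 8]
      simp only [Finset.mem_insert, Finset.mem_singleton] at hz
      rcases hz with hz | hz | hz | hz <;> rw [Nat.cast_ofNat, hz] <;> decide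
    exact key _ hn)
  refine ⟨X, Y, ?_⟩
  rw [← hD, hXY, map_add, map_mul, map_intCast, map_intCast]

theorem exists_two_adic_sqrt : ∃ r : ℤ_[2], r ^ 2 = (B.l : ℤ_[2]) ∧
    red₈ ((B.b : ℤ_[2]) * r) = (1 : ZMod 8) := by
  obtain ⟨r, hr⟩ := exists_sqrt_two_adic B.mod_eight
  obtain ⟨c, hc⟩ := B.four_dvd
  have h1 : (PadicInt.toZModPow (p := 2) 4 ((B.b : ℤ_[2]) * r)) ^ 2 = (1 : ZMod (2 ^ 4)) := by
    have h2 : ((B.b : ℤ_[2]) * r) ^ 2 = ((1 + 16 * c ^ 2 : ℤ) : ℤ_[2]) := by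
      have := congrArg (Int.cast (R := ℤ_[2])) B.pell
      push_cast at this ⊢
      rw [hc] at this
      push_cast at this
      rw [mul_pow, hr]
      linear_combination -this
    rw [← map_pow, h2, map_intCast]
    push_cast
    have : (16 : ZMod (2 ^ 4)) = 0 := by decide
    rw [this]
    ring
  have key : ∀ z : ZMod (2 ^ 4), z ^ 2 = 1 →
      ZMod.castHom (pow_dvd_pow 2 (by norm_num : 3 ≤ 4)) (ZMod (2 ^ 3)) z = 1 ∨
      ZMod.castHom (pow_dvd_pow 2 (by norm_num : 3 ≤ 4)) (ZMod (2 ^ 3)) z = -1 := by decide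
  have h3 := PadicInt.zmod_cast_comp_toZModPow (p := 2) 3 4 (by norm_num)
  have h4 : ∀ z, ZMod.castHom (pow_dvd_pow 2 (by norm_num : 3 ≤ 4)) (ZMod (2 ^ 3))
    (PadicInt.toZModPow (p := 2) 4 z) = red₈ z := fun z => by
      unfold red₈; rw [← h3]; rfl
  rcases key _ h1 with h | h
  · exact ⟨r, hr, by rw [← h4]; exact h⟩
  · refine ⟨-r, by rw [neg_sq, hr], ?_⟩
    rw [mul_neg, map_neg, ← h4, h]
    decide

theorem exists_two_adic {n : ℕ} (Q : QuadExt k K) (hd : Q.d = n * B.α)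
    (hn : (n * (B.a + B.b)) % 8 ∈ ({2, 3, 6, 7} : Finset ℤ)) {u v : ℤ} {y : K}
    (h : Q.nm y = u + v * (B.b * B.Q.δ)) :
    (∃ X Y : ZMod 8, X ^ 2 - ((n * (B.a + B.b) : ℤ) : ZMod 8) * Y ^ 2 = u + v) ∧
    ∃ X Y : ZMod 8, X ^ 2 - ((n * (B.a + B.b) : ℤ) : ZMod 8) * Y ^ 2 = u - v := by
  obtain ⟨r, hr, hr1⟩ := B.exists_two_adic_sqrt
  constructor
  · obtain ⟨X, Y, h1⟩ := B.exists_two_adic_aux Q hd hn h r hr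
    exact ⟨X, Y, by rw [h1, hr1, mul_one]⟩
  · obtain ⟨X, Y, h1⟩ := B.exists_two_adic_aux Q hd hn h (-r) (by rw [neg_sq, hr])
    refine ⟨X, Y, ?_⟩
    rw [h1, mul_neg, map_neg, hr1]
    ring

theorem exists_mod_eight {z : ℤ} (c : ℕ) [NeZero c] (hz : z % 8 = c) : (z : ZMod 8) = c := by
  rw [← ZMod.intCast_mod z 8, Nat.cast_ofNat, hz, Int.cast_natCast]

theorem notMem_norms_of_mod {n : ℕ} (Q : QuadExt k K) (hd : Q.d = n * B.α)
    (hn : n % 4 = 3 ∨ n % 8 = 6) :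
    (-1 : kˣ) ∉ Q.nmU.range ∧ B.e ∉ Q.nmU.range ∧ -B.e ∉ Q.nmU.range := by
  obtain ⟨c, hc⟩ := B.four_dvd
  have hb := B.b_mod
  have hn' : (n * (B.a + B.b)) % 8 = 3 ∨ (n * (B.a + B.b)) % 8 = 7 ∨
      (n * (B.a + B.b)) % 8 = 6 := by
    have h8 : (n : ℤ) % 8 = 3 ∨ (n : ℤ) % 8 = 7 ∨ (n : ℤ) % 8 = 6 := by omega
    have hab : (B.a + B.b) % 8 = 1 ∨ (B.a + B.b) % 8 = 5 := by omega
    rcases h8 with h | h | h <;> rcases hab with h' | h' <;> rw [Int.mul_emod, h, h'] <;> decide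
  have hmem : (n * (B.a + B.b)) % 8 ∈ ({2, 3, 6, 7} : Finset ℤ) := by
    simp only [Finset.mem_insert, Finset.mem_singleton]
    tauto
  have hD : ((n * (B.a + B.b) : ℤ) : ZMod 8) ∈ ({3, 7, 6} : Finset (ZMod 8)) := by
    simp only [Finset.mem_insert, Finset.mem_singleton]
    rcases hn' with h | h | h
    · exact .inl (exists_mod_eight 3 h)
    · exact .inr (.inl (exists_mod_eight 7 h))
    · exact .inr (.inr (exists_mod_eight 6 h))
  have key : ∀ D ∈ ({3, 7, 6} : Finset (ZMod 8)), ∀ c : ZMod 8,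
      (¬ ∃ X Y : ZMod 8, X ^ 2 - D * Y ^ 2 = -1) ∧
      (¬ ((∃ X Y : ZMod 8, X ^ 2 - D * Y ^ 2 = 4 * c + 1) ∧
        ∃ X Y : ZMod 8, X ^ 2 - D * Y ^ 2 = 4 * c - 1)) := by decide
  have key' := key _ hD
  refine ⟨?_, ?_, ?_⟩
  · rintro ⟨y, hy⟩
    have h : Q.nm (y : K) = ((-1 : ℤ) : k) + ((0 : ℤ) : k) * (B.b * B.Q.δ) := by
      rw [← Q.val_nmU, hy]
      simp
    have h1 := (B.exists_two_adic Q hd hmem h).1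
    refine (key' c).1 ?_
    simpa using h1
  · rintro ⟨y, hy⟩
    have h : Q.nm (y : K) = ((B.a : ℤ) : k) + ((1 : ℤ) : k) * (B.b * B.Q.δ) := by
      rw [← Q.val_nmU, hy, val_e]
      simp
    have h1 := B.exists_two_adic Q hd hmem h
    refine (key' c).2 ?_
    rw [hc] at h1
    simpa [hc] using h1
  · rintro ⟨y, hy⟩
    have h : Q.nm (y : K) = ((-B.a : ℤ) : k) + ((-1 : ℤ) : k) * (B.b * B.Q.δ) := by
      rw [← Q.val_nmU, hy, Units.val_neg, val_e]
      push_cast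
      ring
    have h1 := B.exists_two_adic Q hd hmem h
    refine (key' (-c : ℤ)).2 ?_
    simpa [hc, sub_eq_add_neg, and_comm] using h1

theorem notMem_norms_of_two {n : ℕ} (Q : QuadExt k K) (hd : Q.d = n * B.α)
    (hn : n % 8 = 2) (ha : ¬ 8 ∣ B.a) : B.e ∉ Q.nmU.range ∧ -B.e ∉ Q.nmU.range := by
  have hc := B.four_dvd
  have hb := B.b_mod
  have hn' : (n * (B.a + B.b)) % 8 = 2 := by
    have h8 : (n : ℤ) % 8 = 2 := by omega
    have hab : (B.a + B.b) % 8 = 1 ∨ (B.a + B.b) % 8 = 5 := by omega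
    rcases hab with h' | h' <;> rw [Int.mul_emod, h8, h'] <;> decide
  have hmem : (n * (B.a + B.b)) % 8 ∈ ({2, 3, 6, 7} : Finset ℤ) := by
    simp [hn']
  have hD : ((n * (B.a + B.b) : ℤ) : ZMod 8) = 2 := exists_mod_eight 2 hn'
  have ha' : (B.a : ZMod 8) = 4 := exists_mod_eight 4 (by push_cast; omega)
  have key : ¬ (∃ X Y : ZMod 8, X ^ 2 - 2 * Y ^ 2 = 4 + 1) ∧
    ¬ ∃ X Y : ZMod 8, X ^ 2 - 2 * Y ^ 2 = - 4 + 1 := by decide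
  constructor
  · rintro ⟨y, hy⟩
    have h : Q.nm (y : K) = ((B.a : ℤ) : k) + ((1 : ℤ) : k) * (B.b * B.Q.δ) := by
      rw [← Q.val_nmU, hy, val_e]
      simp
    have h1 := (B.exists_two_adic Q hd hmem h).1
    rw [hD, ha'] at h1
    exact key.1 (by simpa using h1)
  · rintro ⟨y, hy⟩
    have h : Q.nm (y : K) = ((-B.a : ℤ) : k) + ((-1 : ℤ) : k) * (B.b * B.Q.δ) := by
      rw [← Q.val_nmU, hy, Units.val_neg, val_e]
      push_cast
      ring
    have h1 := (B.exists_two_adic Q hd hmem h).2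
    rw [hD, Int.cast_neg, ha'] at h1
    exact key.2 (by simpa using h1)

end Base

end GenusCount

namespace GenusCount

open IsDedekindDomain nonZeroDivisors NumberField

theorem not_dvd_neg_one_sub_sq {q : ℕ} (hq : q.Prime) (h : q % 4 = 3) (z : ℤ) :
    ¬ (q : ℤ) ∣ -1 - z ^ 2 := by
  intro hz
  haveI := Fact.mk hq
  have h1 := (ZMod.intCast_zmod_eq_zero_iff_dvd _ q).2 (by exact_mod_cast hz)
  push_cast at h1
  exact ZMod.exists_sq_eq_neg_one_iff.1 ⟨(z : ZMod q), by rw [← sq]; exact sub_eq_zero.1 h1⟩ h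

theorem exists_dvd_neg_one_sub_sq {p : ℕ} (hp : p.Prime) (h : p % 4 = 1) :
    ∃ z : ℤ, (p : ℤ) ∣ -1 - z ^ 2 := by
  haveI := Fact.mk hp
  obtain ⟨i, hi⟩ := ZMod.exists_sq_eq_neg_one_iff.2 (show p % 4 ≠ 3 by omega)
  obtain ⟨z, rfl⟩ := ZMod.intCast_surjective i
  refine ⟨z, (ZMod.intCast_zmod_eq_zero_iff_dvd _ p).1 ?_⟩
  push_cast
  rw [sub_eq_zero, sq]
  exact hi

namespace Base

variable {k : Type} [Field k] [NumberField k] (B : Base k)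
variable {K : Type} [Field K] [NumberField K] [Algebra k K]

theorem unit_notMem (u : (𝓞 k)ˣ) (P : HeightOneSpectrum (𝓞 k)) : (u : 𝓞 k) ∉ P.asIdeal :=
  fun h => P.isPrime.ne_top (Ideal.eq_top_of_isUnit_mem _ h u.isUnit)

theorem coe_neg_ε : (((-B.ε : (𝓞 k)ˣ) : 𝓞 k) : k) = -B.e := by
  rw [Units.val_neg, ← B.coe_ε]
  exact map_neg (algebraMap (𝓞 k) k) _

theorem neg_one_notMem_of_split (Q : QuadExt k K) {q : ℕ} (hq : q.Prime) (h3 : q % 4 = 3)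
    {P : HeightOneSpectrum (𝓞 k)} (hP : (q : 𝓞 k) ∈ P.asIdeal) (hsw : B.Q.sw P ≠ P)
    (hram : P ∈ ramSet k K) : (-1 : kˣ) ∉ Q.nmU.range := by
  rintro ⟨y, hy⟩
  obtain ⟨x, hx⟩ := Q.exists_sub_sq_mem hram (unit_notMem (-1) P) (γ := y) (by
    rw [← Q.val_nmU, hy]; simp)
  obtain ⟨z, hz⟩ := B.Q.exists_int_sub_mem_of_sw_ne hsw x
  refine not_dvd_neg_one_sub_sq hq h3 z ((intCast_mem hq hP _).1 ?_)
  have : ((-1 - z ^ 2 : ℤ) : 𝓞 k) = ((-1 : (𝓞 k)ˣ) : 𝓞 k) - x ^ 2 + (x + z) * (x - z) := by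
    push_cast
    ring
  rw [this]
  exact Ideal.add_mem _ hx (Ideal.mul_mem_left _ _ hz)

theorem unit_notMem_aux (Q : QuadExt k K) {q : ℕ} (hq : q.Prime) (h3 : q % 4 = 3)
    {P : HeightOneSpectrum (𝓞 k)} (hP : (q : 𝓞 k) ∈ P.asIdeal)
    (hram : P ∈ ramSet k K) (hram' : B.Q.sw P ∈ ramSet k K) {u : (𝓞 k)ˣ}
    (hu : (u : 𝓞 k) * B.Q.σR u = -1) (y : K) : Q.nm y ≠ ((u : 𝓞 k) : k) := by
  intro hy
  obtain ⟨x, hx⟩ := Q.exists_sub_sq_mem hram (unit_notMem u P) hy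
  suffices h : ∃ z : ℤ, (-1 - z ^ 2 : 𝓞 k) ∈ P.asIdeal by
    obtain ⟨z, hz⟩ := h
    refine not_dvd_neg_one_sub_sq hq h3 z ((intCast_mem hq hP _).1 ?_)
    push_cast
    exact hz
  have key : ∀ t : 𝓞 k, (u : 𝓞 k) - t ^ 2 ∈ (B.Q.sw P).asIdeal → (-1 - (x * B.Q.σR t) ^ 2) ∈ P.asIdeal := by
    intro t ht
    rw [B.Q.mem_sw, map_sub, map_pow] at ht
    rw [← hu]
    have : (u : 𝓞 k) * B.Q.σR u - (x * B.Q.σR t) ^ 2 =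
        u * (B.Q.σR u - B.Q.σR t ^ 2) + B.Q.σR t ^ 2 * (u - x ^ 2) := by ring
    rw [this]
    exact Ideal.add_mem _ (Ideal.mul_mem_left _ _ ht) (Ideal.mul_mem_left _ _ hx)
  by_cases hsw : B.Q.sw P = P
  · obtain ⟨z, hz, -⟩ := B.Q.exists_int_mul_σR x
    refine ⟨z, ?_⟩
    rw [← hz]
    exact key x (by rwa [hsw])
  · obtain ⟨t, ht⟩ := Q.exists_sub_sq_mem hram' (unit_notMem u _) hy
    obtain ⟨z, hz⟩ := B.Q.exists_int_sub_mem_of_sw_ne hsw (x * B.Q.σR t)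
    refine ⟨z, ?_⟩
    have : (-1 - z ^ 2 : 𝓞 k) =
        -1 - (x * B.Q.σR t) ^ 2 + (x * B.Q.σR t + z) * (x * B.Q.σR t - z) := by ring
    rw [this]
    exact Ideal.add_mem _ (key t ht) (Ideal.mul_mem_left _ _ hz)

theorem e_notMem_of_three (Q : QuadExt k K) {q : ℕ} (hq : q.Prime) (h3 : q % 4 = 3)
    (hram : primesAbove k q ⊆ ramSet k K) : B.e ∉ Q.nmU.range ∧ -B.e ∉ Q.nmU.range := by
  obtain ⟨P, hP⟩ := exists_natCast_mem (k := k) hq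
  have h2 : B.Q.sw P ∈ ramSet k K := hram (B.Q.natCast_mem_sw.2 hP)
  constructor
  · rintro ⟨y, hy⟩
    refine B.unit_notMem_aux Q hq h3 hP (hram hP) h2 B.ε_mul_σR y ?_
    rw [← Q.val_nmU, hy, B.coe_ε]
  · rintro ⟨y, hy⟩
    refine B.unit_notMem_aux Q hq h3 hP (hram hP) h2 (u := -B.ε) ?_ y ?_
    · rw [Units.val_neg, map_neg, neg_mul_neg, B.ε_mul_σR]
    · rw [← Q.val_nmU, hy, coe_neg_ε, Units.val_neg]

theorem neg_one_notMem_of_three (Q : QuadExt k K) {q : ℕ} {z : ℤ} (hq : q.Prime) (h3 : q % 4 = 3)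
    (hql : q ≠ B.l) (hz : (q : ℤ) ∣ z ^ 2 - B.l)
    (hram : primesAbove k q ⊆ ramSet k K) : (-1 : kˣ) ∉ Q.nmU.range := by
  obtain ⟨P, hP⟩ := exists_natCast_mem (k := k) hq
  exact B.neg_one_notMem_of_split Q hq h3 hP
    (B.sw_ne_of_split hP hq (by rintro rfl; omega) hql hz) (hram hP)

theorem e_notMem_of_nonsquare (Q : QuadExt k K) {p : ℕ} {z : ℤ} (hp : p.Prime) (h1 : p % 4 = 1)
    (hpl : p ≠ B.l) (hz : (p : ℤ) ∣ z ^ 2 - B.l)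
    (hsq : ∀ x : ℤ, ¬ (p : ℤ) ∣ B.a + B.b * z - x ^ 2)
    (hram : primesAbove k p ⊆ ramSet k K) : B.e ∉ Q.nmU.range ∧ -B.e ∉ Q.nmU.range := by
  obtain ⟨P, hP, hs⟩ : ∃ P : HeightOneSpectrum (𝓞 k), (p : 𝓞 k) ∈ P.asIdeal ∧
      B.s - z ∈ P.asIdeal := by
    obtain ⟨P, hP⟩ := exists_natCast_mem (k := k) hp
    rcases B.s_sub_or_s_add hP hp hz with h | h
    · exact ⟨P, hP, h⟩
    · refine ⟨B.Q.sw P, B.Q.natCast_mem_sw.2 hP, ?_⟩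
      rw [B.Q.mem_sw, map_sub, σR_s, map_intCast, ← Ideal.neg_mem_iff]
      convert h using 1
      ring
  have hsw := B.sw_ne_of_split hP hp (by rintro rfl; omega) hpl hz
  have main : ∀ (u : (𝓞 k)ˣ) (y : K), Q.nm y = ((u : 𝓞 k) : k) →
      ∃ x : ℤ, (u : 𝓞 k) - x ^ 2 ∈ P.asIdeal := by
    intro u y hy
    obtain ⟨x, hx⟩ := Q.exists_sub_sq_mem (hram hP) (unit_notMem u P) hy
    obtain ⟨t, ht⟩ := B.Q.exists_int_sub_mem_of_sw_ne hsw x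
    refine ⟨t, ?_⟩
    have : (u : 𝓞 k) - t ^ 2 = u - x ^ 2 + (x + t) * (x - t) := by ring
    rw [this]
    exact Ideal.add_mem _ hx (Ideal.mul_mem_left _ _ ht)
  have hε : ∀ x : ℤ, (B.ε : 𝓞 k) - x ^ 2 ∉ P.asIdeal := by
    intro x hx
    refine hsq x ((intCast_mem hp hP _).1 ?_)
    have : ((B.a + B.b * z - x ^ 2 : ℤ) : 𝓞 k) = B.ε - x ^ 2 - B.b * (B.s - z) := by
      rw [B.val_ε]
      push_cast
      ring
    rw [this]
    exact Ideal.sub_mem _ hx (Ideal.mul_mem_left _ _ hs)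
  constructor
  · rintro ⟨y, hy⟩
    obtain ⟨x, hx⟩ := main B.ε y (by rw [← Q.val_nmU, hy, B.coe_ε])
    exact hε x hx
  · rintro ⟨y, hy⟩
    obtain ⟨x, hx⟩ := main (-B.ε) y (by
      rw [← Q.val_nmU, hy, coe_neg_ε, Units.val_neg])
    obtain ⟨i, hi⟩ := exists_dvd_neg_one_sub_sq hp h1
    refine hε (i * x) ?_
    have h2 := (intCast_mem hp hP _).2 hi
    have : (B.ε : 𝓞 k) - ((i * x : ℤ) : 𝓞 k) ^ 2 =
        -(((-B.ε : (𝓞 k)ˣ) : 𝓞 k) - x ^ 2) + x ^ 2 * ((-1 - i ^ 2 : ℤ) : 𝓞 k) := by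
      push_cast
      ring
    rw [this]
    exact Ideal.add_mem _ (neg_mem hx) (Ideal.mul_mem_left _ _ h2)

end Base

end GenusCount

namespace GenusCount

open IsDedekindDomain nonZeroDivisors NumberField

theorem vord_sq_even {R K : Type*} [CommRing R] [IsDedekindDomain R] [Field K] [Algebra R K]
    [IsFractionRing R K] (v : HeightOneSpectrum R) {x : K} (hx : IsSquare x) :
    Even (vord v x) := by
  obtain ⟨y, rfl⟩ := hx
  by_cases hy : y = 0
  · subst hy
    have := vord_pow v (0 : K) 2
    rw [mul_zero]
    rw [zero_pow two_ne_zero] at this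
    exact ⟨_, by rw [this]; push_cast; ring⟩
  · exact ⟨_, vord_mul v hy hy⟩

/-- The four real embeddings of a totally real quadratic extension, out of two embeddings of the
base. -/
noncomputable def QuadExt.real {k K : Type*} [Field k] [Field K] [Algebra k K] (Q : QuadExt k K)
    (ρ : k →+* ℝ) (h : 0 < ρ Q.d) (i : Bool) : K →+* ℝ :=
  Q.lift ρ (cond i 1 (-1) * Real.sqrt (ρ Q.d)) (by
    rw [mul_pow, Real.sq_sqrt h.le]
    cases i <;> simp)

theorem QuadExt.real_inj {k K : Type*} [Field k] [Field K] [Algebra k K] (Q : QuadExt k K)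
    {ρ ρ' : k →+* ℝ} {h : 0 < ρ Q.d} {h' : 0 < ρ' Q.d} {i i' : Bool}
    (heq : Q.real ρ h i = Q.real ρ' h' i') : ρ = ρ' ∧ i = i' := by
  have h1 : ρ = ρ' := by
    ext x
    have := congrArg (fun f : K →+* ℝ => f (algebraMap k K x)) heq
    simpa [QuadExt.real, Q.lift_algebraMap] using this
  subst h1
  refine ⟨rfl, ?_⟩
  have h2 := congrArg (fun f : K →+* ℝ => f Q.δ) heq
  simp only [QuadExt.real, Q.lift_δ] at h2
  have h3 := mul_right_cancel₀ (Real.sqrt_pos.2 h).ne' h2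
  cases i <;> cases i' <;> first | rfl | norm_num at h3

theorem QuadExt.two_le_rank {k K : Type*} [Field k] [NumberField k] [Field K] [NumberField K]
    [Algebra k K] (Q : QuadExt k K) (hk : Module.finrank ℚ k = 2)
    (ρ : k →+* ℝ) (h : 0 < ρ Q.d) : 2 ≤ Units.rank K := by
  have h1 := two_mul_rank K
  have h2 : Fintype.card Bool ≤ _ :=
    le_nrRealPlaces (Q.real ρ h) fun i i' hi => (Q.real_inj hi).2
  have h3 : Module.finrank ℚ K = 4 := by
    rw [← Module.finrank_mul_finrank ℚ k K, hk, Q.finrank_eq]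
  rw [Fintype.card_bool] at h2
  omega

namespace Base

variable {k : Type} [Field k] [NumberField k] (B : Base k)
variable {K : Type} [Field K] [NumberField K] [Algebra k K]

theorem rank_eq_three (Q : QuadExt k K) (hp : 0 < B.pos Q.d) (hn : 0 < B.neg Q.d) :
    Units.rank K = 3 := by
  have h1 := two_mul_rank K
  have h2 : Fintype.card (Bool × Bool) ≤ _ :=
    le_nrRealPlaces (fun i : Bool × Bool => if i.1 = true then Q.real B.pos hp i.2 else
      Q.real B.neg hn i.2) (by
        rintro ⟨i, j⟩ ⟨i', j'⟩ h
        cases i <;> cases i' <;> simp only [Bool.false_eq_true, if_true, if_false] at h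
        · rw [(Q.real_inj h).2]
        · exact absurd (Q.real_inj h).1.symm B.pos_ne_neg
        · exact absurd (Q.real_inj h).1 B.pos_ne_neg
        · rw [(Q.real_inj h).2])
  have h3 : Module.finrank ℚ K = 4 := by
    rw [← Module.finrank_mul_finrank ℚ k K, B.finrank_eq, Q.finrank_eq]
  have h4 := nrRealPlaces_le K
  simp only [Fintype.card_prod, Fintype.card_bool] at h2
  omega

/-- Nonzero sums of two squares in `k`. -/
def SumTwoSq (x : k) : Prop := ∃ y z : k, x = y ^ 2 + z ^ 2

theorem SumTwoSq.mul {x y : k} (hx : SumTwoSq x) (hy : SumTwoSq y) : SumTwoSq (x * y) := by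
  obtain ⟨a, b, rfl⟩ := hx
  obtain ⟨c, d, rfl⟩ := hy
  exact ⟨a * c - b * d, a * d + b * c, by ring⟩

theorem SumTwoSq.of_mul {x y : k} (hx : SumTwoSq (x * y)) (hy : SumTwoSq y) (h0 : y ≠ 0) :
    SumTwoSq x := by
  obtain ⟨c, d, h⟩ := hx.mul hy
  refine ⟨c / y, d / y, ?_⟩
  field_simp
  linear_combination h

theorem sumTwoSq_one : SumTwoSq (1 : k) := ⟨1, 0, by ring⟩

theorem sumTwoSq_two : SumTwoSq (2 : k) := ⟨1, 1, by ring⟩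

theorem sumTwoSq_natCast {m : ℕ} (h : IsSquare (-1 : ZMod m)) : SumTwoSq (m : k) := by
  obtain ⟨x, y, rfl⟩ := Nat.eq_sq_add_sq_of_isSquare_mod_neg_one h
  exact ⟨x, y, by push_cast; ring⟩

theorem sumTwoSq_prime {p : ℕ} (hp : p.Prime) (h : p % 4 = 1) : SumTwoSq (p : k) := by
  haveI := Fact.mk hp
  exact sumTwoSq_natCast (ZMod.exists_sq_eq_neg_one_iff.2 (by omega))

theorem sumTwoSq_α : SumTwoSq B.α := by
  have hb : SumTwoSq ((B.b : ℤ) : k) := by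
    obtain ⟨m, hm⟩ := Int.eq_ofNat_of_zero_le B.b_pos.le
    rw [hm, Int.cast_natCast]
    apply sumTwoSq_natCast
    refine ⟨((B.a : ℤ) : ZMod m), ?_⟩
    have := congrArg (Int.cast (R := ZMod m)) B.pell
    rw [hm] at this
    push_cast at this
    rw [ZMod.natCast_self] at this
    linear_combination -this
  have hb0 : ((B.b : ℤ) : k) ≠ 0 := by exact_mod_cast B.b_pos.ne'
  have hpell := congrArg (Int.cast (R := k)) B.pell
  push_cast at hpell
  refine SumTwoSq.of_mul (y := 2 * (B.b : k)) ⟨B.e, 1, ?_⟩ (sumTwoSq_two.mul hb)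
    (mul_ne_zero two_ne_zero hb0)
  rw [α_eq, val_e]
  linear_combination (1 : k) * B.b ^ 2 * (- B.δ_sq) - hpell

include B in
theorem sq_ne_neg_one {x : k} : x ^ 2 ≠ -1 := fun h => by
  have := congrArg B.pos h
  rw [map_pow, map_neg, map_one] at this
  nlinarith [sq_nonneg (B.pos x)]

theorem neg_one_mem_of_sumTwoSq (Q : QuadExt k K) (h : SumTwoSq Q.d) :
    (-1 : kˣ) ∈ Q.nmU.range := by
  obtain ⟨y, z, h⟩ := h
  have hz : z ≠ 0 := by
    rintro rfl
    exact Q.not_sq ⟨y, by rw [h]; ring⟩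
  have h1 : Q.nm (algebraMap k K (y / z) + algebraMap k K (1 / z) * Q.δ) = -1 := by
    rw [Q.nm_apply, h]
    field_simp
    ring
  have h2 : algebraMap k K (y / z) + algebraMap k K (1 / z) * Q.δ ≠ 0 := by
    intro h0
    rw [h0] at h1
    have := Q.nm_algebraMap 0
    rw [map_zero, h1] at this
    norm_num at this
  refine ⟨Units.mk0 _ h2, ?_⟩
  ext
  rw [Q.val_nmU, Units.val_mk0, h1, Units.val_neg, Units.val_one]

theorem sumTwoSq_of_neg_one_mem (Q : QuadExt k K) (h : (-1 : kˣ) ∈ Q.nmU.range)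
    (h0 : ∀ x : k, x ^ 2 ≠ -1) : SumTwoSq Q.d := by
  obtain ⟨y, hy⟩ := h
  have h1 := Q.nm_apply (Q.re y) (Q.im y)
  rw [← Q.eq_re_add_im, ← Q.val_nmU, hy, Units.val_neg, Units.val_one] at h1
  have him : Q.im y ≠ 0 := by
    intro h2
    rw [h2] at h1
    exact h0 (Q.re y) (by rw [h1]; ring)
  refine ⟨Q.re y / Q.im y, 1 / Q.im y, ?_⟩
  field_simp
  linear_combination h1

theorem primesAbove_subset_of_odd (Q : QuadExt k K) {p : ℕ}
    (h : ∀ P ∈ primesAbove k p, vord P Q.d = 1) : primesAbove k p ⊆ ramSet k K :=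
  fun P hP => Q.mem_ramSet_of_odd (by rw [h P hP]; exact odd_one)

theorem sumTwoSq_inert {p q : ℕ} (hp : p.Prime) (hq : q.Prime) (hpq : p ≠ q)
    (hp3 : p % 4 = 3) (hq3 : q % 4 = 3) (hpz : ∀ z : ℤ, ¬(p : ℤ) ∣ z ^ 2 - B.l)
    (hqz : ∀ z : ℤ, ¬(q : ℤ) ∣ z ^ 2 - B.l) : SumTwoSq ((p * q : ℕ) : k) := by
  have hl : ∀ {r : ℕ}, r.Prime → r % 4 = 3 → r ≠ B.l := by
    rintro r - h3 rfl
    have := B.mod_eight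
    omega
  have hv : ∀ {r t : ℕ}, r.Prime → t.Prime → r ≠ t → r % 4 = 3 → ∀ P ∈ primesAbove k r,
      vord P ((r * t : ℕ) : k) = 1 := by
    intro r t hr ht hrt hr3 P hP
    have h0 : (r : k) ≠ 0 := by exact_mod_cast hr.ne_zero
    have h1 : (t : k) ≠ 0 := by exact_mod_cast ht.ne_zero
    rw [Nat.cast_mul, vord_mul P h0 h1, vord_natCast_prime hr hP,
      B.ram_eq_one hP hr (hl hr hr3)]
    have := vord_intCast_eq_zero hr hP (z := t) (by
      intro h
      exact hrt ((Nat.prime_dvd_prime_iff_eq hr ht).1 (by exact_mod_cast h)))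
    rw [Int.cast_natCast] at this
    rw [this]
    rfl
  obtain ⟨P, hP⟩ := exists_natCast_mem (k := k) hp
  obtain ⟨F, _, _, _, Q, hQ⟩ := QuadExt.exists_of_not_isSquare (k := k) (d := ((p * q : ℕ) : k)) (by
    intro h
    have := vord_sq_even P h
    rw [hv hp hq hpq hp3 P hP] at this
    exact absurd this (by decide))
  have hram : ∀ {r t : ℕ}, r.Prime → t.Prime → r ≠ t → r % 4 = 3 → p * q = r * t →
      primesAbove k r ⊆ ramSet k F := by
    intro r t hr ht hrt hr3 h
    exact primesAbove_subset_of_odd Q fun P hP => by rw [hQ, h]; exact hv hr ht hrt hr3 P hP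
  have hsub : ramSet k F ⊆ primesAbove k p ∪ primesAbove k q := by
    intro P hP
    by_contra hPpq
    simp only [Set.mem_union, not_or] at hPpq
    refine Q.notMem_ramSet (D := ((p * q : ℕ) : 𝓞 k)) (by rw [hQ]; exact (map_natCast _ _).symm)
      ?_ (.inr ?_) hP
    · rw [Nat.cast_mul]
      exact fun h => (P.isPrime.mem_or_mem h).elim hPpq.1 hPpq.2
    · obtain ⟨c, hc⟩ : ∃ c : ℤ, (p * q : ℤ) - 1 = 4 * c := by
        refine ⟨(p * q - 1) / 4, ?_⟩
        have : ((p : ℤ) * q) % 4 = 1 := by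
          rw [Int.mul_emod, show (p : ℤ) % 4 = 3 by omega, show (q : ℤ) % 4 = 3 by omega]
          rfl
        omega
      refine ⟨(c : 𝓞 k), ?_⟩
      have := congrArg (Int.cast (R := 𝓞 k)) hc
      push_cast at this ⊢
      exact this
  have hcard : (ramSet k F).ncard ≤ 2 := by
    refine (Set.ncard_le_ncard hsub
      ((B.primesAbove_finite hp).union (B.primesAbove_finite hq))).trans ?_
    refine (Set.ncard_union_le _ _).trans ?_
    rw [B.ncard_primesAbove_inert hp hpz, B.ncard_primesAbove_inert hq hqz]
  have hpos : (0 : ℝ) < ((p * q : ℕ) : ℝ) := by exact_mod_cast Nat.mul_pos hp.pos hq.pos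
  have h1 := Q.card_two_torsion B.odd_card Q.finite_ramSet
  rw [B.rank_eq, B.rank_eq_three Q (by rw [hQ, map_natCast]; exact hpos)
    (by rw [hQ, map_natCast]; exact hpos)] at h1
  change _ = Q.nu * _ at h1
  have hE := B.e_notMem_of_three Q hp hp3 (hram hp hq hpq hp3 rfl)
  rw [← hQ]
  refine sumTwoSq_of_neg_one_mem Q ?_ fun x => B.sq_ne_neg_one
  by_contra hneg
  rw [B.nu_eq_one Q hneg hE.1 hE.2, one_mul] at h1
  have h2 : 2 ^ ((ramSet k F).ncard + 1) ≤ 2 ^ 3 := Nat.pow_le_pow_right (by norm_num) (by omega)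
  haveI : Nonempty {c : ClassGroup (𝓞 F) // c ^ 2 = 1} := ⟨⟨1, one_pow 2⟩⟩
  have h3 : 0 < Nat.card {c : ClassGroup (𝓞 F) // c ^ 2 = 1} := Nat.card_pos
  have h4 : 0 < 2 ^ ((ramSet k F).ncard + 1) := by positivity
  omega

theorem sumTwoSq_of_primes {x₀ : k} (h0 : x₀ ≠ 0) (n : ℕ) : n % 2 = 1 →
    (∀ q, q.Prime → q ∣ n → q % 4 = 3 → SumTwoSq ((q : k) * x₀)) →
    (n % 4 = 1 → SumTwoSq (n : k)) ∧ (n % 4 = 3 → SumTwoSq ((n : k) * x₀)) := by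
  induction n using induction_on_primes with
  | zero => intro h; omega
  | one => exact fun _ _ => ⟨fun _ => by simpa using sumTwoSq_one, fun h => by omega⟩
  | prime_mul p m hp ih =>
    intro hodd hq
    have ho := Nat.odd_mul.1 (Nat.odd_iff.2 hodd)
    have hp2 := Nat.odd_iff.1 ho.1
    obtain ⟨h1, h3⟩ := ih (Nat.odd_iff.1 ho.2) fun q hqp hqm => hq q hqp (hqm.mul_left p)
    have hm4 : m % 4 = 1 ∨ m % 4 = 3 := by have := Nat.odd_iff.1 ho.2; omega
    rcases (show p % 4 = 1 ∨ p % 4 = 3 by omega) with hp4 | hp4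
    · have hT := sumTwoSq_prime (k := k) hp hp4
      refine ⟨fun h => ?_, fun h => ?_⟩ <;> rcases hm4 with hm4 | hm4 <;>
        rw [Nat.mul_mod, hp4, hm4] at h <;> norm_num at h <;> push_cast
      · exact hT.mul (h1 hm4)
      · rw [mul_assoc]; exact hT.mul (h3 hm4)
    · have hT := hq p hp (Dvd.intro _ rfl) hp4
      refine ⟨fun h => ?_, fun h => ?_⟩ <;> rcases hm4 with hm4 | hm4 <;>
        rw [Nat.mul_mod, hp4, hm4] at h <;> norm_num at h <;> push_cast
      · refine SumTwoSq.of_mul (y := x₀ ^ 2) ?_ ⟨x₀, 0, by ring⟩ (pow_ne_zero 2 h0)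
        convert hT.mul (h3 hm4) using 1
        ring
      · convert hT.mul (h1 hm4) using 1
        ring

theorem neg_one_mem (Q : QuadExt k K) {n : ℕ} (hd : Q.d = n * B.α) (hn : n % 4 = 1 ∨ n % 8 = 2)
    (h : ∀ q, q.Prime → q ∣ n → q % 4 = 3 → ∀ z : ℤ, ¬(q : ℤ) ∣ z ^ 2 - B.l) :
    (-1 : kˣ) ∈ Q.nmU.range := by
  refine neg_one_mem_of_sumTwoSq Q ?_
  rw [hd]
  refine SumTwoSq.mul ?_ B.sumTwoSq_α
  obtain ⟨x₀, hx0, hx⟩ : ∃ x₀ : k, x₀ ≠ 0 ∧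
      ∀ q, q.Prime → q ∣ n → q % 4 = 3 → SumTwoSq ((q : k) * x₀) := by
    by_cases hex : ∃ q, q.Prime ∧ q ∣ n ∧ q % 4 = 3
    · obtain ⟨q₀, hq0, hqn, hq3⟩ := hex
      refine ⟨q₀, by exact_mod_cast hq0.ne_zero, fun q hq hqn' hq3' => ?_⟩
      by_cases he : q = q₀
      · subst he
        exact ⟨q, 0, by ring⟩
      · have := B.sumTwoSq_inert hq hq0 he hq3' hq3 (h q hq hqn' hq3') (h q₀ hq0 hqn hq3)
        simpa using this
    · exact ⟨1, one_ne_zero, fun q hq hqn hq3 => absurd ⟨q, hq, hqn, hq3⟩ hex⟩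
  rcases hn with hn | hn
  · exact (sumTwoSq_of_primes hx0 n (by omega) hx).1 hn
  · obtain ⟨m, rfl⟩ : 2 ∣ n := by omega
    rw [Nat.cast_mul, Nat.cast_ofNat]
    exact sumTwoSq_two.mul ((sumTwoSq_of_primes hx0 m (by omega)
      fun q hq hqm => hx q hq (hqm.mul_left 2)).1 (by omega))

end Base

end GenusCount

namespace GenusCount

open IsDedekindDomain nonZeroDivisors NumberField

namespace Base

variable {k : Type} [Field k] [NumberField k] (B : Base k)

noncomputable def θ : 𝓞 k := B.exists_θ.choose

theorem two_mul_θ : 2 * B.θ = 1 + B.s := B.exists_θ.choose_spec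

theorem σR_θ : B.Q.σR B.θ = 1 - B.θ := by
  have h := congrArg B.Q.σR B.two_mul_θ
  rw [map_mul, map_ofNat, map_add, map_one, σR_s] at h
  have h2 : (2 : 𝓞 k) ≠ 0 := two_ne_zero
  apply mul_left_cancel₀ h2
  linear_combination h + B.two_mul_θ

theorem θ_mul {c : ℤ} (hc : (B.l : ℤ) = 1 + 4 * (2 * c)) : B.θ * (B.θ - 1) = 2 * c := by
  have h4 : (4 : 𝓞 k) ≠ 0 := by norm_num
  apply mul_left_cancel₀ h4
  have h1 := congrArg (Int.cast (R := 𝓞 k)) hc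
  push_cast at h1
  linear_combination (2 * B.θ - 1 + B.s) * B.two_mul_θ + B.s_sq + h1

/-- The numerator of `ε - 1` at the prime above `2` not containing `θ`. -/
theorem θ_sq_mul {c a' b' : ℤ} (hc : (B.l : ℤ) = 1 + 4 * (2 * c)) (ha : B.a = 4 * a')
    (hb : B.b = 1 + 4 * b') : B.θ ^ 2 * ((B.ε : 𝓞 k) - 1) =
      4 * (c * B.θ + a' * B.θ ^ 2 + b' * B.s * B.θ ^ 2) := by
  have ha' := congrArg (Int.cast (R := 𝓞 k)) ha
  have hb' := congrArg (Int.cast (R := 𝓞 k)) hb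
  push_cast at ha' hb'
  rw [val_ε, ha', hb']
  linear_combination 2 * B.θ * B.θ_mul hc - B.θ ^ 2 * B.two_mul_θ

theorem θ_mem_or (P : HeightOneSpectrum (𝓞 k)) (hP : (2 : 𝓞 k) ∈ P.asIdeal) :
    B.θ ∈ P.asIdeal ∨ B.θ - 1 ∈ P.asIdeal := by
  obtain ⟨c, hc⟩ := B.exists_quarter
  apply P.isPrime.mem_or_mem
  rw [B.θ_mul hc]
  exact Ideal.mul_mem_right _ _ hP

theorem e_not_isSquare : ¬IsSquare (B.e : k) := by
  rintro ⟨y, hy⟩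
  have h1 := B.neg_e
  rw [hy, map_mul] at h1
  exact absurd h1 (not_lt.2 (mul_self_nonneg _))

variable {L : Type} [Field L] [NumberField L] [Algebra k L] (Q : QuadExt k L)

section

variable (hQ : Q.d = B.e)

include hQ

theorem ramSet_sqrt_e_subset : ramSet k L ⊆ {P | (2 : 𝓞 k) ∈ P.asIdeal ∧ B.θ ∈ P.asIdeal} := by
  intro P hP
  by_contra hcon
  have hd : P.valuation k Q.d < 1 := by
    refine Q.valuation_d_lt_one hP ?_
    rw [hQ, ← B.coe_ε]
    change P.valuation k (algebraMap (𝓞 k) k B.ε - 1) ≤ _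
    rw [← map_one (algebraMap (𝓞 k) k), ← map_sub, ← map_ofNat (algebraMap (𝓞 k) k) 4]
    by_cases h2 : (2 : 𝓞 k) ∈ P.asIdeal
    · have hθ : B.θ ∉ P.asIdeal := fun h => hcon ⟨h2, h⟩
      obtain ⟨c, hc⟩ := B.exists_quarter
      obtain ⟨a', ha⟩ := B.four_dvd
      obtain ⟨b', hb⟩ : ∃ b', B.b = 1 + 4 * b' := ⟨(B.b - 1) / 4, by have := B.b_mod; omega⟩
      have h1 := congrArg (fun x => P.valuation k (algebraMap (𝓞 k) k x)) (B.θ_sq_mul hc ha hb)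
      have hθ1 : P.valuation k (algebraMap (𝓞 k) k B.θ) = 1 := by
        have hθ0 : algebraMap (𝓞 k) k B.θ ≠ 0 := by
          intro h0
          apply hθ
          rw [(map_eq_zero_iff _ (FaithfulSMul.algebraMap_injective (𝓞 k) k)).1 h0]
          exact zero_mem _
        exact (vord_eq_zero_iff P hθ0).1 (vord_algebraMap_eq_zero P hθ)
      simp only [map_mul, map_pow, hθ1, one_pow, one_mul] at h1
      rw [h1]
      exact mul_le_of_le_one_right' (P.valuation_le_one _)
    · have h4 : P.valuation k (algebraMap (𝓞 k) k 4) = 1 := by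
        have h40 : algebraMap (𝓞 k) k 4 ≠ 0 := by simp
        refine (vord_eq_zero_iff P h40).1 (vord_algebraMap_eq_zero P fun h4 => ?_)
        have : (4 : 𝓞 k) = 2 ^ 2 := by norm_num
        rw [this] at h4
        exact h2 (P.isPrime.mem_of_pow_mem _ h4)
      rw [h4]
      exact P.valuation_le_one _
  have h0 : P.valuation k Q.d = 1 := by
    refine (vord_eq_zero_iff P Q.d_ne_zero).1 ?_
    rw [hQ]
    exact (mem_unitGroup_iff.1 B.e_mem) P
  rw [h0] at hd
  exact lt_irrefl _ hd

theorem neg_nm_pos {y : L} (hy : y ≠ 0) : 0 < B.neg (Q.nm y) := by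
  have h1 := Q.nm_apply (Q.re y) (Q.im y)
  rw [← Q.eq_re_add_im] at h1
  rw [h1, map_sub, map_mul, map_pow, map_pow, hQ]
  have h2 := B.neg_e
  by_contra hcon
  have hX := sq_nonneg (B.neg (Q.re y))
  have hY := mul_nonneg (neg_nonneg.2 h2.le) (sq_nonneg (B.neg (Q.im y)))
  rw [neg_mul] at hY
  have h3 : B.neg (Q.re y) ^ 2 = 0 := by linarith
  have h4 : B.neg B.e * B.neg (Q.im y) ^ 2 = 0 := by linarith
  have h5 : B.neg (Q.im y) = 0 :=
    (pow_eq_zero_iff two_ne_zero).1 ((mul_eq_zero.1 h4).resolve_left h2.ne)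
  have h6 : B.neg (Q.re y) = 0 := (pow_eq_zero_iff two_ne_zero).1 h3
  apply hy
  rw [Q.eq_re_add_im y, (map_eq_zero B.neg).1 h6, (map_eq_zero B.neg).1 h5]
  simp

theorem neg_e_mem_sqrt : -B.e ∈ Q.nmU.range := by
  refine ⟨Units.mk0 Q.δ Q.δ_ne_zero, ?_⟩
  ext
  have h := Q.nm_apply 0 1
  rw [map_zero, zero_add, map_one, one_mul] at h
  rw [Q.val_nmU, Units.val_mk0, h, hQ, Units.val_neg]
  ring

theorem neg_one_notMem_sqrt : (-1 : kˣ) ∉ Q.nmU.range := by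
  rintro ⟨y, hy⟩
  have := B.neg_nm_pos Q hQ y.ne_zero
  rw [← Q.val_nmU, hy] at this
  norm_num at this

theorem sqrt_card : Nat.card {c : ClassGroup (𝓞 L) // c ^ 2 = 1} = 1 ∧
    ∀ P : HeightOneSpectrum (𝓞 k), (2 : 𝓞 k) ∈ P.asIdeal → B.θ ∈ P.asIdeal → P ∈ ramSet k L := by
  have hfin := Q.finite_ramSet
  have hsub := B.ramSet_sqrt_e_subset Q hQ
  have hS : ∀ P P' : HeightOneSpectrum (𝓞 k), (2 : 𝓞 k) ∈ P.asIdeal → B.θ ∈ P.asIdeal →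
      (2 : 𝓞 k) ∈ P'.asIdeal → B.θ ∈ P'.asIdeal → P' = P := by
    intro P P' h1 h2 h3 h4
    rcases B.Q.eq_or_eq_sw_of_mem Nat.prime_two (P := P) (P' := P') (by simpa using h1)
      (by simpa using h3) with h | h
    · exact h
    · exfalso
      rw [h, B.Q.mem_sw, σR_θ] at h4
      have := Ideal.add_mem _ h4 h2
      rw [sub_add_cancel] at this
      exact P.isPrime.ne_top ((Ideal.eq_top_iff_one _).2 this)
  have hle : (ramSet k L).ncard ≤ 1 := by
    refine (Set.ncard_le_one hfin).2 fun P hP P' hP' => ?_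
    exact hS P' P (hsub hP').1 (hsub hP').2 (hsub hP).1 (hsub hP).2
  have h1 := Q.card_two_torsion B.odd_card hfin
  change _ = Q.nu * _ at h1
  rw [B.rank_eq, B.nu_eq_two_of_neg_e Q (B.neg_e_mem_sqrt Q hQ) (B.neg_one_notMem_sqrt Q hQ)] at h1
  have h2 : 2 ≤ Units.rank L := Q.two_le_rank B.finrank_eq B.pos (by rw [hQ]; exact B.pos_e)
  haveI : Nonempty {c : ClassGroup (𝓞 L) // c ^ 2 = 1} := ⟨⟨1, one_pow 2⟩⟩
  have h3 : 0 < Nat.card {c : ClassGroup (𝓞 L) // c ^ 2 = 1} := Nat.card_pos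
  have h4 : 2 ^ 3 ≤ 2 ^ (Units.rank L + 1) := Nat.pow_le_pow_right (by norm_num) (by omega)
  have hcard : (ramSet k L).ncard = 1 := by
    by_contra hne
    have h0 : (ramSet k L).ncard = 0 := by omega
    rw [h0] at h1
    have h5 := Nat.mul_le_mul h3 h4
    rw [h1] at h5
    norm_num at h5
  rw [hcard] at h1
  refine ⟨le_antisymm (by_contra fun hlt => ?_) h3, fun P hP hθ => ?_⟩
  · have h5 := Nat.mul_le_mul (Nat.lt_of_not_le hlt) h4
    rw [h1] at h5
    norm_num at h5
  obtain ⟨P', hP'⟩ := Set.ncard_eq_one.1 hcard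
  have h5 : P' ∈ ramSet k L := by rw [hP']; rfl
  rw [hS P' P (hsub h5).1 (hsub h5).2 hP hθ]
  exact h5

theorem sqrt_odd_card : Odd (Nat.card (ClassGroup (𝓞 L))) :=
  odd_card_of_card_two_torsion (B.sqrt_card Q hQ).1

end

end Base

end GenusCount

namespace GenusCount

open IsDedekindDomain nonZeroDivisors NumberField

variable {k : Type} [Field k] [NumberField k]
variable {L : Type} [Field L] [NumberField L] [Algebra k L]

theorem QuadExt.exists_norm_odd_iff (Q : QuadExt k L) (hodd : Odd (Nat.card (ClassGroup (𝓞 L))))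
    {P : HeightOneSpectrum (𝓞 k)}
    (hP : (∃ w : HeightOneSpectrum (𝓞 L), w.under (𝓞 k) = P ∧ Q.sw w ≠ w) ∨ P ∈ ramSet k L) :
    ∃ y ∈ Q.nmU.range, ∀ P' : HeightOneSpectrum (𝓞 k), Odd (vord P' (y : k)) ↔ P' = P := by
  classical
  obtain ⟨w, hw, hcase⟩ : ∃ w : HeightOneSpectrum (𝓞 L), w.under (𝓞 k) = P ∧
      (Q.sw w ≠ w ∨ Q.sw w = w ∧ ram k w = 2) := by
    rcases hP with ⟨w, hw, h⟩ | hP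
    · exact ⟨w, hw, Or.inl h⟩
    · obtain ⟨w, hw⟩ := exists_over (K := L) P
      exact ⟨w, hw, Or.inr ⟨Q.sw_eq_of_even (hP w hw), Q.ram_eq_of_even (hP w hw)⟩⟩
  obtain ⟨β, hβ0, hβ⟩ := exists_generator_pow_card w
  have hβ1 : algebraMap (𝓞 L) L β ≠ 0 := by simpa using hβ0
  have hv (w' : HeightOneSpectrum (𝓞 L)) := Q.vord_nm w' hβ1
  refine ⟨Q.nmU (Units.mk0 _ hβ1), ⟨_, rfl⟩, fun P' => ?_⟩
  rw [Q.val_nmU, Units.val_mk0]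
  constructor
  · intro ho
    by_contra hne
    obtain ⟨w', hw'⟩ := exists_over (K := L) P'
    have h1 := hv w'
    have h2 : w' ≠ w := fun h => hne (by rw [← hw', h, hw])
    have h3 : Q.sw w' ≠ w := fun h => hne (by rw [← hw', ← Q.under_sw, h, hw])
    rw [vord_of_span_eq hβ0 hβ, vord_of_span_eq hβ0 hβ, if_neg h2, if_neg h3, add_zero, hw'] at h1
    have h4 := ram_pos (k := k) w'
    rcases mul_eq_zero.1 h1 with h | h
    · omega
    · rw [h] at ho
      exact absurd ho (by decide)
  · rintro rfl
    have h1 := hv w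
    rw [vord_of_span_eq hβ0 hβ, vord_of_span_eq hβ0 hβ, if_pos rfl, hw] at h1
    have h5 : Odd ((Nat.card (ClassGroup (𝓞 L)) : ℕ) : ℤ) := by exact_mod_cast hodd
    rcases hcase with h | ⟨h, h2⟩
    · rw [if_neg h, add_zero] at h1
      rw [← h1] at h5
      exact (Int.odd_mul.1 h5).2
    · rw [if_pos h, h2] at h1
      have : vord P' (Q.nm (algebraMap (𝓞 L) L β)) = Nat.card (ClassGroup (𝓞 L)) := by
        push_cast at h1
        omega
      rw [this]
      exact h5

theorem QuadExt.exists_norm_odd_iff_mem (Q : QuadExt k L)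
    (hodd : Odd (Nat.card (ClassGroup (𝓞 L)))) (S : Finset (HeightOneSpectrum (𝓞 k)))
    (hS : ∀ P ∈ S, (∃ w : HeightOneSpectrum (𝓞 L), w.under (𝓞 k) = P ∧ Q.sw w ≠ w) ∨
      P ∈ ramSet k L) :
    ∃ y ∈ Q.nmU.range, ∀ P : HeightOneSpectrum (𝓞 k), Odd (vord P (y : k)) ↔ P ∈ S := by
  classical
  induction S using Finset.induction_on with
  | empty => exact ⟨1, one_mem _, fun P => by simp⟩
  | insert P₀ S hP₀ ih =>
    obtain ⟨y, hy, hyS⟩ := ih fun P hP => hS P (Finset.mem_insert_of_mem hP)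
    obtain ⟨z, hz, hzP⟩ := Q.exists_norm_odd_iff hodd (hS P₀ (Finset.mem_insert_self _ _))
    refine ⟨y * z, mul_mem hy hz, fun P => ?_⟩
    rw [Units.val_mul, vord_mul P y.ne_zero z.ne_zero, Int.odd_add, hyS, Finset.mem_insert,
      ← Int.not_odd_iff_even, hzP]
    by_cases hP : P = P₀
    · subst hP
      simp [hP₀]
    · simp [hP]

namespace Base

variable (B : Base k) (Q : QuadExt k L)

/-- A weak Hasse principle for norms from `k(√ε)`. -/
theorem mem_norms_sqrt (hQ : Q.d = B.e) {x : kˣ} (hx : 0 < B.neg x)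
    (h : ∀ P : HeightOneSpectrum (𝓞 k), Odd (vord P (x : k)) →
      (∃ w : HeightOneSpectrum (𝓞 L), w.under (𝓞 k) = P ∧ Q.sw w ≠ w) ∨ P ∈ ramSet k L) :
    x ∈ Q.nmU.range := by
  have hfin : {P : HeightOneSpectrum (𝓞 k) | Odd (vord P (x : k))}.Finite := by
    refine (vord_finite (x : k) x.ne_zero).subset fun P hP h0 => ?_
    rw [Set.mem_ofPred_eq, h0] at hP
    exact absurd hP (by decide)
  obtain ⟨y, hy, hyS⟩ := Q.exists_norm_odd_iff_mem (B.sqrt_odd_card Q hQ) hfin.toFinset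
    fun P hP => h P (hfin.mem_toFinset.1 hP)
  have hsel : x * y ∈ selmer (𝓞 k) k := by
    rw [mem_selmer]
    intro P
    rw [Units.val_mul, vord_mul P x.ne_zero y.ne_zero, Int.even_add, ← Int.not_odd_iff_even,
      ← Int.not_odd_iff_even, hyS, hfin.mem_toFinset]
    rfl
  rw [selmer_eq_of_odd B.odd_card] at hsel
  obtain ⟨u, hu, s, hs, hus⟩ := Subgroup.mem_sup.1 hsel
  have hs' := squares_le_norms Q hs
  have hxu : x = u * s * y⁻¹ := by rw [hus, mul_inv_cancel_right]
  rw [hxu]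
  refine mul_mem (mul_mem ?_ hs') (inv_mem hy)
  have hypos : 0 < B.neg y := by
    obtain ⟨z, rfl⟩ := hy
    rw [Q.val_nmU]
    exact B.neg_nm_pos Q hQ z.ne_zero
  have hupos : 0 < B.neg u := by
    have h1 := congrArg (fun t : kˣ => B.neg (t : k)) hus
    simp only [Units.val_mul, map_mul] at h1
    have h2 := (B.pos_of_mem_squares hs).2
    have h3 := mul_pos hx hypos
    rw [← h1] at h3
    exact (pos_iff_pos_of_mul_pos h3).2 h2
  have he := B.neg_e
  rcases B.unit_cases hu with h1 | h1 | h1 | h1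
  · exact squares_le_norms Q h1
  · have := (B.pos_of_mem_squares h1).2
    rw [Units.val_neg, map_neg] at this
    linarith
  · have := (B.pos_of_mem_squares h1).2
    rw [Units.val_mul, map_mul] at this
    nlinarith
  · have h2 := squares_le_norms Q h1
    have h3 : u = -(u * B.e) * (-B.e)⁻¹ := by rw [← mul_neg, mul_inv_cancel_right]
    rw [h3]
    exact mul_mem h2 (inv_mem (B.neg_e_mem_sqrt Q hQ))

end Base

end GenusCount

namespace GenusCount

open IsDedekindDomain nonZeroDivisors NumberField

variable {k : Type} [Field k] [NumberField k]
variable {L : Type} [Field L] [NumberField L] [Algebra k L]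

namespace QuadExt

variable (Q : QuadExt k L)

theorem exists_integral_sqrt {D : 𝓞 k} (hD : Q.d = D) :
    ∃ η : 𝓞 L, (η : L) = Q.δ ∧ η ^ 2 = algebraMap (𝓞 k) (𝓞 L) D ∧ Q.σR η = -η := by
  have h_int : IsIntegral ℤ Q.δ := by
    have h1 : IsIntegral ℤ (Q.δ ^ 2) := by
      rw [Q.sq, hD]
      exact (RingOfIntegers.isIntegral_coe D).algebraMap
    exact h1.of_pow two_pos
  refine ⟨⟨Q.δ, h_int⟩, rfl, ?_, ?_⟩
  · apply RingOfIntegers.ext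
    change Q.δ ^ 2 = _
    rw [Q.sq, hD]
    rfl
  · apply RingOfIntegers.ext
    change Q.σ Q.δ = -Q.δ
    exact Q.map_δ

theorem sw_ne_of_sub_sq_mem {D : 𝓞 k} (hD : Q.d = D) {w : HeightOneSpectrum (𝓞 L)}
    (h2 : (2 : 𝓞 k) ∉ (w.under (𝓞 k)).asIdeal) (hDw : D ∉ (w.under (𝓞 k)).asIdeal) {x y : 𝓞 k}
    (hy : y ∉ (w.under (𝓞 k)).asIdeal) (h : D * y ^ 2 - x ^ 2 ∈ (w.under (𝓞 k)).asIdeal) :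
    Q.sw w ≠ w := by
  intro hw
  obtain ⟨η, -, hη, hση⟩ := Q.exists_integral_sqrt hD
  have hmem (t : 𝓞 L) (ht : t ∈ w.asIdeal) : Q.σR t ∈ w.asIdeal := by
    rw [← Q.mem_sw, hw]
    exact ht
  have h1 : (η * algebraMap _ _ y - algebraMap _ _ x) *
      (η * algebraMap _ _ y + algebraMap (𝓞 k) (𝓞 L) x) ∈ w.asIdeal := by
    have h3 : algebraMap (𝓞 k) (𝓞 L) (D * y ^ 2 - x ^ 2) ∈ w.asIdeal := h
    rw [map_sub, map_mul, map_pow, map_pow, ← hη] at h3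
    convert h3 using 1
    ring
  have h2x : algebraMap (𝓞 k) (𝓞 L) (2 * x) ∈ w.asIdeal := by
    rcases w.isPrime.mem_or_mem h1 with h3 | h3
    · have h4 := Ideal.add_mem _ h3 (hmem _ h3)
      rw [map_sub, map_mul, hση, σR_algebraMap, σR_algebraMap] at h4
      rw [← neg_mem_iff, map_mul, map_ofNat]
      convert h4 using 1
      ring
    · have h4 := Ideal.add_mem _ h3 (hmem _ h3)
      rw [map_add, map_mul, hση, σR_algebraMap, σR_algebraMap] at h4
      rw [map_mul, map_ofNat]
      convert h4 using 1
      ring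
  have hx : x ∈ (w.under (𝓞 k)).asIdeal := by
    have h2x' : 2 * x ∈ (w.under (𝓞 k)).asIdeal := h2x
    exact ((w.under (𝓞 k)).isPrime.mem_or_mem h2x').resolve_left h2
  have h5 : D * y ^ 2 ∈ (w.under (𝓞 k)).asIdeal := by
    have := Ideal.add_mem _ h (Ideal.pow_mem_of_mem _ hx 2 two_pos)
    rwa [sub_add_cancel] at this
  rcases (w.under (𝓞 k)).isPrime.mem_or_mem h5 with h6 | h6
  · exact hDw h6
  · exact hy ((w.under (𝓞 k)).isPrime.mem_of_pow_mem _ h6)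

end QuadExt

namespace Base

variable (B : Base k) (Q : QuadExt k L)

theorem sw_ne_of_theta_notMem (hQ : Q.d = B.e) (h8 : (8 : ℤ) ∣ B.a) {w : HeightOneSpectrum (𝓞 L)}
    (h2 : (2 : 𝓞 k) ∈ (w.under (𝓞 k)).asIdeal) (hθ : B.θ ∉ (w.under (𝓞 k)).asIdeal) :
    Q.sw w ≠ w := by
  intro hw
  obtain ⟨η, hηδ, hη, hση⟩ := Q.exists_integral_sqrt (D := (B.ε : 𝓞 k)) (by rw [hQ, B.coe_ε])
  obtain ⟨c, hc⟩ := B.exists_quarter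
  obtain ⟨a', ha⟩ := h8
  obtain ⟨b', hb⟩ : ∃ b', B.b = 1 + 4 * b' := ⟨(B.b - 1) / 4, by have := B.b_mod; omega⟩
  have hbc : (2 : ℤ) ∣ c + b' := by
    have h1 := B.pell
    rw [hc, ha] at h1
    have h2 : c * B.b ^ 2 + b' + 2 * b' ^ 2 = 8 * a' ^ 2 := by
      rw [hb] at h1 ⊢
      nlinarith
    rw [hb] at h2
    exact ⟨4 * a' ^ 2 - b' ^ 2 - c * (4 * b' + 8 * b' ^ 2), by linarith⟩
  set N : 𝓞 k := c * B.θ + (2 * a' : ℤ) * B.θ ^ 2 + b' * B.s * B.θ ^ 2 with hN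
  have h3 : B.θ ^ 2 * ((B.ε : 𝓞 k) - 1) = 4 * N :=
    B.θ_sq_mul hc (a' := 2 * a') (by rw [ha]; ring) hb
  have hNmem : N ∈ (w.under (𝓞 k)).asIdeal := by
    have hθ1 := (B.θ_mem_or _ h2).resolve_left hθ
    obtain ⟨t, ht⟩ := hbc
    have ht' := congrArg (Int.cast (R := 𝓞 k)) ht
    push_cast at ht'
    have hs : B.s = 2 * B.θ - 1 := by linear_combination -B.two_mul_θ
    have h4 : N = (B.θ - 1) * (c + b' * (2 * B.θ ^ 2 + B.θ + 1)) +
        2 * ((t : 𝓞 k) + a' * B.θ ^ 2) := by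
      rw [hN, hs]
      push_cast
      linear_combination ht'
    rw [h4]
    exact Ideal.add_mem _ (Ideal.mul_mem_right _ _ hθ1) (Ideal.mul_mem_right _ _ h2)
  have hγ : ∃ γ : 𝓞 L, 2 * γ = algebraMap (𝓞 k) (𝓞 L) B.θ * (1 + η) := by
    have hg : ((algebraMap (𝓞 k) (𝓞 L) B.θ : L) * (1 + η) / 2) ^ 2 -
        algebraMap (𝓞 k) (𝓞 L) B.θ * ((algebraMap (𝓞 k) (𝓞 L) B.θ : L) * (1 + η) / 2) -
        algebraMap (𝓞 k) (𝓞 L) N = 0 := by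
      have h5 := congrArg (fun t => ((algebraMap (𝓞 k) (𝓞 L) t : 𝓞 L) : L)) h3
      have h6 := congrArg (fun t : 𝓞 L => (t : L)) hη
      simp only [map_mul, map_sub, map_pow, map_one, map_ofNat] at h5 h6
      linear_combination h5 / 4 + (algebraMap (𝓞 k) (𝓞 L) B.θ : L) ^ 2 / 4 * h6
    have h_int : IsIntegral (𝓞 L) ((algebraMap (𝓞 k) (𝓞 L) B.θ : L) * (1 + η) / 2) := by
      refine ⟨Polynomial.X ^ 2 - (Polynomial.C (algebraMap (𝓞 k) (𝓞 L) B.θ) * Polynomial.X +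
        Polynomial.C (algebraMap (𝓞 k) (𝓞 L) N)), ?_, ?_⟩
      · apply Polynomial.monic_X_pow_sub
        exact Polynomial.degree_linear_le.trans_lt (by norm_num)
      · simp only [Polynomial.eval₂_sub, Polynomial.eval₂_add, Polynomial.eval₂_mul,
          Polynomial.eval₂_pow, Polynomial.eval₂_X, Polynomial.eval₂_C]
        linear_combination hg
    obtain ⟨γ, hγ⟩ := IsIntegrallyClosed.isIntegral_iff.1 h_int
    refine ⟨γ, RingOfIntegers.ext ?_⟩
    change (algebraMap (𝓞 L) L (2 * γ)) = algebraMap (𝓞 L) L _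
    rw [map_mul, map_ofNat, hγ, map_mul, map_add, map_one]
    ring
  obtain ⟨γ, hγ⟩ := hγ
  have h20 : (2 : 𝓞 L) ≠ 0 := two_ne_zero
  have hσγ : Q.σR γ = algebraMap (𝓞 k) (𝓞 L) B.θ - γ := by
    have h5 := congrArg Q.σR hγ
    rw [map_mul, map_ofNat, map_mul, map_add, map_one, hση, Q.σR_algebraMap] at h5
    apply mul_left_cancel₀ h20
    linear_combination h5 + hγ
  have hprod : γ * (γ - algebraMap (𝓞 k) (𝓞 L) B.θ) = algebraMap (𝓞 k) (𝓞 L) N := by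
    have h5 := congrArg (algebraMap (𝓞 k) (𝓞 L)) h3
    simp only [map_mul, map_sub, map_pow, map_one, map_ofNat] at h5
    have h40 : (4 : 𝓞 L) ≠ 0 := by norm_num
    apply mul_left_cancel₀ h40
    linear_combination h5 + (algebraMap (𝓞 k) (𝓞 L) B.θ) ^ 2 * hη +
      (2 * γ + algebraMap (𝓞 k) (𝓞 L) B.θ * (1 + η) - 2 * algebraMap (𝓞 k) (𝓞 L) B.θ) * hγ
  have hmem (t : 𝓞 L) (ht : t ∈ w.asIdeal) : Q.σR t ∈ w.asIdeal := by
    rw [← Q.mem_sw, hw]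
    exact ht
  have h7 : γ * (γ - algebraMap (𝓞 k) (𝓞 L) B.θ) ∈ w.asIdeal := by
    rw [hprod]
    exact hNmem
  have h8 : algebraMap (𝓞 k) (𝓞 L) B.θ ∈ w.asIdeal := by
    rcases w.isPrime.mem_or_mem h7 with h | h
    · have h9 := Ideal.add_mem _ h (hmem _ h)
      rwa [hσγ, add_sub_cancel] at h9
    · have h9 := hmem _ h
      rw [map_sub, Q.σR_algebraMap, hσγ, sub_sub_cancel_left] at h9
      rw [← neg_mem_iff]
      have hγw : γ ∈ w.asIdeal := neg_mem_iff.1 h9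
      have h12 := Ideal.sub_mem _ h hγw
      rwa [sub_sub_cancel_left] at h12
  exact hθ h8

end Base

end GenusCount

namespace GenusCount

open IsDedekindDomain nonZeroDivisors NumberField

namespace Base

variable {k : Type} [Field k] [NumberField k] (B : Base k)

theorem exists_dvd_a_sub_sq : ∃ x : ℤ, (B.l : ℤ) ∣ B.a - x ^ 2 := by
  haveI : Fact B.l.Prime := ⟨B.prime⟩
  have hsq : ((B.a : ℤ) : ZMod B.l) ^ 2 = -1 := by
    have h1 := congrArg (Int.cast (R := ZMod B.l)) B.pell
    push_cast at h1
    rw [ZMod.natCast_self, zero_mul] at h1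
    linear_combination h1
  have hne : ((B.a : ℤ) : ZMod B.l) ≠ 0 := by
    intro h0
    rw [h0] at hsq
    norm_num at hsq
  have hpow : ((B.a : ℤ) : ZMod B.l) ^ (B.l / 2) = 1 := by
    obtain ⟨m, hm⟩ : ∃ m, B.l / 2 = 2 * (2 * m) := ⟨B.l / 8, by have := B.mod_eight; omega⟩
    rw [hm, pow_mul, hsq, pow_mul, neg_one_sq, one_pow]
  obtain ⟨y, hy⟩ := (ZMod.euler_criterion B.l hne).2 hpow
  obtain ⟨x, rfl⟩ := ZMod.intCast_surjective y
  refine ⟨x, (ZMod.intCast_zmod_eq_zero_iff_dvd _ _).1 ?_⟩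
  push_cast
  rw [hy]
  ring

theorem exists_dvd_mul_or {p : ℕ} (hp : p.Prime) {m : ℤ} (hm : ¬(p : ℤ) ∣ m) {r : ℤ}
    (hr : ∀ z : ℤ, ¬(p : ℤ) ∣ z ^ 2 - r) :
    (∃ t : ℤ, (p : ℤ) ∣ m - t ^ 2) ∨ ∃ t : ℤ, (p : ℤ) ∣ r * m - t ^ 2 := by
  haveI : Fact p.Prime := ⟨hp⟩
  have key (u : ℤ) (hu : IsSquare (u : ZMod p)) : ∃ t : ℤ, (p : ℤ) ∣ u - t ^ 2 := by
    obtain ⟨y, hy⟩ := hu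
    obtain ⟨x, rfl⟩ := ZMod.intCast_surjective y
    refine ⟨x, (ZMod.intCast_zmod_eq_zero_iff_dvd _ _).1 ?_⟩
    push_cast
    rw [hy]
    ring
  have hr' : legendreSym p r = -1 := by
    rw [legendreSym.eq_neg_one_iff]
    intro h
    obtain ⟨t, ht⟩ := key r h
    exact hr t (by rwa [← dvd_neg, neg_sub])
  have hm0 : (m : ZMod p) ≠ 0 := fun h => hm ((ZMod.intCast_zmod_eq_zero_iff_dvd _ _).1 h)
  have hr0 : (r : ZMod p) ≠ 0 := by
    intro h
    rw [(legendreSym.eq_zero_iff p r).2 h] at hr'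
    norm_num at hr'
  rcases legendreSym.eq_one_or_neg_one p hm0 with h | h
  · exact Or.inl (key _ ((legendreSym.eq_one_iff p hm0).1 h))
  · refine Or.inr (key _ ((legendreSym.eq_one_iff p ?_).1 ?_))
    · push_cast
      exact mul_ne_zero hr0 hm0
    · rw [legendreSym.mul, hr', h]
      norm_num

/-- At a prime of `k` above an inert prime `p ≡ 1 (mod 4)` the unit `ε` is a square. -/
theorem exists_ε_sub_sq_mem_inert {P : HeightOneSpectrum (𝓞 k)} {p : ℕ} (hp : p.Prime)
    (h1 : p % 4 = 1) (hpl : p ≠ B.l) (hP : (p : 𝓞 k) ∈ P.asIdeal)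
    (hz : ∀ z : ℤ, ¬(p : ℤ) ∣ z ^ 2 - B.l) :
    ∃ x y : 𝓞 k, y ∉ P.asIdeal ∧ (B.ε : 𝓞 k) * y ^ 2 - x ^ 2 ∈ P.asIdeal := by
  have hp2 : p ≠ 2 := by rintro rfl; norm_num at h1
  have hp' := Nat.prime_iff_prime_int.1 hp
  obtain ⟨ι, hι⟩ : ∃ ι : ℤ, (p : ℤ) ∣ -1 - ι ^ 2 ∧ ¬(p : ℤ) ∣ B.a + ι := by
    obtain ⟨ι, hι⟩ := exists_dvd_neg_one_sub_sq hp h1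
    by_cases h : (p : ℤ) ∣ B.a + ι
    · refine ⟨-ι, by rwa [neg_sq], fun h' => ?_⟩
      have h2 : (p : ℤ) ∣ 2 * ι := by
        have := dvd_sub h h'
        ring_nf at this
        rwa [mul_comm]
      have h3 : (p : ℤ) ∣ ι := by
        by_contra h3
        exact not_dvd_two_mul hp hp2 h3 h2
      have h4 : (p : ℤ) ∣ 1 := by
        have := dvd_neg.2 (dvd_add hι (dvd_pow h3 two_ne_zero))
        simpa using this
      exact hp'.not_isUnit (isUnit_of_dvd_one h4)
    · exact ⟨ι, hι, h⟩
  obtain ⟨hι, hne⟩ := hι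
  have hm : ¬(p : ℤ) ∣ 2 * (B.a + ι) := not_dvd_two_mul hp hp2 hne
  have hιP : (((-1 - ι ^ 2 : ℤ)) : 𝓞 k) ∈ P.asIdeal := (GenusCount.intCast_mem hp hP _).2 hι
  have hpell := congrArg (Int.cast (R := 𝓞 k)) B.pell
  push_cast at hpell hιP
  have hkey : (B.ε : 𝓞 k) * (2 * (B.a + ι)) - (B.a + ι + B.b * B.s) ^ 2 ∈ P.asIdeal := by
    have : (B.ε : 𝓞 k) * (2 * (B.a + ι)) - (B.a + ι + B.b * B.s) ^ 2 = -1 - (ι : 𝓞 k) ^ 2 := by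
      rw [val_ε]
      linear_combination -(B.b : 𝓞 k) ^ 2 * B.s_sq + hpell
    rw [this]
    exact hιP
  have hnot {u t : ℤ} (hu : ¬(p : ℤ) ∣ u) (ht : (p : ℤ) ∣ u - t ^ 2) : (t : 𝓞 k) ∉ P.asIdeal := by
    rw [GenusCount.intCast_mem hp hP]
    intro h
    apply hu
    have := dvd_add ht (dvd_pow h two_ne_zero)
    rwa [sub_add_cancel] at this
  rcases exists_dvd_mul_or hp hm hz with ⟨t, ht⟩ | ⟨t, ht⟩
  · refine ⟨B.a + ι + B.b * B.s, t, hnot hm ht, ?_⟩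
    have h5 := (GenusCount.intCast_mem hp hP _).2 ht
    push_cast at h5
    have h6 := Ideal.sub_mem _ hkey (Ideal.mul_mem_left _ (B.ε : 𝓞 k) h5)
    convert h6 using 1
    ring
  · have hpl' : ¬(p : ℤ) ∣ B.l := by
      rw [Int.natCast_dvd_natCast, Nat.prime_dvd_prime_iff_eq hp B.prime]
      exact hpl
    refine ⟨B.s * (B.a + ι + B.b * B.s), t,
      hnot (fun h => (hp'.dvd_or_dvd h).elim hpl' hm) ht, ?_⟩
    have h5 := (GenusCount.intCast_mem hp hP _).2 ht
    push_cast at h5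
    have h6 := Ideal.sub_mem _ (Ideal.mul_mem_left _ (B.l : 𝓞 k) hkey)
      (Ideal.mul_mem_left _ (B.ε : 𝓞 k) h5)
    convert h6 using 1
    linear_combination -(B.a + ι + B.b * B.s : 𝓞 k) ^ 2 * B.s_sq

theorem exists_ε_sub_sq_mem_split {P : HeightOneSpectrum (𝓞 k)} {p : ℕ} (hp : p.Prime)
    (hP : (p : 𝓞 k) ∈ P.asIdeal) {z : ℤ} (hz : (p : ℤ) ∣ z ^ 2 - B.l)
    (h : ∀ z : ℤ, (p : ℤ) ∣ z ^ 2 - B.l → ∃ x : ℤ, (p : ℤ) ∣ B.a + B.b * z - x ^ 2) :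
    ∃ x y : 𝓞 k, y ∉ P.asIdeal ∧ (B.ε : 𝓞 k) * y ^ 2 - x ^ 2 ∈ P.asIdeal := by
  obtain ⟨z, hz, hzP⟩ : ∃ z : ℤ, (p : ℤ) ∣ z ^ 2 - B.l ∧ B.s - (z : 𝓞 k) ∈ P.asIdeal := by
    rcases B.s_sub_or_s_add hP hp hz with h' | h'
    · exact ⟨z, hz, h'⟩
    · exact ⟨-z, by rwa [neg_sq], by simpa using h'⟩
  obtain ⟨x, hx⟩ := h z hz
  refine ⟨x, 1, (Ideal.ne_top_iff_one _).1 P.isPrime.ne_top, ?_⟩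
  have h5 := (GenusCount.intCast_mem hp hP _).2 hx
  push_cast at h5
  have h6 := Ideal.add_mem _ h5 (Ideal.mul_mem_left _ (B.b : 𝓞 k) hzP)
  convert h6 using 1
  rw [val_ε]
  ring

theorem exists_ε_sub_sq_mem_l {P : HeightOneSpectrum (𝓞 k)} (hP : (B.l : 𝓞 k) ∈ P.asIdeal) :
    ∃ x y : 𝓞 k, y ∉ P.asIdeal ∧ (B.ε : 𝓞 k) * y ^ 2 - x ^ 2 ∈ P.asIdeal := by
  obtain ⟨x, hx⟩ := B.exists_dvd_a_sub_sq
  refine ⟨x, 1, (Ideal.ne_top_iff_one _).1 P.isPrime.ne_top, ?_⟩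
  have h5 := (GenusCount.intCast_mem B.prime hP _).2 hx
  push_cast at h5
  have h6 := Ideal.add_mem _ h5 (Ideal.mul_mem_left _ (B.b : 𝓞 k) (B.s_mem hP))
  convert h6 using 1
  rw [val_ε]
  ring

variable {K : Type} [Field K] [NumberField K] [Algebra k K] (Q : QuadExt k K)

theorem e_mem_norms {n : ℕ} (hn : n ≠ 0) (hd : Q.d = n * B.α)
    (h1 : ∀ p : ℕ, p.Prime → p ∣ n → p ≠ 2 → p % 4 = 1)
    (hsq : ∀ p : ℕ, p.Prime → p ∣ n → p ≠ 2 → ∀ z : ℤ, (p : ℤ) ∣ z ^ 2 - B.l →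
      ∃ x : ℤ, (p : ℤ) ∣ B.a + B.b * z - x ^ 2)
    (h8 : 2 ∣ n → (8 : ℤ) ∣ B.a) : B.e ∈ Q.nmU.range := by
  obtain ⟨L, _, _, _, Q', hQ'⟩ := QuadExt.exists_of_not_isSquare B.e_not_isSquare
  have hn0 : (n : k) ≠ 0 := by exact_mod_cast hn
  have hx0 : (n : k) * B.α ≠ 0 := mul_ne_zero hn0 B.α_ne_zero
  have hεL : Q'.d = ((B.ε : 𝓞 k) : k) := by rw [hQ', B.coe_ε]
  have hmem : Units.mk0 _ hx0 ∈ Q'.nmU.range := by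
    refine B.mem_norms_sqrt Q' hQ' ?_ fun P hP => ?_
    · rw [Units.val_mk0, map_mul, map_natCast]
      exact mul_pos (by exact_mod_cast Nat.pos_of_ne_zero hn) B.neg_α
    obtain ⟨p, hp, hpP⟩ := exists_prime_mem P
    rw [Units.val_mk0, vord_mul P hn0 B.α_ne_zero, B.vord_α] at hP
    obtain ⟨w, hw⟩ := exists_over (K := L) P
    have hsplit (h2 : p ≠ 2) (h : ∃ x y : 𝓞 k, y ∉ P.asIdeal ∧
        (B.ε : 𝓞 k) * y ^ 2 - x ^ 2 ∈ P.asIdeal) : ∃ w : HeightOneSpectrum (𝓞 L),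
        w.under (𝓞 k) = P ∧ Q'.sw w ≠ w := by
      obtain ⟨x, y, hy, hxy⟩ := h
      refine ⟨w, hw, ?_⟩
      subst hw
      refine Q'.sw_ne_of_sub_sq_mem hεL (fun h => h2 ?_) (unit_notMem _ _) hy hxy
      exact prime_mem_unique hp Nat.prime_two hpP (by simpa using h)
    have hl2 : B.l ≠ 2 := by have := B.mod_eight; omega
    by_cases hpl : p = B.l
    · subst hpl
      exact Or.inl (hsplit hl2 (B.exists_ε_sub_sq_mem_l hpP))
    have hpn : p ∣ n := by
      by_contra hpn
      have hlP : (B.l : 𝓞 k) ∉ P.asIdeal := fun h => hpl (prime_mem_unique hp B.prime hpP h)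
      have h0 := vord_intCast_eq_zero hp hpP (z := n) (by exact_mod_cast hpn)
      rw [Int.cast_natCast] at h0
      rw [B.vord_δ_eq_zero hlP, h0] at hP
      exact absurd hP (by decide)
    by_cases hp2 : p = 2
    · subst hp2
      by_cases hθ : B.θ ∈ P.asIdeal
      · exact Or.inr ((B.sqrt_card Q' hQ').2 P (by simpa using hpP) hθ)
      · refine Or.inl ⟨w, hw, ?_⟩
        subst hw
        exact B.sw_ne_of_theta_notMem Q' hQ' (h8 hpn) (by simpa using hpP) hθ
    · by_cases hz : ∃ z : ℤ, (p : ℤ) ∣ z ^ 2 - B.l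
      · obtain ⟨z, hz⟩ := hz
        exact Or.inl (hsplit hp2 (B.exists_ε_sub_sq_mem_split hp hpP hz (hsq p hp hpn hp2)))
      · exact Or.inl (hsplit hp2 (B.exists_ε_sub_sq_mem_inert hp (h1 p hp hpn hp2) hpl hpP
          (not_exists.1 hz)))
  obtain ⟨y, hy⟩ := hmem
  have h2 := congrArg (fun t : kˣ => (t : k)) hy
  rw [Q'.val_nmU, Q'.eq_re_add_im y, Q'.nm_apply, hQ', Units.val_mk0] at h2
  set X := Q'.re y
  set Y := Q'.im y
  have hY : Y ≠ 0 := by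
    intro h0
    apply Q.not_sq
    rw [hd, ← h2, h0]
    exact ⟨X, by ring⟩
  have h3 := Q.nm_apply (X / Y) (1 / Y)
  have h4 : X ^ 2 - B.e * Y ^ 2 = Q.d := h2.trans hd.symm
  have h5 : (X / Y) ^ 2 - Q.d * (1 / Y) ^ 2 = B.e := by
    rw [← h4]
    field_simp
    ring
  rw [h5] at h3
  have h6 : algebraMap k K (X / Y) + algebraMap k K (1 / Y) * Q.δ ≠ 0 := by
    intro h0
    have h7 := Q.algebraMap_nm 0
    rw [zero_mul, ← h0, h3] at h7
    exact B.e.ne_zero ((map_eq_zero _).1 (h7.trans h0))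
  refine ⟨Units.mk0 _ h6, ?_⟩
  ext
  rw [Q.val_nmU, Units.val_mk0, h3]

end Base

end GenusCount

namespace GenusCount

open IsDedekindDomain nonZeroDivisors NumberField
open scoped NumberTheorySymbols

theorem jacobiSym_eq_one_of_dvd {w : ℕ} {c u v : ℤ} {h : ℕ} (hh : Odd h) (hv : IsCoprime v w)
    (hd : (w : ℤ) ∣ u ^ 2 * c ^ h - v ^ 2) : J(c | w) = 1 := by
  have h1 : J(u ^ 2 * c ^ h | w) = 1 := by
    rw [jacobiSym.mod_left' (Int.ModEq.symm (Int.modEq_iff_dvd.2 hd))]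
    exact jacobiSym.sq_one' (Int.isCoprime_iff_gcd_eq_one.1 hv)
  rw [jacobiSym.mul_left, jacobiSym.pow_left, jacobiSym.pow_left] at h1
  rcases jacobiSym.trichotomy c w with h2 | h2 | h2
  · rw [h2, zero_pow hh.pos.ne', mul_zero] at h1
    norm_num at h1
  · exact h2
  · rw [h2, hh.neg_one_pow] at h1
    nlinarith [sq_nonneg (J(u | w))]

section Pell

variable {a b l Y : ℤ} {q h X w : ℕ} (hpell : a ^ 2 + 1 = l * b ^ 2) (hh : Odd h)
  (hXY : IsCoprime (X : ℤ) Y) (hN : (X : ℤ) ^ 2 - l * Y ^ 2 = (q : ℤ) ^ h)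

include hpell hh hXY hN

theorem jacobiSym_neg_eq_one (hw : (w : ℤ) = a * Y + b * X) (hb : b ≠ 0) :
    J(-(q : ℤ) | w) = 1 := by
  rcases eq_or_ne w 0 with h0 | h0
  · rw [h0, jacobiSym.zero_right]
  obtain ⟨b', Y', hg, hb', hY'⟩ := Int.exists_gcd_one (m := b) (n := Y) (Int.gcd_pos_of_ne_zero_left _ hb)
  set g := Int.gcd b Y
  have hdvd : g ∣ w := by
    rw [← Int.natCast_dvd_natCast, hw, hb', hY']
    exact ⟨a * Y' + b' * X, by ring⟩
  obtain ⟨w', rfl⟩ := hdvd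
  have hg0 : g ≠ 0 := left_ne_zero_of_mul h0
  have hg0' : (g : ℤ) ≠ 0 := by exact_mod_cast hg0
  have hw' : (w' : ℤ) = a * Y' + b' * X := by
    apply mul_left_cancel₀ hg0'
    push_cast at hw
    rw [hw, hb', hY']
    ring
  have hgb : (g : ℤ) ∣ b := ⟨b', by rw [mul_comm]; exact hb'⟩
  have hgY : (g : ℤ) ∣ Y := ⟨Y', by rw [mul_comm]; exact hY'⟩
  have hab : IsCoprime a b := ⟨-a, l * b, by linarith⟩
  have hq : (-(q : ℤ)) ^ h = l * Y ^ 2 - X ^ 2 := by rw [hh.neg_pow, ← hN]; ring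
  rw [jacobiSym.mul_right' _ hg0 (right_ne_zero_of_mul h0)]
  have hb2 : l * b ^ 2 = a ^ 2 + 1 := hpell.symm
  have h1 : J(-(q : ℤ) | g) = 1 := by
    refine jacobiSym_eq_one_of_dvd (u := 1) (v := a * X) hh ?_ ?_
    · exact (hab.of_isCoprime_of_dvd_right hgb).mul_left (hXY.of_isCoprime_of_dvd_right hgY)
    · rw [hq]
      have : 1 ^ 2 * (l * Y ^ 2 - (X : ℤ) ^ 2) - (a * X) ^ 2 = Y * (l * Y) - b * (l * b * X ^ 2) := by
        linear_combination -(X : ℤ) ^ 2 * hpell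
      rw [this]
      exact dvd_sub (hgY.mul_right _) (hgb.mul_right _)
  have h2 : J(-(q : ℤ) | w') = 1 := by
    refine jacobiSym_eq_one_of_dvd (u := b') (v := Y') hh ?_ ?_
    · rw [hw', add_comm, mul_comm a]
      rw [IsCoprime.add_mul_left_right_iff]
      refine IsCoprime.mul_right (Int.isCoprime_iff_gcd_eq_one.2 hg).symm ?_
      exact (hXY.of_isCoprime_of_dvd_right ⟨g, hY'⟩).symm
    · rw [hq, hw']
      refine ⟨a * Y' - b' * X, ?_⟩
      have h3 : b' ^ 2 * (l * Y ^ 2) = (a ^ 2 + 1) * Y' ^ 2 := by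
        rw [hpell, hb', hY']
        ring
      linear_combination h3
  rw [h1, h2, one_mul]

omit hpell in
theorem jacobiSym_neg_eq : J(-(q : ℤ) | X) = J(l | X) := by
  rcases eq_or_ne X 0 with h0 | h0
  · rw [h0, jacobiSym.zero_right, jacobiSym.zero_right]
  have h1 : J((-(q : ℤ)) ^ h | X) = J(l * Y ^ 2 | X) := by
    apply jacobiSym.mod_left'
    apply Int.modEq_iff_dvd.2
    refine ⟨X, ?_⟩
    rw [hh.neg_pow, ← hN]
    ring
  rw [jacobiSym.pow_left, jacobiSym.mul_left,
    jacobiSym.sq_one' (Int.isCoprime_iff_gcd_eq_one.1 hXY.symm), mul_one] at h1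
  rw [← h1]
  rcases jacobiSym.trichotomy (-(q : ℤ)) X with h2 | h2 | h2 <;> rw [h2]
  · rw [zero_pow hh.pos.ne']
  · rw [one_pow]
  · rw [hh.neg_one_pow]

end Pell

theorem quartSym_eq_of_pow {p : ℕ} (hp : p.Prime) (hp2 : p ≠ 2) {c s : ℤ} (hs : s = 1 ∨ s = -1)
    (h : (c : ZMod p) ^ ((p - 1) / 4) = s) : quartSym p c = s := by
  haveI : Fact p.Prime := ⟨hp⟩
  haveI : Fact (2 < p) := ⟨lt_of_le_of_ne hp.two_le hp2.symm⟩
  rw [quartSym, h]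
  rcases hs with rfl | rfl
  · simp
  · rw [if_neg]
    push_cast
    exact ZMod.neg_one_ne_one

theorem quartSym_eq_legendreSym {p : ℕ} [Fact p.Prime] (hp : p % 4 = 1) {c X Y : ℤ} {h : ℕ}
    (hh : Odd h) (hd : (p : ℤ) ∣ X ^ 2 - c ^ h * Y ^ 2) (hX : ¬(p : ℤ) ∣ X) :
    quartSym p c = legendreSym p X * legendreSym p Y := by
  have hp0 := (Fact.out : p.Prime)
  have hp2 : p ≠ 2 := by rintro rfl; norm_num at hp
  have hX0 : (X : ZMod p) ≠ 0 := fun h => hX ((ZMod.intCast_zmod_eq_zero_iff_dvd _ _).1 h)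
  have heq : (X : ZMod p) ^ 2 = (c : ZMod p) ^ h * (Y : ZMod p) ^ 2 := by
    have := (ZMod.intCast_zmod_eq_zero_iff_dvd _ _).2 hd
    push_cast at this
    exact sub_eq_zero.1 this
  have hc0 : (c : ZMod p) ≠ 0 := by
    intro h0
    rw [h0, zero_pow hh.pos.ne', zero_mul] at heq
    exact hX0 ((pow_eq_zero_iff two_ne_zero).1 heq)
  have hY0 : (Y : ZMod p) ≠ 0 := by
    intro h0
    rw [h0, zero_pow two_ne_zero, mul_zero] at heq
    exact hX0 ((pow_eq_zero_iff two_ne_zero).1 heq)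
  set m := (p - 1) / 4 with hm
  have hm2 : p / 2 = 2 * m := by omega
  have hm4 : p - 1 = m * 4 := by omega
  have h1 := legendreSym.eq_pow p X
  have h2 := legendreSym.eq_pow p Y
  rw [hm2, pow_mul] at h1 h2
  have h4 : ((c : ZMod p) ^ m) ^ 4 = 1 := by
    rw [← pow_mul, ← hm4]
    exact ZMod.pow_card_sub_one_eq_one hc0
  have hsX := legendreSym.eq_one_or_neg_one p hX0
  have hsY := legendreSym.eq_one_or_neg_one p hY0
  have hYY : (legendreSym p Y : ZMod p) * legendreSym p Y = 1 := by
    rcases hsY with h | h <;> rw [h] <;> norm_num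
  have h3 : ((c : ZMod p) ^ m) ^ h = (legendreSym p X * legendreSym p Y : ℤ) := by
    push_cast
    rw [h1, heq, mul_pow, ← h2, mul_assoc, hYY, mul_one, ← pow_mul, ← pow_mul, mul_comm]
  have hs : legendreSym p X * legendreSym p Y = 1 ∨ legendreSym p X * legendreSym p Y = -1 := by
    rcases hsX with h | h <;> rcases hsY with h' | h' <;> rw [h, h'] <;> norm_num
  refine quartSym_eq_of_pow hp0 hp2 hs ?_
  have hsh : ((legendreSym p X * legendreSym p Y : ℤ) : ZMod p) ^ h =
      (legendreSym p X * legendreSym p Y : ℤ) := by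
    rcases hs with h | h <;> rw [h]
    · simp
    · push_cast
      rw [hh.neg_one_pow]
  have hs2 : ((legendreSym p X * legendreSym p Y : ℤ) : ZMod p) ^ 2 = 1 := by
    rcases hs with h | h <;> rw [h] <;> norm_num
  set s := ((legendreSym p X * legendreSym p Y : ℤ) : ZMod p)
  have h5 : ((c : ZMod p) ^ m * s) ^ h = 1 := by rw [mul_pow, h3, hsh, ← sq, hs2]
  have h6 : ((c : ZMod p) ^ m * s) ^ 4 = 1 := by
    rw [mul_pow, h4, one_mul]
    calc s ^ 4 = (s ^ 2) ^ 2 := by ring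
      _ = 1 := by rw [hs2, one_pow]
  have h7 : Nat.Coprime h 4 := by
    have : Nat.Coprime h (2 ^ 2) := (Nat.coprime_two_right.2 hh).pow_right 2
    exact this
  have h8 : (c : ZMod p) ^ m * s = 1 := by
    rw [← orderOf_eq_one_iff]
    exact Nat.eq_one_of_dvd_coprimes h7 (orderOf_dvd_of_pow_eq_one h5) (orderOf_dvd_of_pow_eq_one h6)
  calc (c : ZMod p) ^ m = (c : ZMod p) ^ m * s ^ 2 := by rw [hs2, mul_one]
    _ = ((c : ZMod p) ^ m * s) * s := by ring
    _ = s := by rw [h8, one_mul]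

end GenusCount

namespace GenusCount

open IsDedekindDomain nonZeroDivisors NumberField
open scoped NumberTheorySymbols

section Pell

variable {a b Y : ℤ} {l p h X : ℕ} (hl : l.Prime) (hl8 : l % 8 = 1)
  (hpell : a ^ 2 + 1 = l * b ^ 2) (ha : 4 ∣ a) (hb : b % 4 = 1) (hb0 : 0 < b) (hh : Odd h)
  (hXY : IsCoprime (X : ℤ) Y) (hN : (X : ℤ) ^ 2 - l * Y ^ 2 = (p : ℤ) ^ h)

include hpell hN hb0 in
omit hl hl8 ha hb hh hXY in
theorem exists_natCast_eq (hp : 0 < p) (hX : X ≠ 0) : ∃ w : ℕ, (w : ℤ) = a * Y + b * X := by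
  suffices h : 0 ≤ a * Y + b * X from ⟨(a * Y + b * X).toNat, Int.toNat_of_nonneg h⟩
  have h1 : (a * Y) ^ 2 ≤ (b * X) ^ 2 := by
    have h2 : (b * X) ^ 2 - (a * Y) ^ 2 = b ^ 2 * (p : ℤ) ^ h + Y ^ 2 := by
      rw [← hN]
      linear_combination -Y ^ 2 * hpell
    have h3 : 0 ≤ b ^ 2 * (p : ℤ) ^ h + Y ^ 2 := by positivity
    linarith
  have h2 : 0 ≤ b * (X : ℤ) := by positivity
  have h3 := abs_le_of_sq_le_sq h1 h2
  linarith [neg_abs_le (a * Y)]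

include hl hl8 hN hh hXY in
omit hpell ha hb hb0 in
theorem quartSym_eq_jacobiSym (hpl : ¬l ∣ p) (hX : Odd X) : quartSym l p = J(-(p : ℤ) | X) := by
  haveI : Fact l.Prime := ⟨hl⟩
  have hlX : ¬(l : ℤ) ∣ X := by
    intro hd
    apply hpl
    have h1 : (l : ℤ) ∣ (p : ℤ) ^ h := by
      rw [← hN]
      exact dvd_sub (dvd_pow hd two_ne_zero) (dvd_mul_right _ _)
    have h2 := (Nat.prime_iff_prime_int.1 hl).dvd_of_dvd_pow h1
    exact_mod_cast h2
  rw [jacobiSym_neg_eq hh hXY hN, quartSym_eq_legendreSym (by omega) (X := X) (Y := 1) hh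
    ⟨Y ^ 2, by linear_combination hN⟩ hlX, legendreSym.at_one, mul_one,
    jacobiSym.legendreSym.to_jacobiSym]
  exact (jacobiSym.quadratic_reciprocity_one_mod_four (by omega) hX).symm

include hl hl8 hpell ha hb hb0 hh hXY hN

private theorem scholz_aux (hp : p.Prime) (hp4 : p % 4 = 1) (hpl : p ≠ l) {r : ℤ}
    (hr : (p : ℤ) ∣ X - r * Y) [Fact p.Prime] :
    legendreSym p (a + b * r) = quartSym l p * quartSym p l := by
  have hpi := Nat.prime_iff_prime_int.1 hp
  have hpl' : ¬(p : ℤ) ∣ l := by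
    rw [Int.natCast_dvd_natCast, Nat.prime_dvd_prime_iff_eq hp hl]
    exact hpl
  have hlp : ¬l ∣ p := by
    rw [Nat.prime_dvd_prime_iff_eq hl hp]
    exact hpl.symm
  have hpN : (p : ℤ) ∣ X ^ 2 - l * Y ^ 2 := by
    rw [hN]
    exact dvd_pow_self _ hh.pos.ne'
  have hpX : ¬(p : ℤ) ∣ X := by
    intro hd
    have h1 : (p : ℤ) ∣ l * Y ^ 2 := by
      have := dvd_sub (dvd_pow hd two_ne_zero) hpN
      rwa [sub_sub_cancel] at this
    have h2 := hpi.dvd_of_dvd_pow ((hpi.dvd_or_dvd h1).resolve_left hpl')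
    exact hpi.not_isUnit (hXY.isUnit_of_dvd' hd h2)
  have hpY : ¬(p : ℤ) ∣ Y := by
    intro hd
    apply hpX
    have := dvd_add hr (hd.mul_left r)
    rwa [sub_add_cancel] at this
  have hXodd : Odd X := by
    rw [← Nat.not_even_iff_odd]
    rintro ⟨t, ht⟩
    have h1 : (p : ℤ) ^ h % 4 = 1 := by
      have h2 : (p : ℤ) ≡ 1 [ZMOD 4] := by
        change (p : ℤ) % 4 = 1 % 4
        omega
      have h3 := h2.pow h
      rw [one_pow] at h3
      exact h3
    have h2 : (X : ℤ) = 2 * t := by rw [ht]; push_cast; ring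
    obtain ⟨c, hc⟩ : ∃ c : ℤ, (l : ℤ) = 8 * c + 1 := ⟨l / 8, by omega⟩
    rw [← hN, h2, hc] at h1
    rcases Int.even_or_odd' Y with ⟨y, rfl | rfl⟩ <;> ring_nf at h1 <;> omega
  have hX0 : X ≠ 0 := by rintro rfl; norm_num at hXodd
  obtain ⟨w, hw⟩ := exists_natCast_eq hpell hb0 hN hp.pos hX0
  have hwodd : Odd w := by
    rw [← Int.odd_coe_nat, hw, Int.odd_add']
    have hbo : Odd b := Int.odd_iff.2 (by omega)
    have hae : Even a := Int.even_iff.2 (by omega)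
    have hX' : Odd (X : ℤ) := by exact_mod_cast hXodd
    exact ⟨fun _ => hae.mul_right _, fun _ => hbo.mul hX'⟩
  have hw4 : (w : ZMod 4) = X := by
    have h1 : (w : ℤ) ≡ X [ZMOD 4] := by
      rw [hw]
      obtain ⟨a', rfl⟩ := ha
      obtain ⟨b', hb'⟩ : ∃ b', b = 4 * b' + 1 := ⟨b / 4, by omega⟩
      rw [hb']
      apply Int.modEq_iff_dvd.2
      exact ⟨-(a' * Y + b' * X), by ring⟩
    have h2 := (ZMod.intCast_eq_intCast_iff _ _ 4).2 h1
    exact_mod_cast h2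
  have hJw : J(-(p : ℤ) | w) = 1 := jacobiSym_neg_eq_one hpell hh hXY hN hw hb0.ne'
  have hJp : J((p : ℤ) | w) = ZMod.χ₄ X := by
    rw [← neg_one_mul, jacobiSym.mul_left, jacobiSym.at_neg_one hwodd, hw4] at hJw
    rcases Int.eq_one_or_neg_one_of_mul_eq_one hJw with h | h
    · rw [h] at hJw ⊢; linarith
    · rw [h] at hJw ⊢; linarith
  have hlw : legendreSym p (a + b * r) * legendreSym p Y = legendreSym p w := by
    rw [← legendreSym.mul, legendreSym.mod p (w : ℤ), legendreSym.mod]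
    congr 1
    apply Int.modEq_iff_dvd.2
    rw [hw]
    obtain ⟨t, ht⟩ := hr
    exact ⟨b * t, by linear_combination b * ht⟩
  have hYY : legendreSym p Y * legendreSym p Y = 1 := by
    have hY0 : (Y : ZMod p) ≠ 0 := fun h => hpY ((ZMod.intCast_zmod_eq_zero_iff_dvd _ _).1 h)
    rcases legendreSym.eq_one_or_neg_one p hY0 with h | h <;> rw [h] <;> norm_num
  have hXX : legendreSym p X * legendreSym p X = 1 := by
    have hX0 : ((X : ℤ) : ZMod p) ≠ 0 := fun h => hpX ((ZMod.intCast_zmod_eq_zero_iff_dvd _ _).1 h)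
    rcases legendreSym.eq_one_or_neg_one p hX0 with h | h <;> rw [h] <;> norm_num
  have h1 : quartSym p l = legendreSym p X * legendreSym p Y :=
    quartSym_eq_legendreSym hp4 (h := 1) odd_one (by rwa [pow_one]) hpX
  have h2 : quartSym l p = ZMod.χ₄ X * legendreSym p X := by
    rw [quartSym_eq_jacobiSym hl hl8 hh hXY hN hlp hXodd, ← neg_one_mul, jacobiSym.mul_left,
      jacobiSym.at_neg_one hXodd, jacobiSym.legendreSym.to_jacobiSym]
    rw [jacobiSym.quadratic_reciprocity_one_mod_four hp4 hXodd]
  have h3 : legendreSym p w = ZMod.χ₄ X := by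
    rw [← hJp, jacobiSym.legendreSym.to_jacobiSym]
    exact (jacobiSym.quadratic_reciprocity_one_mod_four hp4 hwodd).symm
  rw [h3] at hlw
  calc legendreSym p (a + b * r)
      = legendreSym p (a + b * r) * (legendreSym p Y * legendreSym p Y) := by rw [hYY, mul_one]
    _ = ZMod.χ₄ X * legendreSym p Y * (legendreSym p X * legendreSym p X) := by
        rw [← mul_assoc, hlw, hXX, mul_one]
    _ = _ := by rw [h1, h2]; ring

theorem scholz (hp : p.Prime) (hp4 : p % 4 = 1) (hpl : p ≠ l) {r : ℤ}
    (hr : (p : ℤ) ∣ r ^ 2 - l) [Fact p.Prime] :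
    legendreSym p (a + b * r) = quartSym l p * quartSym p l := by
  have hpi := Nat.prime_iff_prime_int.1 hp
  have h1 : (p : ℤ) ∣ (X - r * Y) * (X - r * -Y) := by
    have h2 : (p : ℤ) ∣ X ^ 2 - l * Y ^ 2 := by
      rw [hN]
      exact dvd_pow_self _ hh.pos.ne'
    have h3 := dvd_sub h2 (hr.mul_right (Y ^ 2))
    have h4 : (X - r * Y) * (X - r * -Y) = X ^ 2 - l * Y ^ 2 - (r ^ 2 - l) * Y ^ 2 := by ring
    rwa [h4]
  rcases hpi.dvd_or_dvd h1 with h | h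
  · exact scholz_aux hl hl8 hpell ha hb hb0 hh hXY hN hp hp4 hpl h
  · exact scholz_aux hl hl8 hpell ha hb hb0 hh hXY.neg_right (by rwa [neg_sq]) hp hp4 hpl h

end Pell

theorem χ₈'_aux (x : ZMod 8) (hx : ZMod.χ₈' x ≠ 0) :
    ZMod.χ₈' (5 * x) = -ZMod.χ₈' x ∧ ZMod.χ₈' (x + 4) = -ZMod.χ₈' x := by
  revert x; decide

theorem quartSym_two {a b Y : ℤ} {l h X : ℕ} (hl : l.Prime) (hl8 : l % 8 = 1)
    (hpell : a ^ 2 + 1 = l * b ^ 2) (ha : 4 ∣ a) (hb : b % 4 = 1) (hb0 : 0 < b) (hh : Odd h)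
    (hXY : IsCoprime (X : ℤ) Y) (hN : (X : ℤ) ^ 2 - l * Y ^ 2 = ((2 : ℕ) : ℤ) ^ h) (hX : Odd X)
    (hY : Odd Y) : quartSym l 2 = (-1) ^ ((l - 1) / 8) ↔ 8 ∣ a := by
  have hX0 : X ≠ 0 := by rintro rfl; norm_num at hX
  have hl2 : ¬l ∣ 2 := by
    rw [Nat.prime_dvd_prime_iff_eq hl Nat.prime_two]
    omega
  have h1 := quartSym_eq_jacobiSym hl hl8 hh hXY hN hl2 hX
  obtain ⟨w, hw⟩ := exists_natCast_eq hpell hb0 hN two_pos hX0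
  have h2 := jacobiSym_neg_eq_one hpell hh hXY hN hw hb0.ne'
  have hwodd : Odd w := by
    rw [← Int.odd_coe_nat, hw, Int.odd_add']
    have hbo : Odd b := Int.odd_iff.2 (by omega)
    have hae : Even a := Int.even_iff.2 (by omega)
    have hX' : Odd (X : ℤ) := by exact_mod_cast hX
    exact ⟨fun _ => hae.mul_right _, fun _ => hbo.mul hX'⟩
  push_cast at h1 h2
  rw [jacobiSym.at_neg_two hX] at h1
  rw [jacobiSym.at_neg_two hwodd] at h2
  rw [h1]
  have hXne : ZMod.χ₈' (X : ZMod 8) ≠ 0 := by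
    rw [← jacobiSym.at_neg_two hX]
    apply jacobiSym.ne_zero
    rw [← Int.isCoprime_iff_gcd_eq_one]
    have : IsCoprime (2 : ℤ) X := by
      have := Nat.isCoprime_iff_coprime.2 (Nat.coprime_two_left.2 hX)
      exact_mod_cast this
    exact this.neg_left
  have hXpm : ZMod.χ₈' (X : ZMod 8) = 1 ∨ ZMod.χ₈' (X : ZMod 8) = -1 := by
    have : ∀ x : ZMod 8, ZMod.χ₈' x ≠ 0 → ZMod.χ₈' x = 1 ∨ ZMod.χ₈' x = -1 := by decide
    exact this _ hXne
  have hwc : (w : ZMod 8) = a * Y + b * X := by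
    have := congrArg (Int.cast (R := ZMod 8)) hw
    exact_mod_cast this
  have h8 : (8 : ZMod 8) = 0 := by decide
  have hYc : ∃ y : ℤ, Y = 2 * y + 1 := hY
  obtain ⟨y, rfl⟩ := hYc
  obtain ⟨a', rfl⟩ := ha
  obtain ⟨b', hb'⟩ : ∃ b', b = 4 * b' + 1 := ⟨b / 4, by omega⟩
  obtain ⟨c, hc⟩ : ∃ c, l = 8 * c + 1 := ⟨l / 8, by omega⟩
  have hcb : c % 2 = (b' % 2).natAbs := by
    have h3 : 2 * a' ^ 2 = c * (4 * b' + 1) ^ 2 + 2 * b' ^ 2 + b' := by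
      rw [hc, hb'] at hpell
      push_cast at hpell
      nlinarith
    have h4 : (2 : ℤ) ∣ c + b' :=
      ⟨a' ^ 2 - b' ^ 2 - c * (8 * b' ^ 2 + 4 * b'), by linear_combination -h3⟩
    omega
  have hexp : (l - 1) / 8 = c := by omega
  have hbz : (b : ZMod 8) = if c % 2 = 0 then 1 else 5 := by
    split_ifs with h
    · have : b % 8 = 1 := by omega
      have := (ZMod.intCast_eq_intCast_iff b 1 8).2 this
      exact_mod_cast this
    · have : b % 8 = 5 := by omega
      have := (ZMod.intCast_eq_intCast_iff b 5 8).2 this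
      exact_mod_cast this
  have hsgn : (-1 : ℤ) ^ c = if c % 2 = 0 then 1 else -1 := by
    split_ifs with h
    · exact (Nat.even_iff.2 h).neg_one_pow
    · exact (Nat.odd_iff.2 (by omega)).neg_one_pow
  have h88 : (8 : ℤ) ∣ 4 * a' ↔ a' % 2 = 0 := by omega
  have haz : (((4 * a' : ℤ) : ZMod 8) * ((2 * y + 1 : ℤ) : ZMod 8)) =
      if a' % 2 = 0 then 0 else 4 := by
    split_ifs with h
    · obtain ⟨t, rfl⟩ : ∃ t, a' = 2 * t := ⟨a' / 2, by omega⟩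
      push_cast
      linear_combination (t : ZMod 8) * (2 * y + 1) * h8
    · obtain ⟨t, rfl⟩ : ∃ t, a' = 2 * t + 1 := ⟨a' / 2, by omega⟩
      push_cast
      linear_combination ((t : ZMod 8) * (2 * y + 1) + y) * h8
  rw [hwc, haz, hbz] at h2
  rw [hexp, hsgn, h88]
  have hc1 := χ₈'_aux (X : ZMod 8) hXne
  have h5X : ZMod.χ₈' (5 * (X : ZMod 8)) ≠ 0 := by rw [hc1.1]; exact neg_ne_zero.2 hXne
  have hc2 := χ₈'_aux (5 * (X : ZMod 8)) h5X
  by_cases ha0 : a' % 2 = 0 <;> by_cases hc0 : c % 2 = 0 <;>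
    simp only [ha0, hc0, if_true, if_false, zero_add, one_mul, iff_true, iff_false] at h2 ⊢
  · exact h2
  · rw [hc1.1] at h2
    omega
  · rw [add_comm, hc1.2] at h2
    omega
  · rw [add_comm, hc2.2, hc1.1] at h2
    omega

end GenusCount

namespace GenusCount

open IsDedekindDomain nonZeroDivisors NumberField
open scoped NumberTheorySymbols

namespace Base

variable {k : Type} [Field k] [NumberField k] (B : Base k)

theorem s_ne_zero : B.s ≠ 0 := by
  intro h
  have h1 := B.s_sq
  rw [h, zero_pow two_ne_zero] at h1
  exact B.prime.ne_zero (by exact_mod_cast h1.symm)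

theorem exists_coords (x : 𝓞 k) : ∃ X Y : ℤ, 2 * x = X + Y * B.s := by
  obtain ⟨N, hN, -⟩ := B.Q.exists_int_mul_σR x
  obtain ⟨M, hM, -⟩ := B.Q.exists_int_mul_σR (x + 1)
  obtain ⟨R, hR, -⟩ := B.Q.exists_int_mul_σR (x + B.s)
  rw [map_add, map_one] at hM
  rw [map_add, B.σR_s] at hR
  have hs := B.s_sq
  have hT : x + B.Q.σR x = ((M - N - 1 : ℤ) : 𝓞 k) := by
    push_cast
    linear_combination hM - hN
  have hm : (x - B.Q.σR x) * B.s = ((N - B.l - R : ℤ) : 𝓞 k) := by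
    push_cast
    linear_combination hN - hR - hs
  have hsq : ((N - B.l - R) ^ 2 : ℤ) = B.l * ((M - N - 1) ^ 2 - 4 * N) := by
    have : (((N - B.l - R) ^ 2 : ℤ) : 𝓞 k) = ((B.l * ((M - N - 1) ^ 2 - 4 * N) : ℤ) : 𝓞 k) := by
      rw [Int.cast_pow, ← hm, Int.cast_mul, Int.cast_sub, Int.cast_pow (M - N - 1), ← hT,
        Int.cast_mul, ← hN]
      push_cast
      linear_combination (x - B.Q.σR x) ^ 2 * hs
    exact_mod_cast this
  obtain ⟨Y, hY⟩ := (Nat.prime_iff_prime_int.1 B.prime).dvd_of_dvd_pow ⟨_, hsq⟩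
  refine ⟨M - N - 1, Y, ?_⟩
  rw [hY] at hm
  have h1 : x - B.Q.σR x = Y * B.s := by
    apply mul_right_cancel₀ B.s_ne_zero
    rw [hm]
    push_cast
    linear_combination -(Y : 𝓞 k) * hs
  linear_combination hT + h1

theorem norm_coords {x : 𝓞 k} {c X Y N : ℤ} (hx : (c : 𝓞 k) * x = X + Y * B.s)
    (hN : x * B.Q.σR x = N) : X ^ 2 - B.l * Y ^ 2 = c ^ 2 * N := by
  have h := congrArg B.Q.σR hx
  rw [map_mul, map_add, map_mul, map_intCast, map_intCast, map_intCast, B.σR_s] at h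
  have h1 : ((X ^ 2 - B.l * Y ^ 2 : ℤ) : 𝓞 k) = ((c ^ 2 * N : ℤ) : 𝓞 k) := by
    push_cast
    rw [← hN]
    linear_combination -(c * B.Q.σR x) * hx - (X + Y * B.s) * h + (Y : 𝓞 k) ^ 2 * B.s_sq
  exact_mod_cast h1

variable {p : ℕ} (hp : p.Prime) {P : HeightOneSpectrum (𝓞 k)} (hP : (p : 𝓞 k) ∈ P.asIdeal)
  (hsw : B.Q.sw P ≠ P)

include hp hP hsw in
theorem exists_norm_eq : ∃ h : ℕ, Odd h ∧ ∃ x : 𝓞 k, x ∉ (B.Q.sw P).asIdeal ∧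
    x * B.Q.σR x = ((p ^ h : ℤ) : 𝓞 k) := by
  classical
  set h := Nat.card (ClassGroup (𝓞 k)) with hh
  have hodd : Odd h := B.odd_card
  obtain ⟨x, hx0, hx⟩ := exists_generator_pow_card P
  have hv := fun v => vord_of_span_eq (K := k) hx0 hx v
  have hxsw : x ∉ (B.Q.sw P).asIdeal := by
    intro hm
    have h1 := (vord_algebraMap_pos (K := k) (B.Q.sw P) hx0).2 hm
    rw [hv] at h1
    simp [hsw] at h1
  have hx_mem : ∀ v : HeightOneSpectrum (𝓞 k), x ∈ v.asIdeal → v = P := by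
    intro v hm
    by_contra hne
    have h1 := (vord_algebraMap_pos (K := k) v hx0).2 hm
    rw [hv] at h1
    simp [hne] at h1
  obtain ⟨N, hN, -⟩ := B.Q.exists_int_mul_σR x
  have hσ0 : B.Q.σR x ≠ 0 := by
    intro h0
    apply hx0
    rw [← B.Q.σR_σR x, h0, map_zero]
  have hN0 : N ≠ 0 := by
    rintro rfl
    rw [Int.cast_zero] at hN
    exact (mul_ne_zero hx0 hσ0) hN
  have hpow : N.natAbs = p ^ N.natAbs.primeFactorsList.length := by
    refine Nat.eq_prime_pow_of_unique_prime_dvd (Int.natAbs_ne_zero.2 hN0) ?_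
    intro q hq hqN
    obtain ⟨w, hw⟩ := exists_natCast_mem (k := k) hq
    have h1 : x * B.Q.σR x ∈ w.asIdeal := by
      rw [hN, intCast_mem hq hw]
      exact Int.natCast_dvd.2 hqN
    rcases w.isPrime.mem_or_mem h1 with h2 | h2
    · obtain rfl := hx_mem w h2
      exact prime_mem_unique hq hp hw hP
    · have h3 := hx_mem (B.Q.sw w) (B.Q.mem_sw.2 h2)
      rw [← h3, B.Q.natCast_mem_sw] at hP
      exact prime_mem_unique hq hp hw hP
  set m := N.natAbs.primeFactorsList.length with hm
  have hmh : m = h := by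
    have h1 : vord P ((N : 𝓞 k) : k) = h := by
      rw [← hN]
      change vord P (algebraMap (𝓞 k) k (x * B.Q.σR x)) = h
      rw [map_mul, vord_mul P (by simpa using hx0) (by simpa using hσ0), hv P, if_pos rfl,
        vord_algebraMap_eq_zero P (a := B.Q.σR x), add_zero]
      intro hm
      exact hxsw (B.Q.mem_sw.2 hm)
    have h2 : vord P ((N : 𝓞 k) : k) = m := by
      have h3 : ((p : k) ^ m) ≠ 0 := by simp [hp.ne_zero]
      have h4 : vord P ((p : k) ^ m) = m := by
        rw [vord_pow, vord_natCast_prime hp hP, B.Q.ram_eq_one_of_sw_ne hsw]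
        simp
      rcases Int.natAbs_eq N with h5 | h5
      · rw [h5, hpow]
        simpa using h4
      · rw [h5, hpow]
        have : vord P (-(p : k) ^ m) = m := by rw [vord_neg, h4]
        simpa using this
    exact_mod_cast h2.symm.trans h1
  rw [hmh] at hpow
  refine ⟨h, hodd, ?_⟩
  rcases Int.natAbs_eq N with h5 | h5
  · refine ⟨x, hxsw, ?_⟩
    rw [hN, h5, hpow]
    push_cast
    rfl
  · refine ⟨B.ε * x, ?_, ?_⟩
    · intro hm
      rcases (B.Q.sw P).isPrime.mem_or_mem hm with h6 | h6
      · exact (B.Q.sw P).isPrime.ne_top (Ideal.eq_top_of_isUnit_mem _ h6 B.ε.isUnit)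
      · exact hxsw h6
    · rw [map_mul, mul_mul_mul_comm, B.ε_mul_σR, hN, h5, hpow]
      push_cast
      ring

theorem exists_halves {X Y N : ℤ} (hN : X ^ 2 - B.l * Y ^ 2 = 4 * N) (hodd : N % 2 = 1) :
    ∃ X' Y', X = 2 * X' ∧ Y = 2 * Y' := by
  obtain ⟨c, hc⟩ : ∃ c : ℤ, (B.l : ℤ) = 8 * c + 1 := ⟨B.l / 8, by have := B.mod_eight; omega⟩
  rw [hc] at hN
  obtain ⟨x, rfl | rfl⟩ := Int.even_or_odd' X <;> obtain ⟨y, rfl | rfl⟩ := Int.even_or_odd' Y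
  · exact ⟨x, y, rfl, rfl⟩
  · exfalso; ring_nf at hN; omega
  · exfalso; ring_nf at hN; omega
  · exfalso
    have h1 := Int.even_mul_succ_self x
    have h2 := Int.even_mul_succ_self y
    obtain ⟨u, hu⟩ := h1
    obtain ⟨v, hv⟩ := h2
    have : 4 * N = 4 * (2 * (u - v - c * (2 * y + 1) ^ 2)) := by
      rw [← hN]
      linear_combination 4 * hu - 4 * hv
    omega

theorem both_odd_or_both_even {X Y N : ℤ} (hN : X ^ 2 - B.l * Y ^ 2 = 2 * N) :
    (X % 2 = 1 ∧ Y % 2 = 1) ∨ (∃ X' Y', X = 2 * X' ∧ Y = 2 * Y') := by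
  obtain ⟨c, hc⟩ : ∃ c : ℤ, (B.l : ℤ) = 8 * c + 1 := ⟨B.l / 8, by have := B.mod_eight; omega⟩
  rw [hc] at hN
  obtain ⟨x, rfl | rfl⟩ := Int.even_or_odd' X <;> obtain ⟨y, rfl | rfl⟩ := Int.even_or_odd' Y
  · exact Or.inr ⟨x, y, rfl, rfl⟩
  · exfalso; ring_nf at hN; omega
  · exfalso; ring_nf at hN; omega
  · left; omega

theorem isCoprime_of_pow {X Y : ℤ} {h : ℕ} (hp : p.Prime)
    (hN : X ^ 2 - B.l * Y ^ 2 = (p : ℤ) ^ h) (hd : (p : ℤ) ∣ X → ¬(p : ℤ) ∣ Y) :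
    IsCoprime (X.natAbs : ℤ) Y := by
  rw [Int.isCoprime_iff_gcd_eq_one, Int.gcd_def, Int.natAbs_natCast, ← Nat.coprime_iff_gcd_eq_one]
  refine Nat.Coprime.symm (Nat.Coprime.symm (Nat.coprime_of_dvd ?_))
  intro q hq h1 h2
  rw [← Int.natCast_dvd] at h1 h2
  have h3 : (q : ℤ) ∣ (p : ℤ) ^ h := by
    rw [← hN]
    exact dvd_sub (dvd_pow h1 two_ne_zero) ((dvd_pow h2 two_ne_zero).mul_left _)
  have h4 : q ∣ p ^ h := by exact_mod_cast h3
  obtain rfl := (Nat.prime_dvd_prime_iff_eq hq hp).1 (hq.dvd_of_dvd_pow h4)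
  exact hd h1 h2

include hp hP hsw in
theorem legendreSym_eq (hp4 : p % 4 = 1) (hpl : p ≠ B.l) {r : ℤ} (hr : (p : ℤ) ∣ r ^ 2 - B.l)
    [Fact p.Prime] : legendreSym p (B.a + B.b * r) = quartSym B.l p * quartSym p B.l := by
  obtain ⟨h, hodd, x, hxsw, hN⟩ := B.exists_norm_eq hp hP hsw
  obtain ⟨X, Y, hXY⟩ := B.exists_coords x
  have h1 := B.norm_coords (c := 2) (by exact_mod_cast hXY) hN
  have hpo : ((p : ℤ) ^ h) % 2 = 1 := by
    have : Odd ((p : ℤ) ^ h) := by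
      apply Odd.pow
      exact_mod_cast Nat.odd_iff.2 (by omega)
    exact Int.odd_iff.1 this
  obtain ⟨X', Y', rfl, rfl⟩ := B.exists_halves (X := X) (Y := Y) (by rw [h1]; norm_num) hpo
  have hx : x = X' + Y' * B.s := by
    have h2 : (2 : 𝓞 k) ≠ 0 := two_ne_zero
    apply mul_left_cancel₀ h2
    rw [hXY]
    push_cast
    ring
  have h2 : X' ^ 2 - B.l * Y' ^ 2 = (p : ℤ) ^ h := by linarith
  refine scholz B.prime B.mod_eight B.pell B.four_dvd B.b_mod B.b_pos hodd
    (X := X'.natAbs) (Y := Y') (B.isCoprime_of_pow hp h2 ?_) (by rwa [Int.natAbs_pow_two] ) hp hp4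
    hpl hr
  rintro ⟨u, rfl⟩ ⟨v, rfl⟩
  apply hxsw
  have h3 : x = p * (u + v * B.s) := by rw [hx]; push_cast; ring
  rw [h3]
  exact Ideal.mul_mem_right _ _ (B.Q.natCast_mem_sw.2 hP)

theorem quartSym_two_iff : quartSym B.l 2 = (-1) ^ ((B.l - 1) / 8) ↔ 8 ∣ B.a := by
  obtain ⟨P, hP⟩ := exists_natCast_mem (k := k) Nat.prime_two
  have hsw := B.sw_ne_of_two (P := P) (by exact_mod_cast hP)
  obtain ⟨h, hodd, x, hxsw, hN⟩ := B.exists_norm_eq Nat.prime_two hP hsw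
  obtain ⟨X, Y, hXY⟩ := B.exists_coords x
  have h1 := B.norm_coords (c := 2) (by exact_mod_cast hXY) hN
  suffices H : ∃ m : ℕ, Odd m ∧ ∃ X Y : ℤ, X ^ 2 - B.l * Y ^ 2 = ((2 : ℕ) : ℤ) ^ m ∧
      X % 2 = 1 ∧ Y % 2 = 1 by
    obtain ⟨m, hm, X, Y, hN, hX, hY⟩ := H
    refine quartSym_two B.prime B.mod_eight B.pell B.four_dvd B.b_mod B.b_pos hm
      (X := X.natAbs) (Y := Y) (B.isCoprime_of_pow Nat.prime_two hN ?_)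
      (by rwa [Int.natAbs_pow_two]) (Int.natAbs_odd.2 (Int.odd_iff.2 hX)) (Int.odd_iff.2 hY)
    intro hd
    omega
  rcases B.both_odd_or_both_even (N := 2 * ((2 : ℕ) : ℤ) ^ h) (by rw [h1]; ring)
    with ⟨hX, hY⟩ | ⟨X', Y', rfl, rfl⟩
  · refine ⟨h + 2, by simpa [parity_simps] using hodd, X, Y, ?_, hX, hY⟩
    rw [h1]
    push_cast
    ring
  have hx : x = X' + Y' * B.s := by
    have h2 : (2 : 𝓞 k) ≠ 0 := two_ne_zero
    apply mul_left_cancel₀ h2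
    rw [hXY]
    push_cast
    ring
  have h2 : X' ^ 2 - B.l * Y' ^ 2 = ((2 : ℕ) : ℤ) ^ h := by linarith
  obtain ⟨j, rfl⟩ := hodd
  rcases B.both_odd_or_both_even (N := ((2 : ℕ) : ℤ) ^ (2 * j)) (by rw [h2]; push_cast; ring)
    with ⟨hX, hY⟩ | ⟨u, v, rfl, rfl⟩
  · exact ⟨2 * j + 1, odd_two_mul_add_one j, X', Y', h2, hX, hY⟩
  · exfalso
    apply hxsw
    have h3 : x = (2 : ℕ) * (u + v * B.s) := by rw [hx]; push_cast; ring
    rw [h3]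
    exact Ideal.mul_mem_right _ _ (B.Q.natCast_mem_sw.2 hP)

end Base

end GenusCount

namespace GenusCount

open IsDedekindDomain nonZeroDivisors NumberField

namespace Base

variable {k K : Type} [Field k] [NumberField k] [Field K] [NumberField K] [Algebra k K]
  (B : Base k) {n : ℕ} (Q : QuadExt k K) (hd : Q.d = n * B.α) (hn : Squarefree n)
  (hnl : n.Coprime B.l) {p : ℕ} {P : HeightOneSpectrum (𝓞 k)} (hp : p.Prime)
  (hP : (p : 𝓞 k) ∈ P.asIdeal)

include hn

include hd in
theorem vord_d (P : HeightOneSpectrum (𝓞 k)) : vord P Q.d = vord P (n : k) + vord P B.Q.δ := by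
  have h0 : (n : k) ≠ 0 := by exact_mod_cast hn.ne_zero
  rw [hd, vord_mul P h0 B.α_ne_zero, B.vord_α]

include hnl

include hd hP in
theorem vord_d_of_l (hp : p = B.l) : vord P Q.d = 1 := by
  subst hp
  rw [B.vord_d Q hd hn, B.vord_δ_eq_one hP]
  have h1 := vord_intCast_eq_zero (k := k) B.prime hP (z := n) (by
    rw [Int.natCast_dvd_natCast]
    intro h
    exact B.prime.one_lt.ne' (Nat.dvd_one.1 (hnl.gcd_eq_one ▸ Nat.dvd_gcd h dvd_rfl)))
  rw [Int.cast_natCast] at h1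
  rw [h1, zero_add]

omit hn in
include hp in
theorem ne_l_of_dvd (hpn : p ∣ n) : p ≠ B.l := by
  rintro rfl
  exact B.prime.one_lt.ne' (Nat.dvd_one.1 (hnl.gcd_eq_one ▸ Nat.dvd_gcd hpn dvd_rfl))

omit hnl in
include hd hp hP in
theorem vord_d_of_dvd (hpl : p ≠ B.l) (hpn : p ∣ n) : vord P Q.d = 1 := by
  rw [B.vord_d Q hd hn, B.vord_δ_eq_zero (fun h => hpl (prime_mem_unique hp B.prime hP h))]
  obtain ⟨m, rfl⟩ := hpn
  have hm : ¬p ∣ m := by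
    rintro ⟨t, rfl⟩
    exact hp.not_isUnit (hn p ⟨t, by ring⟩)
  have h1 := vord_intCast_eq_zero (k := k) hp hP (z := m) (by rwa [Int.natCast_dvd_natCast])
  rw [Int.cast_natCast] at h1
  have hm0 : (m : k) ≠ 0 := by
    have : m ≠ 0 := by rintro rfl; exact hm (dvd_zero p)
    exact_mod_cast this
  have hp0 : (p : k) ≠ 0 := by exact_mod_cast hp.ne_zero
  rw [Nat.cast_mul, vord_mul P hp0 hm0, h1, vord_natCast_prime hp hP, B.ram_eq_one hP hp hpl]
  norm_num

omit hnl in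
include hd hp hP in
theorem vord_d_of_not_dvd (hpl : p ≠ B.l) (hpn : ¬p ∣ n) : vord P Q.d = 0 := by
  rw [B.vord_d Q hd hn, B.vord_δ_eq_zero (fun h => hpl (prime_mem_unique hp B.prime hP h))]
  have h1 := vord_intCast_eq_zero (k := k) hp hP (z := n) (by rwa [Int.natCast_dvd_natCast])
  rw [Int.cast_natCast] at h1
  rw [h1, zero_add]

include hd in
theorem primesAbove_subset (hp : p.Prime) (h : p = B.l ∨ p ∣ n) :
    primesAbove k p ⊆ ramSet k K := by
  refine primesAbove_subset_of_odd Q fun P hP => ?_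
  rcases h with h | h
  · exact B.vord_d_of_l Q hd hn hnl hP h
  · exact B.vord_d_of_dvd Q hd hn hp hP (B.ne_l_of_dvd hnl hp h) h

omit hn hnl in
include hd in
theorem d_eq_coe : Q.d = ((n * (B.l * B.b + B.a * B.s) : 𝓞 k) : k) := by
  rw [hd, B.α_eq]
  simp [B.coe_s]

omit hn hnl in
theorem exists_four_mul (hn4 : n % 4 = 1) :
    ∃ c : 𝓞 k, (n * (B.l * B.b + B.a * B.s) : 𝓞 k) - 1 = 4 * c := by
  obtain ⟨a', ha⟩ := B.four_dvd
  have hb := B.b_mod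
  have hl := B.mod_eight
  obtain ⟨b', hb'⟩ : ∃ b', B.b = 4 * b' + 1 := ⟨B.b / 4, by omega⟩
  obtain ⟨l', hl'⟩ : ∃ l', B.l = 4 * l' + 1 := ⟨B.l / 4, by omega⟩
  obtain ⟨n', hn'⟩ : ∃ n', n = 4 * n' + 1 := ⟨n / 4, by omega⟩
  refine ⟨(n : 𝓞 k) * (l' * B.b + b' + a' * B.s) + n', ?_⟩
  have e1 : (B.a : 𝓞 k) = 4 * a' := by rw [ha]; push_cast; ring
  have e2 : (B.b : 𝓞 k) = 4 * b' + 1 := by rw [hb']; push_cast; ring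
  have e3 : (B.l : 𝓞 k) = 4 * l' + 1 := by rw [hl']; push_cast; ring
  have e4 : (n : 𝓞 k) = 4 * n' + 1 := by rw [hn']; push_cast; ring
  rw [e1, e2, e3]
  linear_combination e4

include hd in
omit hn hnl in
theorem primesAbove_two_subset (hn4 : n % 4 = 3) : primesAbove k 2 ⊆ ramSet k K := by
  intro P hP
  obtain ⟨η, hη, -, -⟩ := Q.exists_integral_sqrt (B.d_eq_coe Q hd)
  have hcoe : ((1 + η : 𝓞 K) : K) = 1 + Q.δ := by
    change algebraMap (𝓞 K) K (1 + η) = _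
    rw [map_add, map_one]
    exact congrArg _ hη
  refine Q.mem_ramSet_of_eisenstein (1 + η) (b := 2) (by exact_mod_cast hP) ?_ ?_
  · have h2 : ((2 : 𝓞 k) : k) = 2 := map_ofNat (algebraMap (𝓞 k) k) 2
    rw [hcoe, map_add, map_one, Q.map_δ, h2, map_ofNat]
    ring
  · have h1 : Q.nm ((1 + η : 𝓞 K) : K) = 1 - Q.d := by
      have h2 : ((1 + η : 𝓞 K) : K) = algebraMap k K 1 + algebraMap k K 1 * Q.δ := by
        rw [hcoe, map_one, one_mul]
      rw [h2, Q.nm_apply]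
      ring
    obtain ⟨a', ha⟩ := B.four_dvd
    have hb := B.b_mod
    have hl := B.mod_eight
    obtain ⟨b', hb'⟩ : ∃ b', B.b = 4 * b' + 1 := ⟨B.b / 4, by omega⟩
    obtain ⟨l', hl'⟩ : ∃ l', B.l = 4 * l' + 1 := ⟨B.l / 4, by omega⟩
    obtain ⟨n', hn'⟩ : ∃ n', n = 4 * n' + 3 := ⟨n / 4, by omega⟩
    set y : 𝓞 k := -1 + 2 * (-(n' : 𝓞 k) - (n : 𝓞 k) * (l' * B.b + b' + a' * B.s)) with hy
    have h2 : 1 - Q.d = algebraMap (𝓞 k) k 2 * algebraMap (𝓞 k) k y := by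
      have e1 : (B.a : 𝓞 k) = 4 * a' := by rw [ha]; push_cast; ring
      have e2 : (B.b : 𝓞 k) = 4 * b' + 1 := by rw [hb']; push_cast; ring
      have e3 : (B.l : 𝓞 k) = 4 * l' + 1 := by rw [hl']; push_cast; ring
      have e4 : (n : 𝓞 k) = 4 * n' + 3 := by rw [hn']; push_cast; ring
      have h3 : 1 - (n * (B.l * B.b + B.a * B.s) : 𝓞 k) = 2 * y := by
        rw [hy, e1, e2, e3]
        linear_combination -e4
      rw [B.d_eq_coe Q hd, ← map_mul, ← h3, map_sub, map_one]
    have h2P : (2 : 𝓞 k) ∈ P.asIdeal := by exact_mod_cast hP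
    have hyP : y ∉ P.asIdeal := by
      intro h
      have h3 : (-1 : 𝓞 k) ∈ P.asIdeal := by
        have := P.asIdeal.sub_mem h (P.asIdeal.mul_mem_right
          (-(n' : 𝓞 k) - (n : 𝓞 k) * (l' * B.b + b' + a' * B.s)) h2P)
        rwa [hy, add_sub_cancel_right] at this
      exact P.isPrime.ne_top (Ideal.eq_top_of_isUnit_mem _ h3 isUnit_one.neg)
    have hy0 : y ≠ 0 := by rintro h; exact hyP (h ▸ P.asIdeal.zero_mem)
    have h22 : vord P (algebraMap (𝓞 k) k 2) = 1 := by
      have := vord_natCast_prime (k := k) Nat.prime_two hP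
      rw [B.ram_eq_one hP Nat.prime_two (by have := B.mod_eight; omega)] at this
      rw [map_ofNat]
      simpa using this
    rw [h1, h2, vord_mul P (by simp) (by simpa using hy0), h22, vord_algebraMap_eq_zero P hyP]
    norm_num

/-- The rational primes below the ramified primes. -/
def bad (l n : ℕ) : Finset ℕ :=
  insert l (n.primeFactors ∪ if n % 4 = 1 then ∅ else {2})

include hd in
theorem ramSet_eq : ramSet k K = ⋃ p ∈ (bad B.l n : Set ℕ), primesAbove k p := by
  ext P
  simp only [bad, Finset.coe_insert, Set.mem_iUnion, exists_prop, Set.mem_insert_iff,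
    Finset.mem_coe, Finset.mem_union, Nat.mem_primeFactors]
  constructor
  · intro hP
    obtain ⟨p, hp, hpP⟩ := exists_prime_mem P
    refine ⟨p, ?_, hpP⟩
    by_contra hcon
    push Not at hcon
    obtain ⟨hpl, hpn, hp2⟩ := hcon
    have hpn' : ¬p ∣ n := fun h => hn.ne_zero (hpn hp h)
    have hv := B.vord_d_of_not_dvd Q hd hn hp hpP hpl hpn'
    rw [B.d_eq_coe Q hd] at hv
    have hD0 : (n * (B.l * B.b + B.a * B.s) : 𝓞 k) ≠ 0 := by
      intro h0
      apply Q.d_ne_zero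
      rw [B.d_eq_coe Q hd, h0]
      exact map_zero (algebraMap (𝓞 k) k)
    refine Q.notMem_ramSet (B.d_eq_coe Q hd) (P := P) ?_ ?_ hP
    · intro hm
      have := (vord_algebraMap_pos (K := k) P hD0).2 hm
      rw [hv] at this
      exact lt_irrefl _ this
    · by_cases h2 : p = 2
      · right
        subst h2
        split_ifs at hp2 with h4
        · exact B.exists_four_mul h4
        · simp at hp2
      · left
        intro h
        exact h2 (prime_mem_unique hp Nat.prime_two hpP (by exact_mod_cast h))
  · rintro ⟨p, h | ⟨hp, hpn, -⟩ | h, hP⟩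
    · exact B.primesAbove_subset Q hd hn hnl (h ▸ B.prime) (Or.inl h) hP
    · exact B.primesAbove_subset Q hd hn hnl hp (Or.inr hpn) hP
    · split_ifs at h with h4
      · simp at h
      · rw [Finset.mem_singleton] at h
        subst h
        by_cases h2 : 2 ∣ n
        · exact B.primesAbove_subset Q hd hn hnl Nat.prime_two (Or.inr h2) hP
        · exact B.primesAbove_two_subset Q hd (by omega) hP

omit hn hnl in
theorem prime_of_mem_bad (hp : p ∈ bad B.l n) : p.Prime := by
  simp only [bad, Finset.mem_insert, Finset.mem_union, Nat.mem_primeFactors] at hp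
  rcases hp with rfl | h | h
  · exact B.prime
  · exact h.1
  · split_ifs at h
    · simp at h
    · rw [Finset.mem_singleton] at h
      exact h ▸ Nat.prime_two

include hd in
theorem ncard_ramSet : (ramSet k K).ncard = ∑ p ∈ bad B.l n, (primesAbove k p).ncard := by
  rw [B.ramSet_eq Q hd hn hnl, Set.Finite.ncard_biUnion (Finset.finite_toSet _)]
  · rw [finsum_mem_coe_finset]
  · intro p hp
    exact B.primesAbove_finite (B.prime_of_mem_bad hp)
  · intro p hp q hq hpq
    rw [Function.onFun, Set.disjoint_left]
    intro P hP hP'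
    exact hpq (prime_mem_unique (B.prime_of_mem_bad hp) (B.prime_of_mem_bad hq) hP hP')

end Base

end GenusCount

namespace GenusCount

open IsDedekindDomain nonZeroDivisors NumberField

/-- The number of `p ∈ T` congruent to `i` modulo `4` with `(p/l) = e`. -/
def cnt (l : ℕ) (T : Finset ℕ) (i : ℕ) (e : ℤ) : ℕ :=
  (T.filter fun p => p % 4 = i ∧ legSym l p = e).card

theorem quartSym_eq_or (p : ℕ) (a : ℤ) : quartSym p a = 1 ∨ quartSym p a = -1 := by
  unfold quartSym
  split_ifs <;> simp

section legSym

variable {l p : ℕ} (hl : l.Prime) (hl8 : l % 8 = 1) (hp : p.Prime) (hpl : p ≠ l)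

include hl hp hpl

omit hl hp hpl in
theorem intCast_dvd_sq_sub_iff {c : ℤ} : (∃ z : ℤ, (p : ℤ) ∣ z ^ 2 - c) ↔ IsSquare (c : ZMod p) := by
  constructor
  · rintro ⟨z, hz⟩
    have := (ZMod.intCast_zmod_eq_zero_iff_dvd _ _).2 hz
    push_cast at this
    exact ⟨z, by linear_combination -this⟩
  · rintro ⟨r, hr⟩
    obtain ⟨z, rfl⟩ := ZMod.intCast_surjective r
    refine ⟨z, (ZMod.intCast_zmod_eq_zero_iff_dvd _ _).1 ?_⟩
    push_cast
    rw [hr]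
    ring

theorem natCast_ne_zero_of_ne : (p : ZMod l) ≠ 0 := by
  intro h
  rw [ZMod.natCast_eq_zero_iff, Nat.prime_dvd_prime_iff_eq hl hp] at h
  exact hpl h.symm

theorem legSym_eq_or : legSym l p = 1 ∨ legSym l p = -1 := by
  have h := natCast_ne_zero_of_ne hl hp hpl
  unfold legSym
  rw [Int.cast_natCast, if_neg h]
  split_ifs <;> simp

include hl8 in
theorem legSym_eq_one_iff (hp2 : p ≠ 2) :
    legSym l p = 1 ↔ ∃ z : ℤ, (p : ℤ) ∣ z ^ 2 - l := by
  haveI : Fact l.Prime := ⟨hl⟩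
  haveI : Fact p.Prime := ⟨hp⟩
  have h := natCast_ne_zero_of_ne hl hp hpl
  rw [intCast_dvd_sq_sub_iff, Int.cast_natCast,
    ← ZMod.exists_sq_eq_prime_iff_of_mod_four_eq_one (p := l) (by omega) hp2,
    ZMod.euler_criterion l h]
  unfold legSym
  rw [Int.cast_natCast, if_neg h, show (l - 1) / 2 = l / 2 by omega]
  split_ifs with h1 <;> simp [h1]

end legSym

section Counting

variable {l : ℕ} (hl : l.Prime) {T : Finset ℕ} (hT : ∀ p ∈ T, p.Prime ∧ p ≠ 2 ∧ p ≠ l)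

include hl hT

omit hl in
theorem mod_four_of_mem {p : ℕ} (hp : p ∈ T) : p % 4 = 1 ∨ p % 4 = 3 := by
  have := (hT p hp).1.eq_two_or_odd
  have := (hT p hp).2.1
  omega

theorem sum_ncard : ∑ p ∈ T, (if legSym l p = 1 then 2 else 1) =
    2 * cnt l T 1 1 + cnt l T 1 (-1) + 2 * cnt l T 3 1 + cnt l T 3 (-1) := by
  simp only [cnt, Finset.card_filter]
  rw [Finset.mul_sum, Finset.mul_sum, ← Finset.sum_add_distrib, ← Finset.sum_add_distrib,
    ← Finset.sum_add_distrib]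
  refine Finset.sum_congr rfl fun p hp => ?_
  rcases mod_four_of_mem hT hp with h | h <;>
    rcases legSym_eq_or hl (hT p hp).1 (hT p hp).2.2 with h' | h' <;> simp [h, h']

theorem prod_mod_four :
    (∏ p ∈ T, p) % 4 = if (cnt l T 3 1 + cnt l T 3 (-1)) % 2 = 0 then 1 else 3 := by
  have h1 : cnt l T 3 1 + cnt l T 3 (-1) = (T.filter fun p => p % 4 = 3).card := by
    simp only [cnt, Finset.card_filter]
    rw [← Finset.sum_add_distrib]
    refine Finset.sum_congr rfl fun p hp => ?_
    rcases legSym_eq_or hl (hT p hp).1 (hT p hp).2.2 with h' | h' <;> simp [h']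
  rw [h1]
  have h2 : ∀ p ∈ T, p % 4 = 1 ∨ p % 4 = 3 := fun p hp => mod_four_of_mem hT hp
  clear h1 hT
  induction T using Finset.induction_on with
  | empty => simp
  | insert p T hp ih =>
    have ih := ih fun q hq => h2 q (Finset.mem_insert_of_mem hq)
    rw [Finset.prod_insert hp, Nat.mul_mod, ih, Finset.filter_insert]
    rcases h2 p (Finset.mem_insert_self p T) with h | h
    · rw [if_neg (by omega : ¬p % 4 = 3), h]
      split_ifs <;> rfl
    · rw [if_pos h, h, Finset.card_insert_of_notMem (by simp [hp])]
      split_ifs <;> first | rfl | omega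

omit hl in
theorem mem_of_dvd {δ p : ℕ} (hδ : δ = 1 ∨ δ = 2) (hp : p.Prime) (h : p ∣ δ * ∏ p ∈ T, p)
    (hp2 : p ≠ 2) : p ∈ T := by
  rcases hp.dvd_mul.1 h with h | h
  · exfalso
    rcases hδ with rfl | rfl
    · exact hp.one_lt.ne' (Nat.dvd_one.1 h)
    · exact hp2 ((Nat.prime_dvd_prime_iff_eq hp Nat.prime_two).1 h)
  · obtain ⟨q, hq, hpq⟩ := (Prime.dvd_finsetProd_iff hp.prime _).1 h
    rw [Nat.prime_dvd_prime_iff_eq hp (hT q hq).1] at hpq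
    rwa [hpq]

omit hl in
theorem squarefree_of_mem {δ : ℕ} (hδ : δ = 1 ∨ δ = 2) : Squarefree (δ * ∏ p ∈ T, p) := by
  have h2 : 2 ∉ T := fun h => (hT 2 h).2.1 rfl
  have h1 : ∀ S : Finset ℕ, (∀ p ∈ S, p.Prime) → Squarefree (∏ p ∈ S, p) := by
    intro S hS
    induction S using Finset.induction_on with
    | empty => simp
    | insert p S hp ih =>
      rw [Finset.prod_insert hp, Nat.squarefree_mul_iff]
      have hp' := hS p (Finset.mem_insert_self p S)
      have hS' := fun q hq => hS q (Finset.mem_insert_of_mem hq)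
      refine ⟨?_, hp'.prime.squarefree, ih hS'⟩
      rw [hp'.coprime_iff_not_dvd]
      intro h
      obtain ⟨q, hq, hpq⟩ := (Prime.dvd_finsetProd_iff hp'.prime _).1 h
      rw [Nat.prime_dvd_prime_iff_eq hp' (hS' q hq)] at hpq
      exact hp (hpq ▸ hq)
  rcases hδ with rfl | rfl
  · rw [one_mul]
    exact h1 T fun p hp => (hT p hp).1
  · rw [← Finset.prod_insert (f := fun p => p) h2]
    refine h1 _ fun p hp => ?_
    rcases Finset.mem_insert.1 hp with rfl | h
    · exact Nat.prime_two
    · exact (hT p h).1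

theorem coprime_of_mem (hl2 : l ≠ 2) {δ : ℕ} (hδ : δ = 1 ∨ δ = 2) : (δ * ∏ p ∈ T, p).Coprime l := by
  rw [Nat.coprime_comm, hl.coprime_iff_not_dvd]
  intro h
  exact (hT l (mem_of_dvd hT hδ hl h hl2)).2.2 rfl

theorem sum_bad {δ : ℕ} (hδ : δ = 1 ∨ δ = 2) (f : ℕ → ℕ) (hfl : f l = 1) (hf2 : f 2 = 2)
    (hl2 : l ≠ 2) (hf : ∀ p ∈ T, f p = if legSym l p = 1 then 2 else 1) :
    ∑ p ∈ Base.bad l (δ * ∏ p ∈ T, p), f p =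
      2 * cnt l T 1 1 + cnt l T 1 (-1) + 2 * cnt l T 3 1 + cnt l T 3 (-1) +
        if δ = 1 ∧ (cnt l T 3 1 + cnt l T 3 (-1)) % 2 = 0 then 1 else 3 := by
  have h2 : 2 ∉ T := fun h => (hT 2 h).2.1 rfl
  have hlT : l ∉ T := fun h => (hT l h).2.2 rfl
  have hm := prod_mod_four hl hT
  have hp : (δ * ∏ p ∈ T, p).primeFactors = if δ = 1 then T else insert 2 T := by
    rcases hδ with rfl | rfl
    · rw [one_mul, if_pos rfl]
      exact Nat.primeFactors_prod fun p hp => (hT p hp).1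
    · rw [← Finset.prod_insert (f := fun p => p) h2, if_neg (by norm_num)]
      refine Nat.primeFactors_prod fun p hp => ?_
      rcases Finset.mem_insert.1 hp with rfl | h
      · exact Nat.prime_two
      · exact (hT p h).1
  have hb : Base.bad l (δ * ∏ p ∈ T, p) = insert l
      (if δ = 1 ∧ (cnt l T 3 1 + cnt l T 3 (-1)) % 2 = 0 then T else insert 2 T) := by
    rw [Base.bad, hp]
    congr 1
    rcases hδ with rfl | rfl
    · rw [if_pos rfl, one_mul, hm]
      by_cases hc : (cnt l T 3 1 + cnt l T 3 (-1)) % 2 = 0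
      · simp [hc]
      · simp only [hc, if_false, and_false]
        ext; simp
    · have : (2 * ∏ p ∈ T, p) % 4 ≠ 1 := by omega
      rw [if_neg this, if_neg (by norm_num), if_neg (by omega)]
      ext; simp
  rw [hb, ← sum_ncard hl hT, ← Finset.sum_congr rfl hf]
  split_ifs
  · rw [Finset.sum_insert hlT, hfl, add_comm]
  · rw [Finset.sum_insert, Finset.sum_insert h2, hfl, hf2]
    · ring
    · simp [hl2, hlT]

end Counting

end GenusCount

namespace GenusCount

open IsDedekindDomain nonZeroDivisors NumberField

theorem not_dvd_sub_sq_of_legendreSym {p : ℕ} [Fact p.Prime] {a : ℤ} (h : legendreSym p a = -1)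
    (x : ℤ) : ¬(p : ℤ) ∣ a - x ^ 2 := by
  intro hd
  have h1 : legendreSym p a = legendreSym p (x ^ 2) := by
    rw [legendreSym.mod p a, legendreSym.mod p (x ^ 2)]
    congr 1
    exact (Int.modEq_iff_dvd.2 hd).symm
  rw [h, sq, legendreSym.mul] at h1
  nlinarith [mul_self_nonneg (legendreSym p x)]

theorem exists_dvd_sub_sq_of_legendreSym {p : ℕ} [Fact p.Prime] {a : ℤ} (h : legendreSym p a = 1) :
    ∃ x : ℤ, (p : ℤ) ∣ a - x ^ 2 := by
  have h0 : (a : ZMod p) ≠ 0 := by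
    intro h0
    rw [(legendreSym.eq_zero_iff p a).2 h0] at h
    norm_num at h
  obtain ⟨x, hx⟩ := intCast_dvd_sq_sub_iff.2 ((legendreSym.eq_one_iff p h0).1 h)
  exact ⟨x, by rwa [← dvd_neg, neg_sub]⟩

/-- The condition on quartic symbols making the fundamental unit a norm. -/
def QuartCond (l : ℕ) (T : Finset ℕ) (δ : ℕ) : Prop :=
  (δ = 2 → quartSym l 2 = (-1) ^ ((l - 1) / 8)) ∧
    ∀ p ∈ T, p % 4 = 1 → legSym l p = 1 → quartSym l p = quartSym p l

open Classical in
/-- The logarithm of the index of the squares in the group of units which are norms. -/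
noncomputable def nuExp (C D δ : ℕ) (q : Prop) : ℕ :=
  if 0 < C ∨ (C + D) % 2 = 1 then 0 else if 0 < D ∨ ¬q then 1 else 2

namespace Base

variable {k K : Type} [Field k] [NumberField k] [Field K] [NumberField K] [Algebra k K]
  (B : Base k) {T : Finset ℕ} (hT : ∀ p ∈ T, p.Prime ∧ p ≠ 2 ∧ p ≠ B.l) {δ : ℕ}
  (hδ : δ = 1 ∨ δ = 2) (Q : QuadExt k K) (hd : Q.d = ((δ * ∏ p ∈ T, p : ℕ) : k) * B.α)

theorem l_ne_two : B.l ≠ 2 := by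
  have := B.mod_eight
  omega

theorem legSym_eq_one_iff {p : ℕ} (hp : p.Prime) (hp2 : p ≠ 2) (hpl : p ≠ B.l) :
    legSym B.l p = 1 ↔ ∃ z : ℤ, (p : ℤ) ∣ z ^ 2 - B.l :=
  GenusCount.legSym_eq_one_iff B.prime B.mod_eight hp hpl hp2

theorem legendreSym_eq_mul {p : ℕ} (hp : p.Prime) (hp4 : p % 4 = 1) (hpl : p ≠ B.l) {z : ℤ}
    (hz : (p : ℤ) ∣ z ^ 2 - B.l) [Fact p.Prime] :
    legendreSym p (B.a + B.b * z) = quartSym B.l p * quartSym p B.l := by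
  obtain ⟨P, hP⟩ := exists_natCast_mem (k := k) hp
  exact B.legendreSym_eq hp hP (B.sw_ne_of_split hP hp (by omega) hpl hz) hp4 hpl hz

include hT hδ hd

theorem ncard_ramSet_eq : (ramSet k K).ncard =
    2 * cnt B.l T 1 1 + cnt B.l T 1 (-1) + 2 * cnt B.l T 3 1 + cnt B.l T 3 (-1) +
      if δ = 1 ∧ (cnt B.l T 3 1 + cnt B.l T 3 (-1)) % 2 = 0 then 1 else 3 := by
  rw [B.ncard_ramSet Q hd (squarefree_of_mem hT hδ) (coprime_of_mem B.prime hT B.l_ne_two hδ)]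
  refine sum_bad B.prime hT hδ _ B.ncard_primesAbove_l B.ncard_primesAbove_two B.l_ne_two ?_
  intro p hp
  obtain ⟨hpp, hp2, hpl⟩ := hT p hp
  split_ifs with h
  · obtain ⟨z, hz⟩ := (B.legSym_eq_one_iff hpp hp2 hpl).1 h
    exact B.ncard_primesAbove_split hpp hp2 hpl hz
  · rw [B.legSym_eq_one_iff hpp hp2 hpl] at h
    push Not at h
    exact B.ncard_primesAbove_inert hpp h

theorem primesAbove_subset_of_mem {p : ℕ} (hp : p ∈ T) : primesAbove k p ⊆ ramSet k K :=
  B.primesAbove_subset Q hd (squarefree_of_mem hT hδ) (coprime_of_mem B.prime hT B.l_ne_two hδ)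
    (hT p hp).1 (Or.inr ((Finset.dvd_prod_of_mem (fun p => p) hp).mul_left δ))

theorem nu_eq : Q.nu = 2 ^ nuExp (cnt B.l T 3 1) (cnt B.l T 3 (-1)) δ (QuartCond B.l T δ) := by
  have hmod := prod_mod_four B.prime hT
  have hexists : ∀ {i e}, 0 < cnt B.l T i e → ∃ p ∈ T, p % 4 = i ∧ legSym B.l p = e := by
    intro i e h
    obtain ⟨p, hp⟩ := Finset.card_pos.1 h
    rw [Finset.mem_filter] at hp
    exact ⟨p, hp⟩
  have hnone : ∀ {i e}, ¬0 < cnt B.l T i e → ∀ p ∈ T, p % 4 = i → legSym B.l p ≠ e := by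
    intro i e h p hp h1 h2
    exact h (Finset.card_pos.2 ⟨p, Finset.mem_filter.2 ⟨hp, h1, h2⟩⟩)
  rw [nuExp]
  split_ifs with h1 h2
  · rw [pow_zero]
    rcases h1 with h1 | h1
    · obtain ⟨q, hq, hq3, hqs⟩ := hexists h1
      obtain ⟨hqp, hq2, hql⟩ := hT q hq
      obtain ⟨z, hz⟩ := (B.legSym_eq_one_iff hqp hq2 hql).1 hqs
      have hram := B.primesAbove_subset_of_mem hT hδ Q hd hq
      have he := B.e_notMem_of_three Q hqp hq3 hram
      exact B.nu_eq_one Q (B.neg_one_notMem_of_three Q hqp hq3 hql hz hram) he.1 he.2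
    · rw [if_neg (by omega)] at hmod
      have hn : (δ * ∏ p ∈ T, p) % 4 = 3 ∨ (δ * ∏ p ∈ T, p) % 8 = 6 := by
        rcases hδ with rfl | rfl <;> omega
      obtain ⟨h, h', h''⟩ := B.notMem_norms_of_mod Q hd hn
      exact B.nu_eq_one Q h h' h''
  all_goals
    push Not at h1
    rw [if_pos (by omega)] at hmod
    have hn : (δ * ∏ p ∈ T, p) % 4 = 1 ∨ (δ * ∏ p ∈ T, p) % 8 = 2 := by
      rcases hδ with rfl | rfl <;> omega
    have hneg : (-1 : kˣ) ∈ Q.nmU.range := by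
      refine B.neg_one_mem Q hd hn fun q hq hqn hq3 => ?_
      have hqT := mem_of_dvd hT hδ hq hqn (by omega)
      have := hnone (i := 3) (e := 1) (by omega) q hqT hq3
      rw [Ne, B.legSym_eq_one_iff hq (hT q hqT).2.1 (hT q hqT).2.2] at this
      push Not at this
      exact this
  · rw [pow_one]
    refine B.nu_eq_two_of_neg_one Q hneg ?_
    by_cases h3 : 0 < cnt B.l T 3 (-1)
    · obtain ⟨q, hq, hq3, -⟩ := hexists h3
      exact (B.e_notMem_of_three Q (hT q hq).1 hq3 (B.primesAbove_subset_of_mem hT hδ Q hd hq)).1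
    · have h4 := h2.resolve_left h3
      rw [QuartCond, not_and_or] at h4
      rcases h4 with h4 | h4
      · push Not at h4
        rw [Ne, B.quartSym_two_iff] at h4
        refine (B.notMem_norms_of_two Q hd ?_ h4.2).1
        rw [h4.1] at hn ⊢
        omega
      · push Not at h4
        obtain ⟨p, hp, hp1, hps, hne⟩ := h4
        obtain ⟨hpp, hp2, hpl⟩ := hT p hp
        haveI : Fact p.Prime := ⟨hpp⟩
        obtain ⟨z, hz⟩ := (B.legSym_eq_one_iff hpp hp2 hpl).1 hps
        have hleg := B.legendreSym_eq_mul hpp hp1 hpl hz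
        have hleg' : legendreSym p (B.a + B.b * z) = -1 := by
          rcases quartSym_eq_or B.l p with h | h <;> rcases quartSym_eq_or p B.l with h' | h' <;>
            rw [h, h'] at hleg hne <;> simp_all
        exact (B.e_notMem_of_nonsquare Q hpp hp1 hpl hz (not_dvd_sub_sq_of_legendreSym hleg')
          (B.primesAbove_subset_of_mem hT hδ Q hd hp)).1
  · push Not at h2
    rw [show (2 : ℕ) ^ 2 = 4 from rfl]
    have h1T : ∀ p ∈ T, p % 4 = 1 := by
      intro p hp
      refine (mod_four_of_mem hT hp).resolve_right fun h3 => ?_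
      rcases legSym_eq_or B.prime (hT p hp).1 (hT p hp).2.2 with h | h
      · exact hnone (by omega) p hp h3 h
      · exact hnone (by omega) p hp h3 h
    refine B.nu_eq_four Q hneg (B.e_mem_norms Q (squarefree_of_mem hT hδ).ne_zero hd ?_ ?_ ?_)
    · exact fun p hp hpn hp2 => h1T p (mem_of_dvd hT hδ hp hpn hp2)
    · intro p hp hpn hp2 z hz
      have hpT := mem_of_dvd hT hδ hp hpn hp2
      haveI : Fact p.Prime := ⟨hp⟩
      apply exists_dvd_sub_sq_of_legendreSym
      rw [B.legendreSym_eq_mul hp (h1T p hpT) (hT p hpT).2.2 hz,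
        h2.2.2 p hpT (h1T p hpT) ((B.legSym_eq_one_iff hp hp2 (hT p hpT).2.2).2 ⟨z, hz⟩)]
      rcases quartSym_eq_or p B.l with h | h <;> rw [h] <;> norm_num
    · intro hn2
      rw [← B.quartSym_two_iff]
      refine h2.2.1 (hδ.resolve_left ?_)
      rintro rfl
      omega

theorem card_two_torsion_eq_eight_iff :
    Nat.card {c : ClassGroup (𝓞 K) // c ^ 2 = 1} = 2 ^ 3 ↔
      2 * cnt B.l T 1 1 + cnt B.l T 1 (-1) + 2 * cnt B.l T 3 1 + cnt B.l T 3 (-1) +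
        (if δ = 1 ∧ (cnt B.l T 3 1 + cnt B.l T 3 (-1)) % 2 = 0 then 1 else 3) +
        nuExp (cnt B.l T 3 1) (cnt B.l T 3 (-1)) δ (QuartCond B.l T δ) = 6 := by
  have h := Q.card_two_torsion B.odd_card Q.finite_ramSet
  change _ = Q.nu * _ at h
  have hn : (0 : ℝ) < ((δ * ∏ p ∈ T, p : ℕ) : ℝ) := by
    exact_mod_cast Nat.pos_of_ne_zero (squarefree_of_mem hT hδ).ne_zero
  have hr : Units.rank K = 3 := by
    apply B.rank_eq_three Q
    · rw [hd, map_mul, map_natCast]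
      exact mul_pos hn B.pos_α
    · rw [hd, map_mul, map_natCast]
      exact mul_pos hn B.neg_α
  rw [hr, B.rank_eq, B.nu_eq hT hδ Q hd, B.ncard_ramSet_eq hT hδ Q hd, ← pow_add] at h
  rw [← Nat.mul_left_inj (pow_pos two_pos (3 + 1)).ne', h, ← pow_add,
    Nat.pow_right_inj (le_refl 2)]
  omega

end Base

end GenusCount

namespace GenusCount

/-- The list of admissible factorizations of `n`. -/
def Forms (l n : ℕ) : Prop :=
  ((∃ p : ℕ, p.Prime ∧ p % 4 = 1 ∧ p ≠ l ∧ n = 2 * p ∧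
      ((legSym l p = -1 ∧ quartSym l 2 = (-1 : ℤ) ^ ((l - 1) / 8)) ∨
        (legSym l p = 1 ∧ (quartSym l 2 ≠ (-1 : ℤ) ^ ((l - 1) / 8) ∨
          quartSym l p ≠ quartSym p l)))) ∨
    (∃ p₁ p₂ : ℕ, p₁.Prime ∧ p₂.Prime ∧ p₁ % 4 = 1 ∧ p₂ % 4 = 1 ∧
      p₁ ≠ l ∧ p₂ ≠ l ∧ p₁ ≠ p₂ ∧ n = p₁ * p₂ ∧
      ((legSym l p₁ = 1 ∧ legSym l p₂ = 1 ∧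
          (quartSym l p₁ ≠ quartSym p₁ l ∨ quartSym l p₂ ≠ quartSym p₂ l)) ∨
        (legSym l p₁ = -1 ∧ legSym l p₂ = 1 ∧ quartSym l p₂ = quartSym p₂ l))) ∨
    (∃ p₁ p₂ : ℕ, p₁.Prime ∧ p₂.Prime ∧ p₁ % 4 = 1 ∧ p₂ % 4 = 1 ∧
      p₁ ≠ l ∧ p₂ ≠ l ∧ p₁ ≠ p₂ ∧ n = 2 * (p₁ * p₂) ∧
      legSym l p₁ = -1 ∧ legSym l p₂ = -1 ∧
      quartSym l 2 ≠ (-1 : ℤ) ^ ((l - 1) / 8)) ∨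
    (∃ p₁ p₂ p₃ : ℕ, p₁.Prime ∧ p₂.Prime ∧ p₃.Prime ∧
      p₁ % 4 = 1 ∧ p₂ % 4 = 1 ∧ p₃ % 4 = 1 ∧ p₁ ≠ l ∧ p₂ ≠ l ∧ p₃ ≠ l ∧
      p₁ ≠ p₂ ∧ p₁ ≠ p₃ ∧ p₂ ≠ p₃ ∧ n = p₁ * p₂ * p₃ ∧
      ((legSym l p₁ = -1 ∧ legSym l p₂ = -1 ∧ legSym l p₃ = -1) ∨
        (legSym l p₁ = -1 ∧ legSym l p₂ = -1 ∧ legSym l p₃ = 1 ∧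
          quartSym l p₃ ≠ quartSym p₃ l))) ∨
    (∃ δ q₁ q₂ q₃ : ℕ, (δ = 1 ∨ δ = 2) ∧ q₁.Prime ∧ q₂.Prime ∧ q₃.Prime ∧
      q₁ % 4 = 3 ∧ q₂ % 4 = 3 ∧ q₃ % 4 = 3 ∧ q₁ ≠ l ∧ q₂ ≠ l ∧ q₃ ≠ l ∧
      q₁ ≠ q₂ ∧ q₁ ≠ q₃ ∧ q₂ ≠ q₃ ∧ n = δ * (q₁ * q₂ * q₃) ∧
      legSym l q₁ = -1 ∧ legSym l q₂ = -1 ∧ legSym l q₃ = -1) ∨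
    (∃ q₁ q₂ q₃ q₄ : ℕ, q₁.Prime ∧ q₂.Prime ∧ q₃.Prime ∧ q₄.Prime ∧
      q₁ % 4 = 3 ∧ q₂ % 4 = 3 ∧ q₃ % 4 = 3 ∧ q₄ % 4 = 3 ∧
      q₁ ≠ l ∧ q₂ ≠ l ∧ q₃ ≠ l ∧ q₄ ≠ l ∧
      q₁ ≠ q₂ ∧ q₁ ≠ q₃ ∧ q₁ ≠ q₄ ∧ q₂ ≠ q₃ ∧ q₂ ≠ q₄ ∧ q₃ ≠ q₄ ∧
      n = q₁ * q₂ * q₃ * q₄ ∧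
      (Finset.filter (fun x : ℕ => legSym l (x : ℤ) = 1)
        ({q₁, q₂, q₃, q₄} : Finset ℕ)).card ≤ 1) ∨
    (∃ q₁ q₂ : ℕ, q₁.Prime ∧ q₂.Prime ∧ q₁ % 4 = 3 ∧ q₂ % 4 = 3 ∧
      q₁ ≠ l ∧ q₂ ≠ l ∧ q₁ ≠ q₂ ∧ n = 2 * (q₁ * q₂) ∧
      (legSym l q₁ = -1 ∨ legSym l q₂ = -1)) ∨
    (∃ δ p₁ p₂ q : ℕ, (δ = 1 ∨ δ = 2) ∧ p₁.Prime ∧ p₂.Prime ∧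
      p₁ % 4 = 1 ∧ p₂ % 4 = 1 ∧ p₁ ≠ l ∧ p₂ ≠ l ∧ p₁ ≠ p₂ ∧
      q.Prime ∧ q % 4 = 3 ∧ q ≠ l ∧ n = δ * (p₁ * p₂ * q) ∧
      legSym l p₁ = -1 ∧ legSym l p₂ = -1 ∧ legSym l q = -1) ∨
    (∃ δ p q : ℕ, (δ = 1 ∨ δ = 2) ∧ p.Prime ∧ p % 4 = 1 ∧ p ≠ l ∧
      q.Prime ∧ q % 4 = 3 ∧ q ≠ l ∧ n = δ * (p * q) ∧
      legSym l p ≠ legSym l q) ∨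
    (∃ p₁ p₂ q₁ q₂ : ℕ, p₁.Prime ∧ p₂.Prime ∧ p₁ % 4 = 1 ∧ p₂ % 4 = 1 ∧
      p₁ ≠ l ∧ p₂ ≠ l ∧ p₁ ≠ p₂ ∧ q₁.Prime ∧ q₂.Prime ∧
      q₁ % 4 = 3 ∧ q₂ % 4 = 3 ∧ q₁ ≠ l ∧ q₂ ≠ l ∧ q₁ ≠ q₂ ∧
      n = p₁ * p₂ * (q₁ * q₂) ∧ legSym l p₁ = -1 ∧ legSym l p₂ = -1 ∧
      (Finset.filter (fun x : ℕ => legSym l (x : ℤ) = 1)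
        ({q₁, q₂} : Finset ℕ)).card ≤ 1) ∨
    (∃ p q₁ q₂ : ℕ, p.Prime ∧ p % 4 = 1 ∧ p ≠ l ∧
      q₁.Prime ∧ q₂.Prime ∧ q₁ % 4 = 3 ∧ q₂ % 4 = 3 ∧
      q₁ ≠ l ∧ q₂ ≠ l ∧ q₁ ≠ q₂ ∧ n = p * (q₁ * q₂) ∧
      ((legSym l p = 1 ∧
          (Finset.filter (fun x : ℕ => legSym l (x : ℤ) = 1)
            ({q₁, q₂} : Finset ℕ)).card ≤ 1) ∨
        (legSym l p = -1 ∧ legSym l q₁ = 1 ∧ legSym l q₂ = 1))))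

/-- The numerical condition for the class group to have exactly eight elements of order dividing
two, where `n = δ * ∏ p ∈ T, p`. -/
def RankCond (l : ℕ) (T : Finset ℕ) (δ : ℕ) : Prop :=
  2 * cnt l T 1 1 + cnt l T 1 (-1) + 2 * cnt l T 3 1 + cnt l T 3 (-1) +
    (if δ = 1 ∧ (cnt l T 3 1 + cnt l T 3 (-1)) % 2 = 0 then 1 else 3) +
    nuExp (cnt l T 3 1) (cnt l T 3 (-1)) δ (QuartCond l T δ) = 6

section Finset

variable {S : Finset ℕ}

theorem prod_of_card_zero (h : S.card = 0) : ∏ p ∈ S, p = 1 := by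
  rw [Finset.card_eq_zero.1 h, Finset.prod_empty]

theorem exists_of_card_one (h : S.card = 1) : ∃ x ∈ S, ∏ p ∈ S, p = x ∧ ∀ y ∈ S, y = x := by
  obtain ⟨x, rfl⟩ := Finset.card_eq_one.1 h
  exact ⟨x, by simp, by simp, by simp⟩

theorem exists_of_card_succ {m : ℕ} (h : S.card = m + 1) : ∃ x ∈ S, ∃ R ⊆ S, x ∉ R ∧
    R.card = m ∧ ∏ p ∈ S, p = x * ∏ p ∈ R, p ∧ ∀ y ∈ S, y = x ∨ y ∈ R := by
  obtain ⟨x, R, hx, rfl, hR⟩ := Finset.card_eq_succ.1 h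
  exact ⟨x, by simp, R, by simp, hx, hR, Finset.prod_insert hx, by simp⟩

theorem exists_of_card_two (h : S.card = 2) : ∃ x ∈ S, ∃ y ∈ S, x ≠ y ∧ ∏ p ∈ S, p = x * y ∧
    ∀ z ∈ S, z = x ∨ z = y := by
  obtain ⟨x, hx, R, hRS, hxR, hR, hprod, hall⟩ := exists_of_card_succ h
  obtain ⟨y, hy, hprod', hall'⟩ := exists_of_card_one hR
  exact ⟨x, hx, y, hRS hy, fun h => hxR (h ▸ hy), by rw [hprod, hprod'],
    fun z hz => (hall z hz).imp_right (hall' z)⟩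

theorem exists_of_card_three (h : S.card = 3) : ∃ x ∈ S, ∃ y ∈ S, ∃ z ∈ S,
    x ≠ y ∧ x ≠ z ∧ y ≠ z ∧ ∏ p ∈ S, p = x * y * z := by
  obtain ⟨x, hx, R, hRS, hxR, hR, hprod, -⟩ := exists_of_card_succ h
  obtain ⟨y, hy, z, hz, hyz, hprod', -⟩ := exists_of_card_two hR
  exact ⟨x, hx, y, hRS hy, z, hRS hz, fun h => hxR (h ▸ hy), fun h => hxR (h ▸ hz), hyz,
    by rw [hprod, hprod', mul_assoc]⟩

theorem exists_of_card_four (h : S.card = 4) : ∃ x ∈ S, ∃ y ∈ S, ∃ z ∈ S, ∃ w ∈ S,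
    x ≠ y ∧ x ≠ z ∧ x ≠ w ∧ y ≠ z ∧ y ≠ w ∧ z ≠ w ∧ ∏ p ∈ S, p = x * y * z * w := by
  obtain ⟨x, hx, R, hRS, hxR, hR, hprod, -⟩ := exists_of_card_succ h
  obtain ⟨y, hy, z, hz, w, hw, hyz, hyw, hzw, hprod'⟩ := exists_of_card_three hR
  exact ⟨x, hx, y, hRS hy, z, hRS hz, w, hRS hw, fun h => hxR (h ▸ hy), fun h => hxR (h ▸ hz),
    fun h => hxR (h ▸ hw), hyz, hyw, hzw, by rw [hprod, hprod']; ring⟩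

end Finset

section Cnt

variable {l : ℕ}

theorem cnt_insert {S : Finset ℕ} {p : ℕ} (hp : p ∉ S) (i : ℕ) (e : ℤ) :
    cnt l (insert p S) i e = (if p % 4 = i ∧ legSym l p = e then 1 else 0) + cnt l S i e := by
  unfold cnt
  rw [Finset.filter_insert]
  split_ifs
  · rw [Finset.card_insert_of_notMem (by simp [hp]), add_comm]
  · rw [zero_add]

theorem cnt_singleton (p i : ℕ) (e : ℤ) :
    cnt l {p} i e = if p % 4 = i ∧ legSym l p = e then 1 else 0 := by
  unfold cnt
  rw [Finset.filter_singleton]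
  split_ifs <;> rfl

variable (hl : l.Prime) {T : Finset ℕ} (hT : ∀ p ∈ T, p.Prime ∧ p ≠ 2 ∧ p ≠ l)

include hl hT

theorem exists_partition : ∃ SA SB SC SD : Finset ℕ,
    (SA.card = cnt l T 1 1 ∧ SB.card = cnt l T 1 (-1) ∧ SC.card = cnt l T 3 1 ∧
      SD.card = cnt l T 3 (-1)) ∧
    (∀ p ∈ SA, p.Prime ∧ p % 4 = 1 ∧ p ≠ l ∧ legSym l p = 1) ∧
    (∀ p ∈ SB, p.Prime ∧ p % 4 = 1 ∧ p ≠ l ∧ legSym l p = -1) ∧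
    (∀ p ∈ SC, p.Prime ∧ p % 4 = 3 ∧ p ≠ l ∧ legSym l p = 1) ∧
    (∀ p ∈ SD, p.Prime ∧ p % 4 = 3 ∧ p ≠ l ∧ legSym l p = -1) ∧
    ∏ p ∈ T, p = (∏ p ∈ SA, p) * (∏ p ∈ SB, p) * (∏ p ∈ SC, p) * (∏ p ∈ SD, p) ∧
    ∀ P : ℕ → Prop, (∀ p ∈ T, p % 4 = 1 → legSym l p = 1 → P p) ↔ ∀ p ∈ SA, P p := by
  have key : ∀ (i : ℕ) (e : ℤ), ∀ p ∈ T.filter (fun p : ℕ => p % 4 = i ∧ legSym l p = e),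
      p.Prime ∧ p % 4 = i ∧ p ≠ l ∧ legSym l p = e := by
    intro i e p hp
    rw [Finset.mem_filter] at hp
    exact ⟨(hT p hp.1).1, hp.2.1, (hT p hp.1).2.2, hp.2.2⟩
  refine ⟨_, _, _, _, ⟨rfl, rfl, rfl, rfl⟩, key 1 1, key 1 (-1), key 3 1, key 3 (-1), ?_, ?_⟩
  · simp only [Finset.prod_filter]
    rw [← Finset.prod_mul_distrib, ← Finset.prod_mul_distrib, ← Finset.prod_mul_distrib]
    refine Finset.prod_congr rfl fun p hp => ?_
    rcases mod_four_of_mem hT hp with h | h <;>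
      rcases legSym_eq_or hl (hT p hp).1 (hT p hp).2.2 with h' | h' <;> simp [h, h']
  · intro P
    simp only [Finset.mem_filter]
    exact ⟨fun h p hp => h p hp.1 hp.2.1 hp.2.2, fun h p hp h1 h2 => h p ⟨hp, h1, h2⟩⟩

end Cnt

end GenusCount

namespace GenusCount

theorem rank_cases {A B C D δ : ℕ} {q : Prop} (hδ : δ = 1 ∨ δ = 2)
    (h : 2 * A + B + 2 * C + D + (if δ = 1 ∧ (C + D) % 2 = 0 then 1 else 3) +
      nuExp C D δ q = 6) :
    (A = 0 ∧ B = 1 ∧ C = 1 ∧ D = 0) ∨ (A = 1 ∧ B = 0 ∧ C = 0 ∧ D = 1) ∨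
    (A = 0 ∧ B = 2 ∧ C = 0 ∧ D = 1) ∨ (A = 0 ∧ B = 0 ∧ C = 0 ∧ D = 3) ∨
    (δ = 1 ∧ ((A = 1 ∧ B = 0 ∧ C = 1 ∧ D = 1) ∨ (A = 1 ∧ B = 0 ∧ C = 0 ∧ D = 2) ∨
      (A = 0 ∧ B = 1 ∧ C = 2 ∧ D = 0) ∨ (A = 0 ∧ B = 2 ∧ C = 1 ∧ D = 1) ∨
      (A = 0 ∧ B = 2 ∧ C = 0 ∧ D = 2) ∨ (A = 0 ∧ B = 0 ∧ C = 1 ∧ D = 3) ∨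
      (A = 0 ∧ B = 0 ∧ C = 0 ∧ D = 4))) ∨
    (δ = 1 ∧ C = 0 ∧ D = 0 ∧ q ∧ ((A = 0 ∧ B = 3) ∨ (A = 1 ∧ B = 1))) ∨
    (δ = 1 ∧ C = 0 ∧ D = 0 ∧ ¬q ∧ ((A = 2 ∧ B = 0) ∨ (A = 1 ∧ B = 2) ∨ (A = 0 ∧ B = 4))) ∨
    (δ = 2 ∧ ((A = 0 ∧ B = 0 ∧ C = 1 ∧ D = 1) ∨ (A = 0 ∧ B = 0 ∧ C = 0 ∧ D = 2))) ∨
    (δ = 2 ∧ C = 0 ∧ D = 0 ∧ q ∧ (A = 0 ∧ B = 1)) ∨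
    (δ = 2 ∧ C = 0 ∧ D = 0 ∧ ¬q ∧ ((A = 1 ∧ B = 0) ∨ (A = 0 ∧ B = 2))) := by
  unfold nuExp at h
  have hone : 1 ≤ if δ = 1 ∧ (C + D) % 2 = 0 then 1 else 3 := by split_ifs <;> simp
  have hA : A ≤ 2 := by omega
  have hC : C ≤ 2 := by omega
  have hD : D ≤ 5 := by omega
  by_cases hq : q <;> rcases hδ with rfl | rfl <;> interval_cases A <;> interval_cases C <;>
    interval_cases D <;> simp [hq] at h ⊢ <;> omega

section Forms

variable {l : ℕ} (hl : l.Prime) {T : Finset ℕ} (hT : ∀ p ∈ T, p.Prime ∧ p ≠ 2 ∧ p ≠ l)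
  {δ : ℕ} (hδ : δ = 1 ∨ δ = 2)

include hl hT hδ

theorem forms_of_rankCond (h : RankCond l T δ) : Forms l (δ * ∏ p ∈ T, p) := by
  obtain ⟨SA, SB, SC, SD, ⟨hA, hB, hC, hD⟩, sA, sB, sC, sD, hprod, hP⟩ := exists_partition hl hT
  have hq : QuartCond l T δ ↔ (δ = 2 → quartSym l 2 = (-1) ^ ((l - 1) / 8)) ∧
      ∀ p ∈ SA, quartSym l p = quartSym p l := by
    rw [← hP]; rfl
  unfold RankCond at h
  rw [← hA, ← hB, ← hC, ← hD] at h
  rw [hprod]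
  have h11 : (1 : ℤ) ≠ -1 := by decide
  unfold Forms
  rcases rank_cases hδ h with ⟨a, b, c, d⟩ | ⟨a, b, c, d⟩ | ⟨a, b, c, d⟩ | ⟨a, b, c, d⟩ |
    ⟨rfl, ⟨a, b, c, d⟩ | ⟨a, b, c, d⟩ | ⟨a, b, c, d⟩ | ⟨a, b, c, d⟩ | ⟨a, b, c, d⟩ |
      ⟨a, b, c, d⟩ | ⟨a, b, c, d⟩⟩ |
    ⟨rfl, c, d, q, ⟨a, b⟩ | ⟨a, b⟩⟩ | ⟨rfl, c, d, q, ⟨a, b⟩ | ⟨a, b⟩ | ⟨a, b⟩⟩ |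
    ⟨rfl, ⟨a, b, c, d⟩ | ⟨a, b, c, d⟩⟩ |
    ⟨rfl, c, d, q, ⟨a, b⟩⟩ | ⟨rfl, c, d, q, ⟨a, b⟩ | ⟨a, b⟩⟩
  · obtain ⟨p, hp, hp', -⟩ := exists_of_card_one b
    obtain ⟨q, hq, hq', -⟩ := exists_of_card_one c
    rw [prod_of_card_zero a, prod_of_card_zero d, hp', hq', one_mul, mul_one]
    obtain ⟨u1, u2, u3, u4⟩ := sB p hp
    obtain ⟨v1, v2, v3, v4⟩ := sC q hq
    iterate 8 right
    left
    exact ⟨δ, p, q, hδ, u1, u2, u3, v1, v2, v3, rfl, by rw [u4, v4]; exact h11.symm⟩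
  · obtain ⟨p, hp, hp', -⟩ := exists_of_card_one a
    obtain ⟨q, hq, hq', -⟩ := exists_of_card_one d
    rw [prod_of_card_zero b, prod_of_card_zero c, hp', hq', mul_one, mul_one]
    obtain ⟨u1, u2, u3, u4⟩ := sA p hp
    obtain ⟨v1, v2, v3, v4⟩ := sD q hq
    iterate 8 right
    left
    exact ⟨δ, p, q, hδ, u1, u2, u3, v1, v2, v3, rfl, by rw [u4, v4]; exact h11⟩
  · obtain ⟨p, hp, r, hr, hne, hp', -⟩ := exists_of_card_two b
    obtain ⟨q, hq, hq', -⟩ := exists_of_card_one d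
    rw [prod_of_card_zero a, prod_of_card_zero c, hp', hq', one_mul, mul_one]
    obtain ⟨u1, u2, u3, u4⟩ := sB p hp
    obtain ⟨w1, w2, w3, w4⟩ := sB r hr
    obtain ⟨v1, v2, v3, v4⟩ := sD q hq
    iterate 7 right
    left
    exact ⟨δ, p, r, q, hδ, u1, w1, u2, w2, u3, w3, hne, v1, v2, v3, rfl, u4, w4, v4⟩
  · obtain ⟨x, hx, y, hy, z, hz, xy, xz, yz, h'⟩ := exists_of_card_three d
    rw [prod_of_card_zero a, prod_of_card_zero b, prod_of_card_zero c, h', one_mul, one_mul,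
      one_mul]
    obtain ⟨u1, u2, u3, u4⟩ := sD x hx
    obtain ⟨v1, v2, v3, v4⟩ := sD y hy
    obtain ⟨w1, w2, w3, w4⟩ := sD z hz
    iterate 4 right
    left
    exact ⟨δ, x, y, z, hδ, u1, v1, w1, u2, v2, w2, u3, v3, w3, xy, xz, yz, rfl, u4, v4, w4⟩
  · obtain ⟨p, hp, hp', -⟩ := exists_of_card_one a
    obtain ⟨q, hq, hq', -⟩ := exists_of_card_one c
    obtain ⟨r, hr, hr', -⟩ := exists_of_card_one d
    rw [prod_of_card_zero b, hp', hq', hr']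
    obtain ⟨u1, u2, u3, u4⟩ := sA p hp
    obtain ⟨v1, v2, v3, v4⟩ := sC q hq
    obtain ⟨w1, w2, w3, w4⟩ := sD r hr
    iterate 10 right
    exact ⟨p, q, r, u1, u2, u3, v1, w1, v2, w2, v3, w3, by rintro rfl; simp [v4] at w4, by ring,
      .inl ⟨u4, by simp [Finset.filter_insert, Finset.filter_singleton, v4, w4]⟩⟩
  · obtain ⟨p, hp, hp', -⟩ := exists_of_card_one a
    obtain ⟨q, hq, r, hr, hne, hq', -⟩ := exists_of_card_two d
    rw [prod_of_card_zero b, prod_of_card_zero c, hp', hq']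
    obtain ⟨u1, u2, u3, u4⟩ := sA p hp
    obtain ⟨v1, v2, v3, v4⟩ := sD q hq
    obtain ⟨w1, w2, w3, w4⟩ := sD r hr
    iterate 10 right
    exact ⟨p, q, r, u1, u2, u3, v1, w1, v2, w2, v3, w3, hne, by ring,
      .inl ⟨u4, by simp [Finset.filter_insert, Finset.filter_singleton, v4, w4]⟩⟩
  · obtain ⟨p, hp, hp', -⟩ := exists_of_card_one b
    obtain ⟨q, hq, r, hr, hne, hq', -⟩ := exists_of_card_two c
    rw [prod_of_card_zero a, prod_of_card_zero d, hp', hq']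
    obtain ⟨u1, u2, u3, u4⟩ := sB p hp
    obtain ⟨v1, v2, v3, v4⟩ := sC q hq
    obtain ⟨w1, w2, w3, w4⟩ := sC r hr
    iterate 10 right
    exact ⟨p, q, r, u1, u2, u3, v1, w1, v2, w2, v3, w3, hne, by ring, .inr ⟨u4, v4, w4⟩⟩
  · obtain ⟨p, hp, p', hp', hpp, h', -⟩ := exists_of_card_two b
    obtain ⟨q, hq, hq', -⟩ := exists_of_card_one c
    obtain ⟨r, hr, hr', -⟩ := exists_of_card_one d
    rw [prod_of_card_zero a, h', hq', hr']
    obtain ⟨u1, u2, u3, u4⟩ := sB p hp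
    obtain ⟨t1, t2, t3, t4⟩ := sB p' hp'
    obtain ⟨v1, v2, v3, v4⟩ := sC q hq
    obtain ⟨w1, w2, w3, w4⟩ := sD r hr
    iterate 9 right
    left
    exact ⟨p, p', q, r, u1, t1, u2, t2, u3, t3, hpp, v1, w1, v2, w2, v3, w3,
      by rintro rfl; simp [v4] at w4, by ring, u4, t4,
      by simp [Finset.filter_insert, Finset.filter_singleton, v4, w4]⟩
  · obtain ⟨p, hp, p', hp', hpp, h', -⟩ := exists_of_card_two b
    obtain ⟨q, hq, r, hr, hne, hq', -⟩ := exists_of_card_two d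
    rw [prod_of_card_zero a, prod_of_card_zero c, h', hq']
    obtain ⟨u1, u2, u3, u4⟩ := sB p hp
    obtain ⟨t1, t2, t3, t4⟩ := sB p' hp'
    obtain ⟨v1, v2, v3, v4⟩ := sD q hq
    obtain ⟨w1, w2, w3, w4⟩ := sD r hr
    iterate 9 right
    left
    exact ⟨p, p', q, r, u1, t1, u2, t2, u3, t3, hpp, v1, w1, v2, w2, v3, w3,
      hne, by ring, u4, t4,
      by simp [Finset.filter_insert, Finset.filter_singleton, v4, w4]⟩
  · obtain ⟨x, hx, hx', -⟩ := exists_of_card_one c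
    obtain ⟨y, hy, z, hz, w, hw, yz, yw, zw, h'⟩ := exists_of_card_three d
    rw [prod_of_card_zero a, prod_of_card_zero b, hx', h']
    obtain ⟨t1, t2, t3, t4⟩ := sC x hx
    obtain ⟨u1, u2, u3, u4⟩ := sD y hy
    obtain ⟨v1, v2, v3, v4⟩ := sD z hz
    obtain ⟨w1, w2, w3, w4⟩ := sD w hw
    iterate 5 right
    left
    exact ⟨x, y, z, w, t1, u1, v1, w1, t2, u2, v2, w2, t3, u3, v3, w3,
      by rintro rfl; simp [t4] at u4, by rintro rfl; simp [t4] at v4,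
      by rintro rfl; simp [t4] at w4, yz, yw, zw, by ring,
      by simp [Finset.filter_insert, Finset.filter_singleton, t4, u4, v4, w4]⟩
  · obtain ⟨x, hx, y, hy, z, hz, w, hw, xy, xz, xw, yz, yw, zw, h'⟩ := exists_of_card_four d
    rw [prod_of_card_zero a, prod_of_card_zero b, prod_of_card_zero c, h']
    obtain ⟨t1, t2, t3, t4⟩ := sD x hx
    obtain ⟨u1, u2, u3, u4⟩ := sD y hy
    obtain ⟨v1, v2, v3, v4⟩ := sD z hz
    obtain ⟨w1, w2, w3, w4⟩ := sD w hw
    iterate 5 right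
    left
    exact ⟨x, y, z, w, t1, u1, v1, w1, t2, u2, v2, w2, t3, u3, v3, w3,
      xy, xz, xw, yz, yw, zw, by ring,
      by simp [Finset.filter_insert, Finset.filter_singleton, t4, u4, v4, w4]⟩
  · obtain ⟨x, hx, y, hy, z, hz, xy, xz, yz, h'⟩ := exists_of_card_three b
    rw [prod_of_card_zero a, prod_of_card_zero d, prod_of_card_zero c, h']
    obtain ⟨u1, u2, u3, u4⟩ := sB x hx
    obtain ⟨v1, v2, v3, v4⟩ := sB y hy
    obtain ⟨w1, w2, w3, w4⟩ := sB z hz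
    iterate 3 right
    left
    exact ⟨x, y, z, u1, v1, w1, u2, v2, w2, u3, v3, w3, xy, xz, yz, by ring, .inl ⟨u4, v4, w4⟩⟩
  · obtain ⟨x, hx, hx', -⟩ := exists_of_card_one a
    obtain ⟨y, hy, hy', -⟩ := exists_of_card_one b
    rw [prod_of_card_zero c, prod_of_card_zero d, hx', hy']
    obtain ⟨u1, u2, u3, u4⟩ := sA x hx
    obtain ⟨v1, v2, v3, v4⟩ := sB y hy
    right
    left
    exact ⟨y, x, v1, u1, v2, u2, v3, u3, by rintro rfl; simp [u4] at v4, by ring,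
      .inr ⟨v4, u4, (hq.1 q).2 x hx⟩⟩
  · obtain ⟨x, hx, y, hy, hne, h', hall⟩ := exists_of_card_two a
    rw [prod_of_card_zero b, prod_of_card_zero c, prod_of_card_zero d, h']
    obtain ⟨u1, u2, u3, u4⟩ := sA x hx
    obtain ⟨v1, v2, v3, v4⟩ := sA y hy
    right
    left
    refine ⟨x, y, u1, v1, u2, v2, u3, v3, hne, by ring, .inl ⟨u4, v4, ?_⟩⟩
    by_contra! hcon
    refine q (hq.2 ⟨by simp, fun p hp => ?_⟩)
    rcases hall p hp with rfl | rfl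
    exacts [hcon.1, hcon.2]
  · obtain ⟨x, hx, hx', hall⟩ := exists_of_card_one a
    obtain ⟨y, hy, z, hz, hne, h', -⟩ := exists_of_card_two b
    rw [prod_of_card_zero c, prod_of_card_zero d, hx', h']
    obtain ⟨u1, u2, u3, u4⟩ := sA x hx
    obtain ⟨v1, v2, v3, v4⟩ := sB y hy
    obtain ⟨w1, w2, w3, w4⟩ := sB z hz
    iterate 3 right
    left
    refine ⟨y, z, x, v1, w1, u1, v2, w2, u2, v3, w3, u3, hne, by rintro rfl; simp [u4] at v4,
      by rintro rfl; simp [u4] at w4, by ring, .inr ⟨v4, w4, u4, fun hcon => ?_⟩⟩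
    refine q (hq.2 ⟨by simp, fun p hp => ?_⟩)
    rw [hall p hp]
    exact hcon
  · exact absurd (hq.2 ⟨by simp, by simp [Finset.card_eq_zero.1 a]⟩) q
  · obtain ⟨x, hx, hx', -⟩ := exists_of_card_one c
    obtain ⟨y, hy, hy', -⟩ := exists_of_card_one d
    rw [prod_of_card_zero a, prod_of_card_zero b, hx', hy', one_mul, one_mul]
    obtain ⟨u1, u2, u3, u4⟩ := sC x hx
    obtain ⟨v1, v2, v3, v4⟩ := sD y hy
    iterate 6 right
    left
    exact ⟨x, y, u1, v1, u2, v2, u3, v3, by rintro rfl; simp [u4] at v4, rfl, .inr v4⟩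
  · obtain ⟨x, hx, y, hy, hne, h', -⟩ := exists_of_card_two d
    rw [prod_of_card_zero a, prod_of_card_zero b, prod_of_card_zero c, h', one_mul, one_mul,
      one_mul]
    obtain ⟨u1, u2, u3, u4⟩ := sD x hx
    obtain ⟨v1, v2, v3, v4⟩ := sD y hy
    iterate 6 right
    left
    exact ⟨x, y, u1, v1, u2, v2, u3, v3, hne, rfl, .inr v4⟩
  · obtain ⟨x, hx, hx', -⟩ := exists_of_card_one b
    rw [prod_of_card_zero a, prod_of_card_zero c, prod_of_card_zero d, hx']
    obtain ⟨u1, u2, u3, u4⟩ := sB x hx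
    left
    exact ⟨x, u1, u2, u3, by ring, .inl ⟨u4, (hq.1 q).1 rfl⟩⟩
  · obtain ⟨x, hx, hx', hall⟩ := exists_of_card_one a
    rw [prod_of_card_zero b, prod_of_card_zero c, prod_of_card_zero d, hx']
    obtain ⟨u1, u2, u3, u4⟩ := sA x hx
    left
    refine ⟨x, u1, u2, u3, by ring, .inr ⟨u4, ?_⟩⟩
    by_contra! hcon
    refine q (hq.2 ⟨fun _ => hcon.1, fun p hp => ?_⟩)
    rw [hall p hp]
    exact hcon.2
  · obtain ⟨x, hx, y, hy, hne, h', -⟩ := exists_of_card_two b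
    rw [prod_of_card_zero a, prod_of_card_zero c, prod_of_card_zero d, h']
    obtain ⟨u1, u2, u3, u4⟩ := sB x hx
    obtain ⟨v1, v2, v3, v4⟩ := sB y hy
    iterate 2 right
    left
    exact ⟨x, y, u1, v1, u2, v2, u3, v3, hne, by ring, u4, v4,
      fun hcon => q (hq.2 ⟨fun _ => hcon, by simp [Finset.card_eq_zero.1 a]⟩)⟩

end Forms

end GenusCount

namespace GenusCount

theorem forms_iff {l : ℕ} (hl : l.Prime) {n : ℕ} (hsq : Squarefree n) (hnl : n.Coprime l)
    {P : Prop} (H : ∀ (T : Finset ℕ) (δ : ℕ), (∀ p ∈ T, p.Prime ∧ p ≠ 2 ∧ p ≠ l) →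
      (δ = 1 ∨ δ = 2) → n = δ * ∏ p ∈ T, p → (P ↔ RankCond l T δ)) : P ↔ Forms l n := by
  constructor
  · intro hP
    have hT : ∀ p ∈ n.primeFactors.erase 2, p.Prime ∧ p ≠ 2 ∧ p ≠ l := by
      intro p hp
      obtain ⟨hp2, hp⟩ := Finset.mem_erase.1 hp
      refine ⟨Nat.prime_of_mem_primeFactors hp, hp2, ?_⟩
      rintro rfl
      exact (Nat.Prime.coprime_iff_not_dvd hl).1 hnl.symm (Nat.dvd_of_mem_primeFactors hp)
    obtain ⟨δ, hδ, hn⟩ : ∃ δ, (δ = 1 ∨ δ = 2) ∧ n = δ * ∏ p ∈ n.primeFactors.erase 2, p := by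
      by_cases h2 : 2 ∈ n.primeFactors
      · refine ⟨2, .inr rfl, ?_⟩
        rw [Finset.mul_prod_erase _ (fun p => p) h2]
        exact (Nat.prod_primeFactors_of_squarefree hsq).symm
      · refine ⟨1, .inl rfl, ?_⟩
        rw [Finset.erase_eq_of_notMem h2, one_mul]
        exact (Nat.prod_primeFactors_of_squarefree hsq).symm
    have := forms_of_rankCond hl hT hδ ((H _ δ hT hδ hn).1 hP)
    rwa [← hn] at this
  · have key : ∀ {p i : ℕ}, p.Prime → p % 4 = i → i % 2 = 1 → p ≠ l →
        p.Prime ∧ p ≠ 2 ∧ p ≠ l := fun h1 h2 h3 h4 => ⟨h1, by omega, h4⟩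
    have hodd : ∀ {p q : ℕ}, p % 4 = 1 → q % 4 = 3 → p ≠ q := by omega
    rintro (⟨p, hp, m, hpl, rfl, h⟩ | ⟨p, q, hp, hq, m, m', hpl, hql, hne, rfl, h⟩ |
      ⟨p, q, hp, hq, m, m', hpl, hql, hne, rfl, h, h', h''⟩ |
      ⟨p, q, r, hp, hq, hr, m, m', m'', hpl, hql, hrl, hne, hne', hne'', rfl, h⟩ |
      ⟨δ, p, q, r, hδ, hp, hq, hr, m, m', m'', hpl, hql, hrl, hne, hne', hne'', rfl,
        h, h', h''⟩ |
      ⟨p, q, r, s, hp, hq, hr, hs, m, m', m'', m₄, hpl, hql, hrl, hsl, n1, n2, n3, n4, n5, n6,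
        rfl, h⟩ |
      ⟨p, q, hp, hq, m, m', hpl, hql, hne, rfl, h⟩ |
      ⟨δ, p, q, r, hδ, hp, hq, m, m', hpl, hql, hne, hr, m'', hrl, rfl, h, h', h''⟩ |
      ⟨δ, p, q, hδ, hp, m, hpl, hq, m', hql, rfl, h⟩ |
      ⟨p, q, r, s, hp, hq, m, m', hpl, hql, hne, hr, hs, m'', m₄, hrl, hsl, hne', rfl,
        h, h', h''⟩ |
      ⟨p, q, r, hp, m, hpl, hq, hr, m', m'', hql, hrl, hne, rfl, h⟩)
    · refine (H {p} 2 (by simpa using key hp m rfl hpl) (.inr rfl) (by simp)).2 ?_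
      rcases h with ⟨h, h'⟩ | ⟨h, h'⟩
      · simp [RankCond, nuExp, QuartCond, cnt_singleton, m, h, h']
      · have : ¬ (quartSym l 2 = (-1) ^ ((l - 1) / 8) ∧ quartSym l p = quartSym p l) := by tauto
        simp [RankCond, nuExp, QuartCond, cnt_singleton, m, h, this]
    · refine (H {p, q} 1 (by simpa using ⟨key hp m rfl hpl, key hq m' rfl hql⟩) (.inl rfl)
        (by simp [Finset.prod_pair hne])).2 ?_
      rcases h with ⟨h, h', h''⟩ | ⟨h, h', h''⟩
      · have : ¬ (quartSym l p = quartSym p l ∧ quartSym l q = quartSym q l) := by tauto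
        simp [RankCond, nuExp, QuartCond, cnt_insert, cnt_singleton, hne, m, m', h, h', this]
      · simp [RankCond, nuExp, QuartCond, cnt_insert, cnt_singleton, hne, m, m', h, h', h'']
    · refine (H {p, q} 2 (by simpa using ⟨key hp m rfl hpl, key hq m' rfl hql⟩) (.inr rfl)
        (by simp [Finset.prod_pair hne])).2 ?_
      simp [RankCond, nuExp, QuartCond, cnt_insert, cnt_singleton, hne, m, m', h, h', h'']
    · refine (H {p, q, r} 1 (by simpa using ⟨key hp m rfl hpl, key hq m' rfl hql,
        key hr m'' rfl hrl⟩) (.inl rfl) (by simp [Finset.prod_insert, *, mul_assoc])).2 ?_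
      rcases h with ⟨h, h', h''⟩ | ⟨h, h', h'', h₄⟩
      · simp [RankCond, nuExp, QuartCond, cnt_insert, cnt_singleton, *]
      · simp [RankCond, nuExp, QuartCond, cnt_insert, cnt_singleton, *]
    · refine (H {p, q, r} δ (by simpa using ⟨key hp m rfl hpl, key hq m' rfl hql,
        key hr m'' rfl hrl⟩) hδ (by simp [Finset.prod_insert, *, mul_assoc])).2 ?_
      simp [RankCond, nuExp, cnt_insert, cnt_singleton, *]
    · refine (H {p, q, r, s} 1 (by simpa using ⟨key hp m rfl hpl, key hq m' rfl hql,
        key hr m'' rfl hrl, key hs m₄ rfl hsl⟩) (.inl rfl)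
        (by simp [Finset.prod_insert, *, mul_assoc])).2 ?_
      rcases legSym_eq_or hl hp hpl with e | e <;> rcases legSym_eq_or hl hq hql with e' | e' <;>
      rcases legSym_eq_or hl hr hrl with e'' | e'' <;>
      rcases legSym_eq_or hl hs hsl with e₄ | e₄ <;>
      simp [Finset.filter_insert, Finset.filter_singleton, *] at h <;>
      simp [RankCond, nuExp, cnt_insert, cnt_singleton, *]
    · refine (H {p, q} 2 (by simpa using ⟨key hp m rfl hpl, key hq m' rfl hql⟩) (.inr rfl)
        (by simp [Finset.prod_pair hne])).2 ?_
      rcases legSym_eq_or hl hp hpl with e | e <;> rcases legSym_eq_or hl hq hql with e' | e' <;>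
      simp [e, e'] at h <;>
      simp [RankCond, nuExp, cnt_insert, cnt_singleton, *]
    · have n1 := hodd m m''
      have n2 := hodd m' m''
      refine (H {p, q, r} δ (by simpa using ⟨key hp m rfl hpl, key hq m' rfl hql,
        key hr m'' rfl hrl⟩) hδ (by simp [Finset.prod_insert, *, mul_assoc])).2 ?_
      simp [RankCond, nuExp, cnt_insert, cnt_singleton, *]
    · have hne := hodd m m'
      refine (H {p, q} δ (by simpa using ⟨key hp m rfl hpl, key hq m' rfl hql⟩) hδ
        (by simp [Finset.prod_pair hne])).2 ?_
      rcases legSym_eq_or hl hp hpl with e | e <;> rcases legSym_eq_or hl hq hql with e' | e' <;>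
      simp [e, e'] at h <;>
      simp [RankCond, nuExp, cnt_insert, cnt_singleton, *]
    · have n1 := hodd m m''
      have n2 := hodd m' m''
      have n3 := hodd m m₄
      have n4 := hodd m' m₄
      refine (H {p, q, r, s} 1 (by simpa using ⟨key hp m rfl hpl, key hq m' rfl hql,
        key hr m'' rfl hrl, key hs m₄ rfl hsl⟩) (.inl rfl)
        (by simp [Finset.prod_insert, *, mul_assoc])).2 ?_
      rcases legSym_eq_or hl hr hrl with e'' | e'' <;>
      rcases legSym_eq_or hl hs hsl with e₄ | e₄ <;>
      simp [Finset.filter_insert, Finset.filter_singleton, e'', e₄, hne'] at h'' <;>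
      simp [RankCond, nuExp, cnt_insert, cnt_singleton, *]
    · have n1 := hodd m m'
      have n2 := hodd m m''
      refine (H {p, q, r} 1 (by simpa using ⟨key hp m rfl hpl, key hq m' rfl hql,
        key hr m'' rfl hrl⟩) (.inl rfl) (by simp [Finset.prod_insert, *, mul_assoc])).2 ?_
      rcases h with ⟨h, h'⟩ | ⟨h, h', h''⟩
      · rcases legSym_eq_or hl hq hql with e | e <;> rcases legSym_eq_or hl hr hrl with e' | e' <;>
        simp [Finset.filter_insert, Finset.filter_singleton, e, e', hne] at h' <;>
        simp [RankCond, nuExp, cnt_insert, cnt_singleton, *]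
      · simp [RankCond, nuExp, cnt_insert, cnt_singleton, *]

end GenusCount

namespace GenusCount

theorem mod_four_eq_one_of_forall_prime {m : ℕ} (hm : m ≠ 0)
    (h : ∀ p, p.Prime → p ∣ m → p % 4 = 1) : m % 4 = 1 := by
  induction m using Nat.recOnMul with
  | zero => exact absurd rfl hm
  | one => rfl
  | prime p hp => exact h p hp dvd_rfl
  | mul a b iha ihb =>
    rw [mul_ne_zero_iff] at hm
    rw [Nat.mul_mod, iha hm.1 fun p hp hpa => h p hp (hpa.mul_right b),
      ihb hm.2 fun p hp hpb => h p hp (hpb.mul_left a)]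

theorem exists_int_of_isIntegral {x : ℚ} (h : IsIntegral ℤ ((x : ℚ) : ℝ)) : ∃ m : ℤ, (m : ℚ) = x := by
  have h' : IsIntegral ℤ x := by
    rw [← isIntegral_algebraMap_iff (B := ℝ) (algebraMap ℚ ℝ).injective]
    simpa using h
  obtain ⟨m, hm⟩ := IsIntegrallyClosed.isIntegral_iff.1 h'
  exact ⟨m, by simpa using hm⟩

theorem exists_int_of_sq_eq_intCast {x : ℚ} {m : ℤ} (h : x ^ 2 = m) : ∃ z : ℤ, (z : ℚ) = x := by
  have h' : IsIntegral ℤ x := by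
    apply IsIntegral.of_pow (n := 2) (by norm_num)
    rw [h]
    exact isIntegral_algebraMap (x := m)
  obtain ⟨m, hm⟩ := IsIntegrallyClosed.isIntegral_iff.1 h'
  exact ⟨m, by simpa using hm⟩

theorem exists_pell_of_half {l : ℕ} (hl : l.Prime) (hl8 : l % 8 = 1) {x y : ℤ}
    (h : x ^ 2 + 4 = l * y ^ 2) (hy : 0 < y) :
    ∃ a b : ℤ, x = 2 * a ∧ y = 2 * b ∧ a ^ 2 + 1 = l * b ^ 2 ∧ 4 ∣ a ∧ b % 4 = 1 ∧ 0 < b := by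
  have hl8' : (l : ℤ) = 8 * (l / 8 : ℤ) + 1 := by omega
  set t : ℤ := l / 8
  rcases Int.even_or_odd' x with ⟨a, rfl | rfl⟩
  · rcases Int.even_or_odd' y with ⟨b, rfl | rfl⟩
    · have h' : a ^ 2 + 1 = l * b ^ 2 := by linarith
      have hb0 : 0 < b := by omega
      have hb : Odd b := by
        by_contra hb
        obtain ⟨c, rfl⟩ := Int.not_odd_iff_even.1 hb
        have h4 : (4 : ℤ) ∣ a ^ 2 + 1 := ⟨l * c ^ 2, by rw [h']; ring⟩
        rcases Int.even_or_odd' a with ⟨d, rfl | rfl⟩ <;> ring_nf at h4 <;> omega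
      refine ⟨a, b, rfl, rfl, h', ?_, ?_, hb0⟩
      · have h8 : (8 : ℤ) ∣ a ^ 2 := by
          have := Int.sq_mod_four_eq_one_of_odd hb
          obtain ⟨c, rfl⟩ := hb
          obtain ⟨d, hd⟩ : Even (c * (c + 1)) := Int.even_mul_succ_self c
          exact ⟨t * (2 * c + 1) ^ 2 + d, by
            rw [hl8'] at h'
            linear_combination h' + 4 * hd⟩
        have h2 : (2 : ℤ) ∣ a := Int.prime_two.dvd_of_dvd_pow (dvd_trans (by norm_num) h8)
        obtain ⟨c, rfl⟩ := h2
        have h2' : (2 : ℤ) ∣ c ^ 2 := by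
          rw [mul_pow] at h8
          omega
        obtain ⟨d, rfl⟩ := Int.prime_two.dvd_of_dvd_pow h2'
        exact ⟨d, by ring⟩
      · have key : b.natAbs % 4 = 1 := by
          refine mod_four_eq_one_of_forall_prime (by omega) fun p hp hpb => ?_
          have := Fact.mk hp
          have hp2 : p ≠ 2 := by
            rintro rfl
            have := Int.natCast_dvd.2 hpb
            obtain ⟨c, rfl⟩ := hb
            push_cast at this
            omega
          have h3 : p % 4 ≠ 3 := by
            apply ZMod.mod_four_ne_three_of_sq_eq_neg_one (y := (a : ZMod p))
            have : ((a ^ 2 + 1 : ℤ) : ZMod p) = 0 := by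
              rw [h', ZMod.intCast_zmod_eq_zero_iff_dvd]
              exact ((Int.natCast_dvd.2 hpb).pow two_ne_zero).mul_left _
            push_cast at this
            linear_combination this
          have := hp.eq_two_or_odd
          omega
        omega
    · exfalso
      have : (4 * a ^ 2 + 4 : ℤ) = (8 * t + 1) * (2 * b + 1) ^ 2 := by rw [← hl8', ← h]; ring
      have h2 : (2 : ℤ) ∣ (8 * t + 1) * (2 * b + 1) ^ 2 := by rw [← this]; omega
      ring_nf at h2
      omega
  · exfalso
    rcases Int.even_or_odd' y with ⟨b, rfl | rfl⟩
    · have : (2 : ℤ) ∣ (2 * a + 1) ^ 2 + 4 := by rw [h]; exact ⟨l * b * (2 * b), by ring⟩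
      ring_nf at this
      omega
    · obtain ⟨c, hc⟩ : Even (a * (a + 1)) := Int.even_mul_succ_self a
      obtain ⟨d, hd⟩ : Even (b * (b + 1)) := Int.even_mul_succ_self b
      rw [hl8'] at h
      have : 8 * c + 5 = 8 * (t * (2 * b + 1) ^ 2 + d) + 1 := by
        linear_combination h - 4 * hc + 4 * hd
      omega

theorem exists_pell {l : ℕ} (hl : l.Prime) (hl8 : l % 8 = 1) {ε : ℝ} (h1 : 1 < ε)
    (hi : IsIntegral ℤ ε) (hi' : IsIntegral ℤ ε⁻¹) {u v : ℚ} (hε : ε = u + v * Real.sqrt l)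
    (hn : (u : ℝ) ^ 2 - (v : ℝ) ^ 2 * l = -1) :
    ∃ a b : ℤ, ε = a + b * Real.sqrt l ∧ a ^ 2 + 1 = l * b ^ 2 ∧ 4 ∣ a ∧ b % 4 = 1 ∧ 0 < b := by
  have hs : Real.sqrt l ^ 2 = l := Real.sq_sqrt (Nat.cast_nonneg _)
  have hs0 : 0 < Real.sqrt l := Real.sqrt_pos.2 (by exact_mod_cast hl.pos)
  have hinv : ε⁻¹ = -(u - v * Real.sqrt l) := by
    apply inv_eq_of_mul_eq_one_left
    rw [hε]
    linear_combination -hn + (v : ℝ) ^ 2 * hs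
  obtain ⟨x, hx⟩ : ∃ x : ℤ, (x : ℚ) = 2 * u := by
    apply exists_int_of_isIntegral
    have : (((2 * u : ℚ)) : ℝ) = ε - ε⁻¹ := by
      rw [hinv, hε]; push_cast; ring
    rw [this]
    exact hi.sub hi'
  have hn' : u ^ 2 - v ^ 2 * l = -1 := by exact_mod_cast hn
  obtain ⟨w, hw⟩ : ∃ w : ℤ, (w : ℚ) = 2 * v * l := by
    apply exists_int_of_sq_eq_intCast (m := l * (x ^ 2 + 4))
    push_cast
    rw [hx]
    linear_combination -4 * l * hn'
  have hlw : w ^ 2 = l * (x ^ 2 + 4) := by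
    have : (w : ℚ) ^ 2 = l * (x ^ 2 + 4) := by
      rw [hw, hx]
      linear_combination -4 * l * hn'
    exact_mod_cast this
  obtain ⟨y, rfl⟩ : (l : ℤ) ∣ w :=
    (Nat.prime_iff_prime_int.1 hl).dvd_of_dvd_pow (hlw ▸ dvd_mul_right _ _)
  have hl0 : (l : ℚ) ≠ 0 := by exact_mod_cast hl.ne_zero
  have hy : (y : ℚ) = 2 * v := by
    push_cast at hw
    exact mul_left_cancel₀ hl0 (by rw [hw]; ring)
  have hxy : x ^ 2 + 4 = l * y ^ 2 := by
    have : (x : ℚ) ^ 2 + 4 = l * y ^ 2 := by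
      rw [hx, hy]; linear_combination 4 * hn'
    exact_mod_cast this
  have hy0 : 0 < y := by
    have h2 : (0 : ℝ) < (y : ℝ) * Real.sqrt l := by
      have h3 : (y : ℝ) = 2 * v := by exact_mod_cast hy
      have h4 : 0 < ε⁻¹ := inv_pos.2 (by linarith)
      rw [h3]
      rw [hinv] at h4
      linarith
    exact_mod_cast pos_of_mul_pos_left h2 hs0.le
  obtain ⟨a, b, rfl, rfl, hab, h4, hb, hb0⟩ := exists_pell_of_half hl hl8 hxy hy0
  refine ⟨a, b, ?_, hab, h4, hb, hb0⟩
  have hu : u = a := by push_cast at hx; linarith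
  have hv : v = b := by push_cast at hy; linarith
  rw [hε, hu, hv]
  simp

end GenusCount

namespace GenusCount

open IsDedekindDomain nonZeroDivisors NumberField

theorem card_two_torsion_congr {K L : Type} [Field K] [Field L] (e : K ≃+* L) :
    Nat.card {c : ClassGroup (𝓞 K) // c ^ 2 = 1} =
      Nat.card {c : ClassGroup (𝓞 L) // c ^ 2 = 1} := by
  set E := ClassGroup.mulEquiv (RingOfIntegers.mapRingEquiv e)
  refine Nat.card_congr (E.toEquiv.subtypeEquiv fun c => ?_)
  change c ^ 2 = 1 ↔ E c ^ 2 = 1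
  rw [← map_pow, EmbeddingLike.map_eq_one_iff]

theorem not_isSquare_natCast {l : ℕ} (hl : l.Prime) : ¬IsSquare (l : ℚ) := by
  rintro ⟨x, hx⟩
  apply hl.irrational_sqrt
  refine ⟨|x|, ?_⟩
  rw [eq_comm, Real.sqrt_eq_iff_mul_self_eq (Nat.cast_nonneg _) (by positivity)]
  have : (l : ℝ) = x * x := by exact_mod_cast hx
  rw [this]
  simp

namespace Base

variable {k : Type} [Field k] [NumberField k] (B : Base k)

theorem not_isSquare_mul_α {n : ℕ} (hn0 : n ≠ 0) (hnl : n.Coprime B.l) :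
    ¬IsSquare ((n : k) * B.α) := by
  intro h
  obtain ⟨P, hP⟩ := exists_natCast_mem (k := k) B.prime
  have h1 := vord_intCast_eq_zero (k := k) B.prime hP (z := n) (by
    rw [Int.natCast_dvd_natCast]
    intro h
    exact B.prime.one_lt.ne' (Nat.dvd_one.1 (hnl.gcd_eq_one ▸ Nat.dvd_gcd h dvd_rfl)))
  rw [Int.cast_natCast] at h1
  have h2 := vord_sq_even P h
  rw [vord_mul P (by exact_mod_cast hn0) B.α_ne_zero, h1, B.vord_α, B.vord_δ_eq_one hP] at h2
  exact absurd h2 (by decide)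

theorem pos_α_eq : B.pos B.α = Real.sqrt B.l * (B.a + B.b * Real.sqrt B.l) := by
  have hs : Real.sqrt B.l ^ 2 = B.l := Real.sq_sqrt (Nat.cast_nonneg _)
  rw [B.α_eq, map_add, map_mul, map_mul, B.pos_s, map_natCast, map_intCast, map_intCast]
  linear_combination -(B.b : ℝ) * hs

theorem a_ne_zero : B.a ≠ 0 := by
  intro h
  have h1 := B.pell
  rw [h] at h1
  have h2 : (B.l : ℤ) ∣ 1 := ⟨B.b ^ 2, by linarith⟩
  exact B.prime.one_lt.ne' (by exact_mod_cast Int.eq_one_of_dvd_one (by positivity) h2)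

variable {K : Type} [Field K] [NumberField K] [Algebra k K] (Q : QuadExt k K) {n : ℕ} {θ : ℝ}
  (hθ : θ ^ 2 = B.pos Q.d)

theorem fieldRange_lift (hn0 : n ≠ 0) (hd : Q.d = n * B.α) :
    (Q.lift B.pos θ hθ).toRatAlgHom.fieldRange = IntermediateField.adjoin ℚ {θ} := by
  have hθm : θ ∈ IntermediateField.adjoin ℚ ({θ} : Set ℝ) :=
    IntermediateField.mem_adjoin_simple_self ℚ θ
  apply le_antisymm
  · have hs : Real.sqrt B.l ∈ IntermediateField.adjoin ℚ ({θ} : Set ℝ) := by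
      have h1 : Real.sqrt B.l = (θ ^ 2 / n - B.l * B.b) / B.a := by
        have ha : (B.a : ℝ) ≠ 0 := by exact_mod_cast B.a_ne_zero
        have hn : (n : ℝ) ≠ 0 := by exact_mod_cast hn0
        rw [hθ, hd, map_mul, map_natCast, mul_div_cancel_left₀ _ hn, B.α_eq, map_add, map_mul,
          map_mul, B.pos_s, map_natCast, map_intCast, map_intCast]
        field_simp
        ring
      rw [h1]
      exact div_mem (sub_mem (div_mem (pow_mem hθm 2) (natCast_mem _ n))
        (mul_mem (natCast_mem _ _) (_root_.intCast_mem _ _))) (_root_.intCast_mem _ _)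
    have hk : ∀ x : k, B.pos x ∈ IntermediateField.adjoin ℚ ({θ} : Set ℝ) := by
      intro x
      obtain ⟨u, v, rfl⟩ := B.Q.gen x
      rw [map_add, map_mul, B.pos_s]
      simp only [eq_ratCast, map_ratCast]
      exact add_mem (IntermediateField.algebraMap_mem _ u)
        (mul_mem (IntermediateField.algebraMap_mem _ v) hs)
    rintro _ ⟨y, rfl⟩
    obtain ⟨u, v, rfl⟩ := Q.gen y
    change Q.lift B.pos θ hθ _ ∈ _
    rw [Q.lift_apply]
    exact add_mem (hk u) (mul_mem (hk v) hθm)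
  · rw [IntermediateField.adjoin_le_iff, Set.singleton_subset_iff]
    exact ⟨Q.δ, Q.lift_δ B.pos θ hθ⟩

end Base

theorem twoTorsCard_eq {l n : ℕ} (hl : l.Prime) (hl8 : l % 8 = 1) {a b : ℤ}
    (hab : a ^ 2 + 1 = l * b ^ 2) (ha : 4 ∣ a) (hb : b % 4 = 1) (hb0 : 0 < b) (hn0 : n ≠ 0)
    (hnl : n.Coprime l) :
    ∃ (k : Type) (_ : Field k) (_ : NumberField k) (B : Base k) (K : Type) (_ : Field K)
      (_ : NumberField K) (_ : Algebra k K) (Q : QuadExt k K), B.l = l ∧ Q.d = n * B.α ∧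
      twoTorsCard (IntermediateField.adjoin ℚ
        {Real.sqrt (n * (a + b * Real.sqrt l) * Real.sqrt l)}) =
        Nat.card {c : ClassGroup (𝓞 K) // c ^ 2 = 1} := by
  obtain ⟨k, _, _, algk, Q₀, hQ₀⟩ := QuadExt.exists_of_not_isSquare (not_isSquare_natCast hl)
  obtain rfl : algk = DivisionRing.toRatAlgebra := Subsingleton.elim _ _
  let B : Base k := ⟨Q₀, l, hl, hl8, hQ₀, a, b, hab, ha, hb, hb0⟩
  obtain ⟨K, _, _, _, Q, hQ⟩ := QuadExt.exists_of_not_isSquare (B.not_isSquare_mul_α hn0 hnl)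
  refine ⟨k, _, _, B, K, _, inferInstance, _, Q, rfl, hQ, ?_⟩
  have hpos : (0 : ℝ) < B.pos Q.d := by
    rw [hQ, map_mul, map_natCast]
    exact mul_pos (by exact_mod_cast Nat.pos_of_ne_zero hn0) B.pos_α
  have hval : B.pos Q.d = n * (a + b * Real.sqrt l) * Real.sqrt l := by
    rw [hQ, map_mul, map_natCast, B.pos_α_eq]
    change (n : ℝ) * (Real.sqrt l * (a + b * Real.sqrt l)) = _
    ring
  rw [← hval, ← B.fieldRange_lift Q (Real.sq_sqrt hpos.le) hn0 hQ]
  exact (card_two_torsion_congr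
    (AlgEquiv.ofInjectiveField (Q.lift B.pos _ (Real.sq_sqrt hpos.le)).toRatAlgHom).toRingEquiv).symm

theorem twoTorsCard_eq_eight_iff {l : ℕ} (hl : l.Prime) (hl8 : l % 8 = 1) {ε : ℝ}
    (hε : IsFundamentalUnit l ε)
    (hnorm : ∃ u v : ℚ, ε = (u : ℝ) + (v : ℝ) * Real.sqrt (l : ℝ) ∧
      (u : ℝ) ^ 2 - (v : ℝ) ^ 2 * (l : ℝ) = -1)
    {n : ℕ} (hsq : Squarefree n) (hnl : n.Coprime l) :
    twoTorsCard (IntermediateField.adjoin ℚ {Real.sqrt (n * ε * Real.sqrt l)}) = 2 ^ 3 ↔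
      Forms l n := by
  obtain ⟨u, v, huv, hn⟩ := hnorm
  obtain ⟨h1, -, hi, hi', -⟩ := hε
  obtain ⟨a, b, rfl, hab, ha, hb, hb0⟩ := exists_pell hl hl8 h1 hi hi' huv hn
  obtain ⟨k, _, _, B, K, _, _, _, Q, rfl, hd, hcard⟩ :=
    twoTorsCard_eq hl hl8 hab ha hb hb0 hsq.ne_zero hnl
  rw [hcard]
  refine forms_iff hl hsq hnl fun T δ hT hδ hn => ?_
  exact B.card_two_torsion_eq_eight_iff hT hδ Q (by rw [hd, hn])

end GenusCount

/-- `l ≡ 1 (mod 8)` prime, `n` squarefree positive coprime to `l`,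
`𝕂 = ℚ(√(n·ε₀·√l))`.  One has `r₂(H) = 3` (i.e. the 2-torsion of the class group
has exactly `2³ = 8` elements) iff `n` has one of the eleven listed forms
(`p, p₁, p₂, p₃` distinct primes `≡ 1 (mod 4)`, `q, q₁, …, q₄` distinct primes
`≡ 3 (mod 4)`, all coprime to `l`, `δ ∈ {1,2}`; "for some ordering" clauses are
absorbed by the symmetric existential quantifiers). -/
theorem stmt_15 (l : ℕ) (hl : l.Prime) (hl8 : l % 8 = 1)
    (ε₀ : ℝ) (hε : IsFundamentalUnit l ε₀)
    (hεnorm : ∃ u v : ℚ, ε₀ = (u : ℝ) + (v : ℝ) * Real.sqrt (l : ℝ) ∧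
      (u : ℝ) ^ 2 - (v : ℝ) ^ 2 * (l : ℝ) = -1)
    (n : ℕ) (hn0 : 0 < n) (hnsq : Squarefree n) (hnl : n.Coprime l)
    (K : IntermediateField ℚ ℝ)
    (hK : K = IntermediateField.adjoin ℚ
      ({Real.sqrt ((n : ℝ) * ε₀ * Real.sqrt (l : ℝ))} : Set ℝ))
    [NumberField K] :
    twoTorsCard K = 2 ^ 3 ↔
      ((∃ p : ℕ, p.Prime ∧ p % 4 = 1 ∧ p ≠ l ∧ n = 2 * p ∧
          ((legSym l p = -1 ∧ quartSym l 2 = (-1 : ℤ) ^ ((l - 1) / 8)) ∨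
            (legSym l p = 1 ∧ (quartSym l 2 ≠ (-1 : ℤ) ^ ((l - 1) / 8) ∨
              quartSym l p ≠ quartSym p l)))) ∨
        (∃ p₁ p₂ : ℕ, p₁.Prime ∧ p₂.Prime ∧ p₁ % 4 = 1 ∧ p₂ % 4 = 1 ∧
          p₁ ≠ l ∧ p₂ ≠ l ∧ p₁ ≠ p₂ ∧ n = p₁ * p₂ ∧
          ((legSym l p₁ = 1 ∧ legSym l p₂ = 1 ∧
              (quartSym l p₁ ≠ quartSym p₁ l ∨ quartSym l p₂ ≠ quartSym p₂ l)) ∨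
            (legSym l p₁ = -1 ∧ legSym l p₂ = 1 ∧ quartSym l p₂ = quartSym p₂ l))) ∨
        (∃ p₁ p₂ : ℕ, p₁.Prime ∧ p₂.Prime ∧ p₁ % 4 = 1 ∧ p₂ % 4 = 1 ∧
          p₁ ≠ l ∧ p₂ ≠ l ∧ p₁ ≠ p₂ ∧ n = 2 * (p₁ * p₂) ∧
          legSym l p₁ = -1 ∧ legSym l p₂ = -1 ∧
          quartSym l 2 ≠ (-1 : ℤ) ^ ((l - 1) / 8)) ∨
        (∃ p₁ p₂ p₃ : ℕ, p₁.Prime ∧ p₂.Prime ∧ p₃.Prime ∧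
          p₁ % 4 = 1 ∧ p₂ % 4 = 1 ∧ p₃ % 4 = 1 ∧ p₁ ≠ l ∧ p₂ ≠ l ∧ p₃ ≠ l ∧
          p₁ ≠ p₂ ∧ p₁ ≠ p₃ ∧ p₂ ≠ p₃ ∧ n = p₁ * p₂ * p₃ ∧
          ((legSym l p₁ = -1 ∧ legSym l p₂ = -1 ∧ legSym l p₃ = -1) ∨
            (legSym l p₁ = -1 ∧ legSym l p₂ = -1 ∧ legSym l p₃ = 1 ∧
              quartSym l p₃ ≠ quartSym p₃ l))) ∨
        (∃ δ q₁ q₂ q₃ : ℕ, (δ = 1 ∨ δ = 2) ∧ q₁.Prime ∧ q₂.Prime ∧ q₃.Prime ∧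
          q₁ % 4 = 3 ∧ q₂ % 4 = 3 ∧ q₃ % 4 = 3 ∧ q₁ ≠ l ∧ q₂ ≠ l ∧ q₃ ≠ l ∧
          q₁ ≠ q₂ ∧ q₁ ≠ q₃ ∧ q₂ ≠ q₃ ∧ n = δ * (q₁ * q₂ * q₃) ∧
          legSym l q₁ = -1 ∧ legSym l q₂ = -1 ∧ legSym l q₃ = -1) ∨
        (∃ q₁ q₂ q₃ q₄ : ℕ, q₁.Prime ∧ q₂.Prime ∧ q₃.Prime ∧ q₄.Prime ∧
          q₁ % 4 = 3 ∧ q₂ % 4 = 3 ∧ q₃ % 4 = 3 ∧ q₄ % 4 = 3 ∧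
          q₁ ≠ l ∧ q₂ ≠ l ∧ q₃ ≠ l ∧ q₄ ≠ l ∧
          q₁ ≠ q₂ ∧ q₁ ≠ q₃ ∧ q₁ ≠ q₄ ∧ q₂ ≠ q₃ ∧ q₂ ≠ q₄ ∧ q₃ ≠ q₄ ∧
          n = q₁ * q₂ * q₃ * q₄ ∧
          (Finset.filter (fun x : ℕ => legSym l (x : ℤ) = 1)
            ({q₁, q₂, q₃, q₄} : Finset ℕ)).card ≤ 1) ∨
        (∃ q₁ q₂ : ℕ, q₁.Prime ∧ q₂.Prime ∧ q₁ % 4 = 3 ∧ q₂ % 4 = 3 ∧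
          q₁ ≠ l ∧ q₂ ≠ l ∧ q₁ ≠ q₂ ∧ n = 2 * (q₁ * q₂) ∧
          (legSym l q₁ = -1 ∨ legSym l q₂ = -1)) ∨
        (∃ δ p₁ p₂ q : ℕ, (δ = 1 ∨ δ = 2) ∧ p₁.Prime ∧ p₂.Prime ∧
          p₁ % 4 = 1 ∧ p₂ % 4 = 1 ∧ p₁ ≠ l ∧ p₂ ≠ l ∧ p₁ ≠ p₂ ∧
          q.Prime ∧ q % 4 = 3 ∧ q ≠ l ∧ n = δ * (p₁ * p₂ * q) ∧
          legSym l p₁ = -1 ∧ legSym l p₂ = -1 ∧ legSym l q = -1) ∨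
        (∃ δ p q : ℕ, (δ = 1 ∨ δ = 2) ∧ p.Prime ∧ p % 4 = 1 ∧ p ≠ l ∧
          q.Prime ∧ q % 4 = 3 ∧ q ≠ l ∧ n = δ * (p * q) ∧
          legSym l p ≠ legSym l q) ∨
        (∃ p₁ p₂ q₁ q₂ : ℕ, p₁.Prime ∧ p₂.Prime ∧ p₁ % 4 = 1 ∧ p₂ % 4 = 1 ∧
          p₁ ≠ l ∧ p₂ ≠ l ∧ p₁ ≠ p₂ ∧ q₁.Prime ∧ q₂.Prime ∧
          q₁ % 4 = 3 ∧ q₂ % 4 = 3 ∧ q₁ ≠ l ∧ q₂ ≠ l ∧ q₁ ≠ q₂ ∧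
          n = p₁ * p₂ * (q₁ * q₂) ∧ legSym l p₁ = -1 ∧ legSym l p₂ = -1 ∧
          (Finset.filter (fun x : ℕ => legSym l (x : ℤ) = 1)
            ({q₁, q₂} : Finset ℕ)).card ≤ 1) ∨
        (∃ p q₁ q₂ : ℕ, p.Prime ∧ p % 4 = 1 ∧ p ≠ l ∧
          q₁.Prime ∧ q₂.Prime ∧ q₁ % 4 = 3 ∧ q₂ % 4 = 3 ∧
          q₁ ≠ l ∧ q₂ ≠ l ∧ q₁ ≠ q₂ ∧ n = p * (q₁ * q₂) ∧
          ((legSym l p = 1 ∧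
              (Finset.filter (fun x : ℕ => legSym l (x : ℤ) = 1)
                ({q₁, q₂} : Finset ℕ)).card ≤ 1) ∨
            (legSym l p = -1 ∧ legSym l q₁ = 1 ∧ legSym l q₂ = 1)))) := by
  subst hK
  exact GenusCount.twoTorsCard_eq_eight_iff hl hl8 hε hεnorm hnsq hnl
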